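/- There exists a unique minimax L_H-solution of (TVP), and it equals u_0, the pointwise infimum of all non-continuous minimax L_H-supersolutions of (TVP). -/

import Mathlib

open MeasureTheory Set Filter Topology
open scoped InnerProductSpace

noncomputable section

namespace PHJ

/-- The Euclidean state space `ℝ^d`. -/
abbrev E (d : ℕ) := EuclideanSpace ℝ (Fin d)

/-- A path; only its values on `[0, T]` are relevant. -/
abbrev Path (d : ℕ) := ℝ → E d

/-- The set `Ω = D([0,T], ℝ^d)` of paths that are right-continuous on `[0,T)` and have
left limits on `(0,T]`. -/
def Cadlag (T : ℝ) (d : ℕ) : Set (Path d) :=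
  {x | (∀ t ∈ Ico (0 : ℝ) T, ContinuousWithinAt x (Ici t) t) ∧
       (∀ t ∈ Ioc (0 : ℝ) T, ∃ l : E d, Tendsto x (nhdsWithin t (Iio t)) (nhds l))}

/-- The running supremum `sup_{0 ≤ s ≤ t} |x(s)|`. -/
def runSup (d : ℕ) (x : Path d) (t : ℝ) : ℝ :=
  sSup ((fun s => ‖x s‖) '' Icc 0 t)

/-- The supremum distance `sup_{0 ≤ s ≤ T} |x(s) − y(s)|`. -/
def supDist (T : ℝ) (d : ℕ) (x y : Path d) : ℝ :=
  sSup ((fun s => ‖x s - y s‖) '' Icc 0 T)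

/-- The stopped supremum distance `sup_{0 ≤ r ≤ T} |x(r ∧ t) − y(r ∧ s)|`. -/
def stopDist (T : ℝ) (d : ℕ) (t : ℝ) (x : Path d) (s : ℝ) (y : Path d) : ℝ :=
  sSup ((fun r => ‖x (min r t) - y (min r s)‖) '' Icc 0 T)

/-- The pseudometric `d_∞` on `[0,T] × Ω`. -/
def dInf (T : ℝ) (d : ℕ) (p q : ℝ × Path d) : ℝ :=
  |p.1 - q.1| + stopDist T d p.1 p.2 q.1 q.2

/-- `g` is an integrable a.e.-derivative of `x` on `[s₀, T]` (so that `x` is absolutely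
continuous there) satisfying the growth bound `|x′(t)| ≤ L (1 + sup_{s ≤ t} |x(s)|)` a.e. -/
def XDeriv (T : ℝ) (d : ℕ) (L s₀ : ℝ) (x g : Path d) : Prop :=
  IntegrableOn g (Icc s₀ T) volume ∧
  (∀ t ∈ Icc s₀ T, x t = x s₀ + ∫ s in s₀..t, g s) ∧
  (∀ᵐ t ∂(volume.restrict (Ioo s₀ T)), ‖g t‖ ≤ L * (1 + runSup d x t))

/-- The set `X^L(s₀, x₀)` of "Lipschitz-like" paths. -/
def XSet (T : ℝ) (d : ℕ) (L s₀ : ℝ) (x₀ : Path d) : Set (Path d) :=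
  {x | x ∈ Cadlag T d ∧ (∀ t ∈ Icc 0 s₀, x t = x₀ t) ∧ ∃ g, XDeriv T d L s₀ x g}

/-- Type of Hamiltonians `H(t, x, y, z)`. -/
abbrev Ham (d : ℕ) := ℝ → Path d → ℝ → E d → ℝ

/-- The set `Y^L(s₀, x₀, y₀, z)` of characteristic pairs `(x, y)`. -/
def YSet (T : ℝ) (d : ℕ) (H : Ham d) (L s₀ : ℝ) (x₀ : Path d) (y₀ : ℝ) (z : E d) :
    Set (Path d × (ℝ → ℝ)) :=
  {p | p.1 ∈ Cadlag T d ∧ (∀ t ∈ Icc 0 s₀, p.1 t = x₀ t) ∧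
       ContinuousOn p.2 (Icc s₀ T) ∧
       ∃ g, XDeriv T d L s₀ p.1 g ∧
         IntegrableOn (fun s => ⟪g s, z⟫_ℝ - H s p.1 (p.2 s) z) (Icc s₀ T) volume ∧
         ∀ t ∈ Icc s₀ T, p.2 t = y₀ + ∫ s in s₀..t, (⟪g s, z⟫_ℝ - H s p.1 (p.2 s) z)}

/-- Assumption (i): for a.e. `t`, `(x, y, z) ↦ H(t, x, y, z)` is continuous. -/
def HamCont (T : ℝ) (d : ℕ) (H : Ham d) : Prop :=
  ∀ᵐ t ∂(volume.restrict (Ioo (0 : ℝ) T)),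
    ∀ x ∈ Cadlag T d, ∀ (y : ℝ) (z : E d), ∀ ε > (0 : ℝ), ∃ δ > (0 : ℝ),
      ∀ x' ∈ Cadlag T d, ∀ (y' : ℝ) (z' : E d),
        supDist T d x x' < δ → |y - y'| < δ → ‖z - z'‖ < δ →
        |H t x y z - H t x' y' z'| < ε

/-- Assumption (ii): `t ↦ H(t, x, y, z)` is Borel measurable. -/
def HamMeas (d : ℕ) (H : Ham d) : Prop :=
  ∀ (x : Path d) (y : ℝ) (z : E d), Measurable fun t => H t x y z

/-- Assumption (iii): Lipschitz continuity in `z` with constant `L_H (1 + sup_{s≤t} |x(s)|)`. -/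
def HamLipZ (T : ℝ) (d : ℕ) (H : Ham d) (LH : ℝ) : Prop :=
  0 ≤ LH ∧ ∀ᵐ t ∂(volume.restrict (Ioo (0 : ℝ) T)),
    ∀ x ∈ Cadlag T d, ∀ (y : ℝ) (z z' : E d),
      |H t x y z - H t x y z'| ≤ LH * (1 + runSup d x t) * ‖z - z'‖

/-- Assumption (iv): local Lipschitz continuity in `x` along `X^L`-paths,
with constant `M L`. -/
def HamLipX (T : ℝ) (d : ℕ) (H : Ham d) (M : ℝ → ℝ) : Prop :=
  ∀ L ≥ (0 : ℝ), 0 ≤ M L ∧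
    ∀ t₀ ∈ Ico (0 : ℝ) T, ∀ x₀ ∈ Cadlag T d,
      ∀ x ∈ XSet T d L t₀ x₀, ∀ x' ∈ XSet T d L t₀ x₀, ∀ (y : ℝ) (z : E d),
        ∀ᵐ t ∂(volume.restrict (Ioo t₀ T)),
          |H t x y z - H t x' y z| ≤
            M L * (1 + |y| + ‖z‖) * sSup ((fun s => ‖x s - x' s‖) '' Icc 0 t)

/-- Assumption (v): `y ↦ H(t, x, y, z)` is non-increasing. -/
def HamMono (T : ℝ) (d : ℕ) (H : Ham d) : Prop :=
  ∀ᵐ t ∂(volume.restrict (Ioo (0 : ℝ) T)),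
    ∀ x ∈ Cadlag T d, ∀ (z : E d) (y y' : ℝ), y ≤ y' → H t x y' z ≤ H t x y z

/-- Assumption (vi): growth bound `|H(t, x, y, 0)| ≤ C_H (1 + sup_{s≤t}|x(s)| + |y|)`. -/
def HamBound (T : ℝ) (d : ℕ) (H : Ham d) (CH : ℝ) : Prop :=
  0 ≤ CH ∧ ∀ᵐ t ∂(volume.restrict (Ioo (0 : ℝ) T)),
    ∀ x ∈ Cadlag T d, ∀ y : ℝ, |H t x y 0| ≤ CH * (1 + runSup d x t + |y|)

/-- Lower semicontinuity on `[0,T] × Ω` with respect to `d_∞`. -/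
def LscOn (T : ℝ) (d : ℕ) (u : ℝ → Path d → ℝ) : Prop :=
  ∀ t₀ ∈ Icc (0 : ℝ) T, ∀ x₀ ∈ Cadlag T d, ∀ c : ℝ, c < u t₀ x₀ →
    ∃ δ > (0 : ℝ), ∀ t ∈ Icc (0 : ℝ) T, ∀ x ∈ Cadlag T d,
      dInf T d (t₀, x₀) (t, x) < δ → c < u t x

/-- Upper semicontinuity on `[0,T] × Ω` with respect to `d_∞`. -/
def UscOn (T : ℝ) (d : ℕ) (u : ℝ → Path d → ℝ) : Prop :=
  ∀ t₀ ∈ Icc (0 : ℝ) T, ∀ x₀ ∈ Cadlag T d, ∀ c : ℝ, u t₀ x₀ < c →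
    ∃ δ > (0 : ℝ), ∀ t ∈ Icc (0 : ℝ) T, ∀ x ∈ Cadlag T d,
      dInf T d (t₀, x₀) (t, x) < δ → u t x < c

/-- Continuity of the terminal condition `h` with respect to the sup norm. -/
def TermCont (T : ℝ) (d : ℕ) (h : Path d → ℝ) : Prop :=
  ∀ x ∈ Cadlag T d, ∀ ε > (0 : ℝ), ∃ δ > (0 : ℝ), ∀ x' ∈ Cadlag T d,
    supDist T d x x' < δ → |h x' - h x| < ε

/-- `u` is a minimax `L`-supersolution of the terminal-value problem (TVP). -/
def MinimaxSuper (T : ℝ) (d : ℕ) (H : Ham d) (h : Path d → ℝ) (L : ℝ)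
    (u : ℝ → Path d → ℝ) : Prop :=
  LscOn T d u ∧ (∀ x ∈ Cadlag T d, h x ≤ u T x) ∧
  ∀ s₀ ∈ Ico (0 : ℝ) T, ∀ x₀ ∈ Cadlag T d, ∀ (z : E d) (y₀ : ℝ), u s₀ x₀ ≤ y₀ →
    ∃ p ∈ YSet T d H L s₀ x₀ y₀ z, ∀ t ∈ Icc s₀ T, u t p.1 ≤ p.2 t

/-- `u` is a minimax `L`-subsolution of the terminal-value problem (TVP). -/
def MinimaxSub (T : ℝ) (d : ℕ) (H : Ham d) (h : Path d → ℝ) (L : ℝ)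
    (u : ℝ → Path d → ℝ) : Prop :=
  UscOn T d u ∧ (∀ x ∈ Cadlag T d, u T x ≤ h x) ∧
  ∀ s₀ ∈ Ico (0 : ℝ) T, ∀ x₀ ∈ Cadlag T d, ∀ (z : E d) (y₀ : ℝ), y₀ ≤ u s₀ x₀ →
    ∃ p ∈ YSet T d H L s₀ x₀ y₀ z, ∀ t ∈ Icc s₀ T, p.2 t ≤ u t p.1

/-- `u` is a minimax `L`-solution of the terminal-value problem (TVP). -/
def MinimaxSol (T : ℝ) (d : ℕ) (H : Ham d) (h : Path d → ℝ) (L : ℝ)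
    (u : ℝ → Path d → ℝ) : Prop :=
  MinimaxSuper T d H h L u ∧ MinimaxSub T d H h L u

/-- Embedding of a path into the space of functions on `[0,T]` with the topology of
uniform convergence (i.e. the sup-norm topology). -/
def toUnif (T : ℝ) (d : ℕ) (x : Path d) : UniformFun (Icc (0 : ℝ) T) (E d) :=
  UniformFun.ofFun fun s => x s.1

/-- Embedding of a real-valued function into the space of functions on `[s₀,T]` with the
topology of uniform convergence. -/
def toUnifR (T s₀ : ℝ) (y : ℝ → ℝ) : UniformFun (Icc s₀ T) ℝ :=
  UniformFun.ofFun fun s => y s.1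


/-- Continuity on `[0,T] × Ω` with respect to `d_∞`. -/
def Cont2 (T : ℝ) (d : ℕ) (u : ℝ → Path d → ℝ) : Prop :=
  ∀ t₀ ∈ Icc (0 : ℝ) T, ∀ x₀ ∈ Cadlag T d, ∀ ε > (0 : ℝ), ∃ δ > (0 : ℝ),
    ∀ t ∈ Icc (0 : ℝ) T, ∀ x ∈ Cadlag T d,
      dInf T d (t₀, x₀) (t, x) < δ → |u t x - u t₀ x₀| < ε

/-- `u : [0,T] × Ω → [−∞,∞]` is a non-continuous minimax `L`-supersolution of (TVP). -/
def NCSuper (T : ℝ) (d : ℕ) (H : Ham d) (h : Path d → ℝ) (L : ℝ)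
    (u : ℝ → Path d → EReal) : Prop :=
  (∀ x ∈ Cadlag T d, u T x = ((h x : ℝ) : EReal)) ∧
  ∀ t₀ ∈ Ico (0 : ℝ) T, ∀ x₀ ∈ Cadlag T d, ∀ (z : E d) (y₀ : ℝ),
    u t₀ x₀ < ((y₀ : ℝ) : EReal) → ∀ T₀ ∈ Ioc t₀ T,
      sInf ((fun p : Path d × (ℝ → ℝ) => u T₀ p.1 - ((p.2 T₀ : ℝ) : EReal)) ''
        YSet T d H L t₀ x₀ y₀ z) ≤ 0

/-- `u : [0,T] × Ω → [−∞,∞]` is a non-continuous minimax `L`-subsolution of (TVP). -/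
def NCSub (T : ℝ) (d : ℕ) (H : Ham d) (h : Path d → ℝ) (L : ℝ)
    (u : ℝ → Path d → EReal) : Prop :=
  (∀ x ∈ Cadlag T d, u T x = ((h x : ℝ) : EReal)) ∧
  ∀ t₀ ∈ Ico (0 : ℝ) T, ∀ x₀ ∈ Cadlag T d, ∀ (z : E d) (y₀ : ℝ),
    ((y₀ : ℝ) : EReal) < u t₀ x₀ → ∀ T₀ ∈ Ioc t₀ T,
      0 ≤ sSup ((fun p : Path d × (ℝ → ℝ) => u T₀ p.1 - ((p.2 T₀ : ℝ) : EReal)) ''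
        YSet T d H L t₀ x₀ y₀ z)

/-- The function `μ^z_+(t₀, x₀, y₀) = sup{ h(x) − y(T) : (x,y) ∈ Y^{L_H}(t₀,x₀,y₀,z) }`. -/
def muPlus (T : ℝ) (d : ℕ) (H : Ham d) (h : Path d → ℝ) (LH : ℝ) (z : E d)
    (t₀ : ℝ) (x₀ : Path d) (y₀ : ℝ) : EReal :=
  sSup ((fun p : Path d × (ℝ → ℝ) => ((h p.1 - p.2 T : ℝ) : EReal)) ''
    YSet T d H LH t₀ x₀ y₀ z)

/-- The function `u^z_+` given by `u^z_+(t₀,x₀) = sup{ r ∈ ℝ : μ^z_+(t₀,x₀,r) ≥ 0 }`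
(with `sup ∅ = −∞`) for `t₀ < T`, and `u^z_+(T,·) = h`. -/
def uPlus (T : ℝ) (d : ℕ) (H : Ham d) (h : Path d → ℝ) (LH : ℝ) (z : E d)
    (t₀ : ℝ) (x₀ : Path d) : EReal :=
  if t₀ = T then ((h x₀ : ℝ) : EReal)
  else sSup {v : EReal | ∃ r : ℝ, v = ((r : ℝ) : EReal) ∧ 0 ≤ muPlus T d H h LH z t₀ x₀ r}

/-- The Perron-type function `u₀`, the pointwise infimum of all non-continuous minimax
`L_H`-supersolutions of (TVP). -/
def uZero (T : ℝ) (d : ℕ) (H : Ham d) (h : Path d → ℝ) (LH : ℝ)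
    (t : ℝ) (x : Path d) : EReal :=
  sInf {v : EReal | ∃ u : ℝ → Path d → EReal, NCSuper T d H h LH u ∧ v = u t x}

/-- The upper semicontinuous envelope with respect to `d_∞` of an extended-real-valued
function on `[0,T] × Ω`. -/
def uscEnv (T : ℝ) (d : ℕ) (u : ℝ → Path d → EReal) (t₀ : ℝ) (x₀ : Path d) : EReal :=
  ⨅ δ ∈ Ioi (0 : ℝ),
    sSup {v : EReal | ∃ t ∈ Icc (0 : ℝ) T, ∃ x ∈ Cadlag T d,
      dInf T d (t₀, x₀) (t, x) < δ ∧ v = u t x}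

/-- The lower semicontinuous envelope with respect to `d_∞` of an extended-real-valued
function on `[0,T] × Ω`. -/
def lscEnv (T : ℝ) (d : ℕ) (u : ℝ → Path d → EReal) (t₀ : ℝ) (x₀ : Path d) : EReal :=
  ⨆ δ ∈ Ioi (0 : ℝ),
    sInf {v : EReal | ∃ t ∈ Icc (0 : ℝ) T, ∃ x ∈ Cadlag T d,
      dInf T d (t₀, x₀) (t, x) < δ ∧ v = u t x}


section

variable {T : ℝ} {d : ℕ}

theorem Cadlag.bounded {x : Path d} (hx : x ∈ Cadlag T d) : ∃ B, ∀ t ∈ Icc 0 T, ‖x t‖ ≤ B := by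
  refine isCompact_Icc.induction_on (p := fun s => ∃ B, ∀ t ∈ s, ‖x t‖ ≤ B) ⟨0, by simp⟩
    (fun s t hst ⟨B, hB⟩ => ⟨B, fun r hr => hB r (hst hr)⟩)
    (fun s t ⟨B, hB⟩ ⟨C, hC⟩ => ⟨max B C, fun r hr => hr.elim
      (fun h => (hB r h).trans (le_max_left _ _)) (fun h => (hC r h).trans (le_max_right _ _))⟩) ?_
  intro t ht
  have hl : ∃ B, ∀ᶠ s in 𝓝[Icc 0 T ∩ Iio t] t, ‖x s‖ ≤ B := by
    rcases ht.1.eq_or_lt with h | h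
    · refine ⟨0, ?_⟩
      have : Icc 0 T ∩ Iio t = ∅ := by
        ext s; simp only [mem_inter_iff, mem_Icc, mem_Iio, mem_empty_iff_false, iff_false]
        rintro ⟨⟨h1, _⟩, h2⟩; linarith
      simp [this]
    · obtain ⟨l, hl⟩ := hx.2 t ⟨h, ht.2⟩
      refine ⟨‖l‖ + 1, ?_⟩
      have := (hl.norm.eventually (gt_mem_nhds (lt_add_one ‖l‖)))
      exact (this.filter_mono (nhdsWithin_mono _ inter_subset_right)).mono fun _ h => h.le
  have hr : ∃ B, ∀ᶠ s in 𝓝[Icc 0 T ∩ Ici t] t, ‖x s‖ ≤ B := by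
    refine ⟨‖x t‖ + 1, ?_⟩
    rcases ht.2.eq_or_lt with h | h
    · have : Icc 0 T ∩ Ici t = {t} := by
        ext s; simp only [mem_inter_iff, mem_Icc, mem_Ici, mem_singleton_iff]
        constructor
        · rintro ⟨⟨_, h1⟩, h2⟩; linarith
        · rintro rfl; exact ⟨ht, le_rfl⟩
      rw [this, nhdsWithin_singleton]
      simp
    · have := ((hx.1 t ⟨ht.1, h⟩).norm.eventually (gt_mem_nhds (lt_add_one ‖x t‖)))
      exact (this.filter_mono (nhdsWithin_mono _ inter_subset_right)).mono fun _ h => h.le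
  obtain ⟨B, hB⟩ := hl
  obtain ⟨C, hC⟩ := hr
  refine ⟨{s | ‖x s‖ ≤ max B C}, ?_, max B C, fun s hs => hs⟩
  have : Icc 0 T = (Icc 0 T ∩ Iio t) ∪ (Icc 0 T ∩ Ici t) := by
    rw [← inter_union_distrib_left]; simp
  rw [this, nhdsWithin_union]
  exact Filter.mem_sup.2 ⟨hB.mono fun _ h => h.trans (le_max_left _ _),
    hC.mono fun _ h => h.trans (le_max_right _ _)⟩

theorem Cadlag.of_agree {s₀ : ℝ} {x x₀ : Path d} (hx₀ : x₀ ∈ Cadlag T d)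
    (h : ∀ t ∈ Icc 0 s₀, x t = x₀ t) (hc : ContinuousOn x (Icc s₀ T)) : x ∈ Cadlag T d := by
  constructor
  · intro t ht
    rcases lt_or_ge t s₀ with hts | hts
    · have h1 := hx₀.1 t ht
      refine h1.congr_of_eventuallyEq ?_ (h t ⟨ht.1, hts.le⟩)
      filter_upwards [self_mem_nhdsWithin, mem_nhdsWithin_of_mem_nhds (Iio_mem_nhds hts)]
        with s hs1 hs2
      exact h s ⟨ht.1.trans hs1, hs2.le⟩
    · have h1 := hc t ⟨hts, ht.2.le⟩
      refine h1.mono_of_mem_nhdsWithin ?_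
      filter_upwards [self_mem_nhdsWithin, mem_nhdsWithin_of_mem_nhds (Iio_mem_nhds ht.2)]
        with s hs1 hs2
      exact ⟨hts.trans hs1, le_of_lt hs2⟩
  · intro t ht
    rcases le_or_gt t s₀ with hts | hts
    · obtain ⟨l, hl⟩ := hx₀.2 t ht
      refine ⟨l, hl.congr' ?_⟩
      filter_upwards [self_mem_nhdsWithin, mem_nhdsWithin_of_mem_nhds (Ioi_mem_nhds ht.1)]
        with s hs1 hs2
      exact (h s ⟨le_of_lt hs2, (le_of_lt hs1).trans hts⟩).symm
    · refine ⟨x t, ?_⟩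
      have h1 := hc t ⟨hts.le, ht.2⟩
      refine h1.mono_of_mem_nhdsWithin ?_
      filter_upwards [self_mem_nhdsWithin, mem_nhdsWithin_of_mem_nhds (Ioi_mem_nhds hts)]
        with s hs1 hs2
      exact ⟨le_of_lt hs2, (le_of_lt hs1).trans ht.2⟩

theorem runSup_le {x : Path d} {t B : ℝ} (ht : 0 ≤ t) (h : ∀ s ∈ Icc 0 t, ‖x s‖ ≤ B) :
    runSup d x t ≤ B := by
  refine csSup_le ((nonempty_Icc.2 ht).image _) ?_
  rintro _ ⟨s, hs, rfl⟩
  exact h s hs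

theorem bddAbove_norm_image {x : Path d} {t B : ℝ} (h : ∀ s ∈ Icc 0 t, ‖x s‖ ≤ B) :
    BddAbove ((fun s => ‖x s‖) '' Icc 0 t) := by
  refine ⟨B, ?_⟩
  rintro _ ⟨s, hs, rfl⟩
  exact h s hs

theorem norm_le_runSup {x : Path d} (hx : x ∈ Cadlag T d) {s t : ℝ} (hs : 0 ≤ s) (hst : s ≤ t)
    (ht : t ≤ T) : ‖x s‖ ≤ runSup d x t := by
  obtain ⟨B, hB⟩ := Cadlag.bounded hx
  exact le_csSup (bddAbove_norm_image (B := B) fun r hr => hB r ⟨hr.1, hr.2.trans ht⟩)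
    ⟨s, ⟨hs, hst⟩, rfl⟩

theorem runSup_mono {x : Path d} (hx : x ∈ Cadlag T d) {s t : ℝ} (hs : 0 ≤ s) (hst : s ≤ t)
    (ht : t ≤ T) : runSup d x s ≤ runSup d x t :=
  runSup_le hs fun _ hr => norm_le_runSup hx hr.1 (hr.2.trans hst) ht

theorem runSup_nonneg (x : Path d) (t : ℝ) : 0 ≤ runSup d x t := by
  apply Real.sSup_nonneg
  rintro _ ⟨s, _, rfl⟩
  exact norm_nonneg _

theorem runSup_congr {x x' : Path d} {t : ℝ} (h : ∀ s ∈ Icc 0 t, x s = x' s) :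
    runSup d x t = runSup d x' t := by
  unfold runSup
  congr 1
  exact image_congr fun s hs => by rw [h s hs]

theorem one_add_norm_le_exp_of_increment_le {F : Type*} [NormedAddCommGroup F] {y : ℝ → F} {a b C : ℝ}
    (hC : 0 ≤ C) (hb : ∃ B, ∀ t ∈ Icc a b, ‖y t‖ ≤ B)
    (h : ∀ s t, a ≤ s → s ≤ t → t ≤ b → ∀ m, (∀ τ ∈ Icc a t, ‖y τ‖ ≤ m) →
      ‖y t - y s‖ ≤ C * (1 + m) * (t - s)) :
    ∀ t ∈ Icc a b, 1 + ‖y t‖ ≤ (1 + ‖y a‖) * Real.exp (2 * C * (t - a)) := by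
  obtain ⟨B, hB⟩ := hb
  set ρ : ℝ → ℝ := fun t => sSup ((fun s => ‖y s‖) '' Icc a t) with hρ
  have hle : ∀ s t, a ≤ s → s ≤ t → t ≤ b → ‖y s‖ ≤ ρ t := by
    intro s t h1 h2 h3
    refine le_csSup ⟨B, ?_⟩ ⟨s, ⟨h1, h2⟩, rfl⟩
    rintro _ ⟨r, hr, rfl⟩
    exact hB r ⟨hr.1, hr.2.trans h3⟩
  have hρle : ∀ t m, a ≤ t → (∀ s ∈ Icc a t, ‖y s‖ ≤ m) → ρ t ≤ m := by
    intro t m h1 h2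
    refine csSup_le ((nonempty_Icc.2 h1).image _) ?_
    rintro _ ⟨s, hs, rfl⟩
    exact h2 s hs
  have hstep : ∀ s t, a ≤ s → s ≤ t → t ≤ b → C * (t - s) ≤ 1 / 2 →
      1 + ρ t ≤ (1 + ρ s) * Real.exp (2 * C * (t - s)) := by
    intro s t h1 h2 h3 h4
    have hρ0 : 0 ≤ ρ t := (norm_nonneg _).trans (hle a t le_rfl (h1.trans h2) h3)
    have key : ρ t ≤ ρ s + C * (1 + ρ t) * (t - s) := by
      refine hρle t _ (h1.trans h2) fun r hr => ?_
      rcases le_total r s with hrs | hrs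
      · have := hle r s hr.1 hrs (h2.trans h3)
        have : 0 ≤ C * (1 + ρ t) * (t - s) := by
          have : 0 ≤ t - s := by linarith
          positivity
        linarith
      · have e1 := h s r h1 hrs (hr.2.trans h3) (ρ t) fun τ hτ => hle τ t hτ.1 (hτ.2.trans hr.2) h3
        have e2 := hle s s h1 le_rfl (h2.trans h3)
        have e3 : ‖y r‖ ≤ ‖y s‖ + ‖y r - y s‖ := by
          have := norm_add_le (y s) (y r - y s); simpa using this
        have e4 : C * (1 + ρ t) * (r - s) ≤ C * (1 + ρ t) * (t - s) := by
          gcongr; exact hr.2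
        linarith
    set u := C * (t - s) with hu
    have hu0 : 0 ≤ u := mul_nonneg hC (by linarith)
    have hexp : 1 + 2 * u ≤ Real.exp (2 * C * (t - s)) := by
      have := Real.add_one_le_exp (2 * u)
      rw [hu] at this ⊢
      rw [mul_assoc]; linarith
    have hρs : 0 ≤ ρ s := (norm_nonneg _).trans (hle a s le_rfl h1 (h2.trans h3))
    have k2 : (1 + ρ t) * (1 - u) ≤ 1 + ρ s := by nlinarith
    have k3 : 1 ≤ (1 - u) * (1 + 2 * u) := by nlinarith
    calc 1 + ρ t ≤ (1 + ρ t) * ((1 - u) * (1 + 2 * u)) := by nlinarith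
      _ = ((1 + ρ t) * (1 - u)) * (1 + 2 * u) := by ring
      _ ≤ (1 + ρ s) * (1 + 2 * u) := by gcongr
      _ ≤ _ := by gcongr
  intro t ht
  obtain ⟨N, hN⟩ := exists_nat_gt (2 * C * (t - a))
  have hN0 : (0 : ℝ) < N := lt_of_le_of_lt (by have := sub_nonneg.2 ht.1; positivity) hN
  set Δ := (t - a) / N with hΔ
  have hΔ0 : 0 ≤ Δ := div_nonneg (sub_nonneg.2 ht.1) hN0.le
  have hNΔ : N * Δ = t - a := by rw [hΔ]; field_simp
  have hind : ∀ k : ℕ, k ≤ N → 1 + ρ (a + k * Δ) ≤ (1 + ‖y a‖) * Real.exp (2 * C * (k * Δ)) := by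
    intro k
    induction k with
    | zero =>
      intro _
      have : ρ a ≤ ‖y a‖ := hρle a _ le_rfl fun s hs => by
        rw [le_antisymm hs.2 hs.1]
      simpa using this
    | succ k ih =>
      intro hk
      have ih := ih (by omega)
      have hk' : ((k + 1 : ℕ) : ℝ) ≤ N := by exact_mod_cast hk
      have hk0 : (0 : ℝ) ≤ k := Nat.cast_nonneg k
      have e : (k + 1 : ℕ) * Δ ≤ t - a := by rw [← hNΔ]; gcongr
      push_cast at e ⊢
      have hs := hstep (a + k * Δ) (a + (k + 1) * Δ) (by nlinarith) (by nlinarith)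
        (by linarith [ht.2]) (by
          have : a + (k + 1) * Δ - (a + k * Δ) = Δ := by ring
          rw [this, hΔ, ← mul_div_assoc, div_le_iff₀ hN0]; linarith)
      refine hs.trans ((mul_le_mul_of_nonneg_right ih (Real.exp_pos _).le).trans (le_of_eq ?_))
      rw [mul_assoc, ← Real.exp_add]
      congr 2; ring
  have := hind N le_rfl
  rw [hNΔ, add_sub_cancel] at this
  linarith [hle t t ht.1 le_rfl ht.2]

theorem integral_deriv_eq_sub_of_lipschitzWith {F : Type*} [NormedAddCommGroup F] [NormedSpace ℝ F]
    [FiniteDimensional ℝ F] {K : NNReal} {f : ℝ → F} (hf : LipschitzWith K f) (a b : ℝ) :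
    ∫ t in a..b, deriv f t = f b - f a := by
  borelize F
  have hint : ∀ a b, IntervalIntegrable (deriv f) volume a b := by
    intro a b
    refine (intervalIntegrable_const (c := (K : ℝ))).mono_fun
      (measurable_deriv f).aestronglyMeasurable ?_
    refine Eventually.of_forall fun t => ?_
    have := norm_deriv_le_of_lipschitz (x₀ := t) hf
    simpa using this
  set g : ℝ → F := fun t => f t - ∫ s in a..t, deriv f s with hg
  have hIlip : LipschitzWith K fun t => ∫ s in a..t, deriv f s := by
    refine LipschitzWith.of_dist_le_mul fun s t => ?_
    rw [dist_eq_norm, intervalIntegral.integral_interval_sub_left (hint _ _) (hint _ _),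
      Real.dist_eq]
    exact intervalIntegral.norm_integral_le_of_norm_le_const
      fun r _ => norm_deriv_le_of_lipschitz hf
  have hfa : AbsolutelyContinuousOnInterval f a b :=
    (hf.lipschitzOnWith (s := uIcc a b)).absolutelyContinuousOnInterval
  have hga : AbsolutelyContinuousOnInterval g a b :=
    hfa.sub (hIlip.lipschitzOnWith (s := uIcc a b)).absolutelyContinuousOnInterval
  have hg0 : ∀ᵐ t, t ∈ uIcc a b → HasDerivAt g 0 t := by
    filter_upwards [hf.ae_differentiableAt, (hint a b).ae_hasDerivAt_integral] with t h1 h2 h3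
    have := h1.hasDerivAt.sub (h2 h3 a (by simp))
    rwa [sub_self] at this
  obtain ⟨C, hC⟩ := hga.const_of_ae_hasDerivAt_zero hg0
  have h1 := hC a (by simp)
  have h2 := hC b (by simp)
  simp only [hg, intervalIntegral.integral_same, sub_zero] at h1 h2
  rw [h1, ← h2]; abel

/-- The increments of `x` on `[s₀, T]` obey the growth bound of `X^L`. -/
def XLip (T : ℝ) (d : ℕ) (L s₀ : ℝ) (x : Path d) : Prop :=
  ∀ s t, s₀ ≤ s → s ≤ t → t ≤ T → ‖x t - x s‖ ≤ L * (1 + runSup d x t) * (t - s)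

theorem lipschitzWith_clamp {F : Type*} [NormedAddCommGroup F] {K a b : ℝ} (hK : 0 ≤ K) (hab : a ≤ b)
    {x : ℝ → F} (h : ∀ s t, a ≤ s → s ≤ t → t ≤ b → ‖x t - x s‖ ≤ K * (t - s)) :
    LipschitzWith K.toNNReal fun t => x (max a (min t b)) := by
  have key : ∀ s t, s ≤ t → ‖x (max a (min t b)) - x (max a (min s b))‖ ≤ K * (t - s) := by
    intro s t hst
    refine (h _ _ (le_max_left _ _) ?_ ?_).trans ?_
    · gcongr
    · exact max_le hab (min_le_right _ _)
    · refine mul_le_mul_of_nonneg_left ?_ hK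
      rcases max_cases a (min t b) with h1 | h1 <;> rcases max_cases a (min s b) with h2 | h2 <;>
      rcases min_cases t b with h3 | h3 <;> rcases min_cases s b with h4 | h4 <;>
      linarith
  refine LipschitzWith.of_dist_le_mul fun s t => ?_
  rw [dist_eq_norm, Real.dist_eq, Real.coe_toNNReal K hK]
  rcases le_total s t with hst | hst
  · rw [norm_sub_rev, abs_sub_comm, abs_of_nonneg (sub_nonneg.2 hst)]
    exact key s t hst
  · rw [abs_of_nonneg (sub_nonneg.2 hst)]
    exact key t s hst

theorem continuousOn_of_increment_le {F : Type*} [NormedAddCommGroup F] {K a b : ℝ} (hK : 0 ≤ K)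
    (hab : a ≤ b) {x : ℝ → F}
    (h : ∀ s t, a ≤ s → s ≤ t → t ≤ b → ‖x t - x s‖ ≤ K * (t - s)) : ContinuousOn x (Icc a b) := by
  refine (lipschitzWith_clamp hK hab h).continuous.continuousOn.congr fun t ht => ?_
  simp only
  rw [min_eq_left ht.2, max_eq_right ht.1]

theorem XLip.lip {L s₀ : ℝ} (hL : 0 ≤ L) (hs₀ : 0 ≤ s₀) {x : Path d} (hx : x ∈ Cadlag T d)
    (h : XLip T d L s₀ x) : ∀ s t, s₀ ≤ s → s ≤ t → t ≤ T →
      ‖x t - x s‖ ≤ L * (1 + runSup d x T) * (t - s) := by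
  intro s t h1 h2 h3
  refine (h s t h1 h2 h3).trans ?_
  have := runSup_mono hx (hs₀.trans (h1.trans h2)) h3 le_rfl
  have : 0 ≤ t - s := by linarith
  gcongr

theorem XDeriv.xLip {L s₀ : ℝ} (hL : 0 ≤ L) (hs₀ : s₀ ∈ Icc 0 T) {x g : Path d}
    (hx : x ∈ Cadlag T d) (h : XDeriv T d L s₀ x g) : XLip T d L s₀ x := by
  obtain ⟨hg, hxg, hb⟩ := h
  intro s t h1 h2 h3
  have hint : ∀ r ∈ Icc s₀ T, IntervalIntegrable g volume s₀ r := fun r hr => by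
    rw [intervalIntegrable_iff_integrableOn_Icc_of_le hr.1]
    exact hg.mono_set (Icc_subset_Icc_right hr.2)
  have hs : s ∈ Icc s₀ T := ⟨h1, h2.trans h3⟩
  have ht : t ∈ Icc s₀ T := ⟨h1.trans h2, h3⟩
  rw [hxg t ht, hxg s hs, add_sub_add_left_eq_sub,
    intervalIntegral.integral_interval_sub_left (hint t ht) (hint s hs)]
  rw [← abs_of_nonneg (sub_nonneg.2 h2)]
  refine intervalIntegral.norm_integral_le_of_norm_le_const_ae ?_
  rw [ae_restrict_iff' measurableSet_Ioo] at hb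
  have hne : ∀ᵐ r : ℝ, r ≠ T := by simp [ae_iff, measure_singleton]
  filter_upwards [hb, hne] with r hr hrT hrs
  rw [uIoc_of_le h2] at hrs
  refine (hr ⟨h1.trans_lt hrs.1, lt_of_le_of_ne (hrs.2.trans h3) hrT⟩).trans ?_
  have := runSup_mono hx (hs₀.1.trans (h1.trans hrs.1.le)) hrs.2 h3
  gcongr

theorem XLip.exists_deriv {L s₀ : ℝ} (hL : 0 ≤ L) (hs₀ : s₀ ∈ Icc 0 T) {x : Path d}
    (hx : x ∈ Cadlag T d) (h : XLip T d L s₀ x) : ∃ g, XDeriv T d L s₀ x g := by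
  have hR := runSup_nonneg x T
  set K := L * (1 + runSup d x T) with hK
  have hK0 : 0 ≤ K := by positivity
  have hlip := lipschitzWith_clamp hK0 hs₀.2 (h.lip hL hs₀.1 hx)
  set f : ℝ → E d := fun t => x (max s₀ (min t T)) with hf
  have hfx : ∀ t ∈ Icc s₀ T, f t = x t := fun t ht => by
    simp only [hf]; rw [min_eq_left ht.2, max_eq_right ht.1]
  have hbound : ∀ t, ‖deriv f t‖ ≤ K := fun t => by
    simpa only [Real.coe_toNNReal K hK0] using norm_deriv_le_of_lipschitz (x₀ := t) hlip
  refine ⟨deriv f, ?_, ?_, ?_⟩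
  · refine Measure.integrableOn_of_bounded (M := K) (by simp)
      (measurable_deriv f).aestronglyMeasurable (Eventually.of_forall hbound)
  · intro t ht
    rw [integral_deriv_eq_sub_of_lipschitzWith hlip, hfx t ht, hfx s₀ ⟨le_rfl, hs₀.2⟩]
    abel
  · rw [ae_restrict_iff' measurableSet_Ioo]
    filter_upwards [hlip.ae_differentiableAt] with t hd ht
    have hslope := (hasDerivAt_iff_tendsto_slope.1 hd.hasDerivAt).mono_left
      (nhdsWithin_mono t (fun s (hs : s ∈ Iio t) => ne_of_lt hs))
    refine le_of_tendsto hslope.norm ?_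
    filter_upwards [self_mem_nhdsWithin, mem_nhdsWithin_of_mem_nhds (Ioi_mem_nhds ht.1)]
      with s hs1 hs2
    have hs1 : s < t := hs1
    have hs2 : s₀ < s := hs2
    rw [slope_def_module, norm_smul, norm_inv, Real.norm_eq_abs, abs_sub_comm,
      abs_of_pos (sub_pos.2 hs1), norm_sub_rev, hfx t ⟨ht.1.le, ht.2.le⟩,
      hfx s ⟨hs2.le, hs1.le.trans ht.2.le⟩, inv_mul_le_iff₀ (sub_pos.2 hs1), mul_comm]
    exact h s t hs2.le hs1.le ht.2.le

theorem mem_XSet_iff {L s₀ : ℝ} (hL : 0 ≤ L) (hs₀ : s₀ ∈ Icc 0 T) {x x₀ : Path d} :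
    x ∈ XSet T d L s₀ x₀ ↔ x ∈ Cadlag T d ∧ (∀ t ∈ Icc 0 s₀, x t = x₀ t) ∧ XLip T d L s₀ x :=
  ⟨fun ⟨h1, h2, _, h3⟩ => ⟨h1, h2, h3.xLip hL hs₀ h1⟩,
    fun ⟨h1, h2, h3⟩ => ⟨h1, h2, h3.exists_deriv hL hs₀ h1⟩⟩

theorem XSet.of_lip {L s₀ K : ℝ} (hL : 0 ≤ L) (hK : 0 ≤ K) (hs₀ : s₀ ∈ Icc 0 T) {x x₀ : Path d}
    (hx₀ : x₀ ∈ Cadlag T d) (h : ∀ t ∈ Icc 0 s₀, x t = x₀ t)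
    (hKx : ∀ s t, s₀ ≤ s → s ≤ t → t ≤ T → ‖x t - x s‖ ≤ K * (t - s))
    (hx : XLip T d L s₀ x) : x ∈ XSet T d L s₀ x₀ :=
  (mem_XSet_iff hL hs₀).2
    ⟨Cadlag.of_agree hx₀ h (continuousOn_of_increment_le hK hs₀.2 hKx), h, hx⟩

theorem XSet.trans {L s₀ s₁ : ℝ} (hL : 0 ≤ L) (hs₀ : 0 ≤ s₀) (hs₁ : s₀ ≤ s₁) (hT : s₁ ≤ T)
    {x x' x₀ : Path d} (hx : x ∈ XSet T d L s₀ x₀) (hx' : x' ∈ XSet T d L s₁ x) :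
    x' ∈ XSet T d L s₀ x₀ := by
  have m0 : s₀ ∈ Icc 0 T := ⟨hs₀, hs₁.trans hT⟩
  have m1 : s₁ ∈ Icc 0 T := ⟨hs₀.trans hs₁, hT⟩
  rw [mem_XSet_iff hL m0] at hx ⊢
  rw [mem_XSet_iff hL m1] at hx'
  obtain ⟨c, e, l⟩ := hx
  obtain ⟨c', e', l'⟩ := hx'
  refine ⟨c', fun t ht => (e' t ⟨ht.1, ht.2.trans hs₁⟩).trans (e t ht), fun s t h1 h2 h3 => ?_⟩
  rcases le_total t s₁ with ht | ht
  · rw [e' t ⟨m0.1.trans (h1.trans h2), ht⟩, e' s ⟨m0.1.trans h1, h2.trans ht⟩,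
      runSup_congr (x := x') (x' := x) fun r hr => e' r ⟨hr.1, hr.2.trans ht⟩]
    exact l s t h1 h2 h3
  rcases le_total s₁ s with hs | hs
  · exact l' s t hs h2 h3
  have a1 := l' s₁ t le_rfl ht h3
  have a2 := l s s₁ h1 hs hT
  rw [← e' s₁ ⟨m1.1, le_rfl⟩, ← e' s ⟨m0.1.trans h1, hs⟩,
    ← runSup_congr (x := x') (x' := x) fun r hr => e' r hr] at a2
  have a3 : L * (1 + runSup d x' s₁) * (s₁ - s) ≤ L * (1 + runSup d x' t) * (s₁ - s) := by
    have := runSup_mono c' m1.1 ht h3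
    have : 0 ≤ s₁ - s := by linarith
    gcongr
  have a4 := norm_add_le (x' t - x' s₁) (x' s₁ - x' s)
  rw [sub_add_sub_cancel] at a4
  linarith

theorem XSet.stopped {L s₀ q : ℝ} (hL : 0 ≤ L) (hs₀ : s₀ ∈ Icc 0 T) (hq : s₀ ≤ q)
    {x x₀ : Path d} (hx₀ : x₀ ∈ Cadlag T d) (hx : x ∈ XSet T d L s₀ x₀) :
    (fun t => x (min t q)) ∈ XSet T d L s₀ x₀ := by
  obtain ⟨c, e, l⟩ := (mem_XSet_iff hL hs₀).1 hx
  have hR := runSup_nonneg x T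
  have hmin : ∀ s t, s ≤ t → min t q - min s q ≤ t - s := by
    intro s t hst
    rcases min_cases t q with h3 | h3 <;> rcases min_cases s q with h4 | h4 <;> linarith
  refine XSet.of_lip hL (K := L * (1 + runSup d x T)) (by positivity) hs₀ hx₀ ?_ ?_ ?_
  · intro t ht
    simp only [min_eq_left (ht.2.trans hq)]
    exact e t ht
  · intro s t h1 h2 h3
    refine (l.lip hL hs₀.1 c (min s q) (min t q) (le_min h1 hq) (by gcongr)
      ((min_le_left _ _).trans h3)).trans ?_
    gcongr _ * ?_
    exact hmin s t h2
  · intro s t h1 h2 h3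
    have hrs : runSup d (fun t => x (min t q)) t = runSup d x (min t q) := by
      have h0 : 0 ≤ t := hs₀.1.trans (h1.trans h2)
      have h0q : 0 ≤ min t q := le_min h0 (hs₀.1.trans hq)
      apply le_antisymm
      · exact runSup_le h0 fun r hr => norm_le_runSup c (le_min hr.1 (hs₀.1.trans hq))
          (by gcongr; exact hr.2) ((min_le_left _ _).trans h3)
      · refine csSup_le_csSup ?_ ((nonempty_Icc.2 h0q).image _) ?_
        · refine bddAbove_norm_image (B := runSup d x t) fun r hr => ?_
          exact norm_le_runSup c (le_min hr.1 (hs₀.1.trans hq)) ((min_le_left _ _).trans hr.2) h3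
        · rintro _ ⟨r, hr, rfl⟩
          exact ⟨r, ⟨hr.1, hr.2.trans (min_le_left _ _)⟩, by
            simp only [min_eq_left (hr.2.trans (min_le_right _ _))]⟩
    rw [hrs]
    refine (l (min s q) (min t q) (le_min h1 hq) (by gcongr)
      ((min_le_left _ _).trans h3)).trans ?_
    have := runSup_nonneg x (min t q)
    gcongr _ * ?_
    exact hmin s t h2

theorem XSet.const {L s₀ : ℝ} (hL : 0 ≤ L) (hs₀ : s₀ ∈ Icc 0 T) {x₀ : Path d}
    (hx₀ : x₀ ∈ Cadlag T d) : (fun t => x₀ (min t s₀)) ∈ XSet T d L s₀ x₀ := by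
  have : ∀ s t, s₀ ≤ s → s ≤ t → ‖x₀ (min t s₀) - x₀ (min s s₀)‖ = 0 := by
    intro s t h1 h2
    rw [min_eq_right h1, min_eq_right (h1.trans h2), sub_self, norm_zero]
  refine XSet.of_lip hL le_rfl hs₀ hx₀ (fun t ht => by rw [min_eq_left ht.2]) ?_ ?_
  · intro s t h1 h2 h3
    rw [this s t h1 h2]; simp
  · intro s t h1 h2 h3
    rw [this s t h1 h2]
    have := runSup_nonneg (fun t => x₀ (min t s₀)) t
    have : 0 ≤ t - s := by linarith
    positivity

theorem XLip.runSup_le {L s₀ : ℝ} (hL : 0 ≤ L) (hs₀ : s₀ ∈ Icc 0 T) {x : Path d}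
    (hx : x ∈ Cadlag T d) (h : XLip T d L s₀ x) :
    ∀ t ∈ Icc s₀ T, 1 + runSup d x t ≤ (1 + runSup d x s₀) * Real.exp (2 * L * (t - s₀)) := by
  have hn : ∀ t, ‖runSup d x t‖ = runSup d x t := fun t => by
    rw [Real.norm_eq_abs, abs_of_nonneg (runSup_nonneg x t)]
  have := one_add_norm_le_exp_of_increment_le (y := fun t => runSup d x t) (a := s₀) (b := T) hL
    ⟨runSup d x T, fun t ht => by
      rw [hn]; exact runSup_mono hx (hs₀.1.trans ht.1) ht.2 le_rfl⟩ ?_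
  · simpa only [hn] using this
  · intro s t h1 h2 h3 m hm
    have h0 : 0 ≤ s := hs₀.1.trans h1
    have hmt := hm t ⟨h1.trans h2, le_rfl⟩
    rw [hn] at hmt
    have hts : 0 ≤ t - s := by linarith
    have h4 := runSup_nonneg x t
    rw [Real.norm_eq_abs, abs_of_nonneg (sub_nonneg.2 (runSup_mono hx h0 h2 h3)), sub_le_iff_le_add]
    refine PHJ.runSup_le (h0.trans h2) fun r hr => ?_
    rcases le_total r s with hrs | hrs
    · have h5 := norm_le_runSup hx hr.1 hrs (h2.trans h3)
      have : 0 ≤ L * (1 + m) * (t - s) := by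
        have : 0 ≤ m := h4.trans hmt
        positivity
      linarith
    · have h5 := norm_le_runSup hx h0 le_rfl (h2.trans h3)
      have h6 := h s r h1 hrs (hr.2.trans h3)
      have h7 := norm_add_le (x s) (x r - x s)
      rw [add_sub_cancel] at h7
      have h8 : L * (1 + runSup d x r) * (r - s) ≤ L * (1 + m) * (t - s) := by
        have := runSup_mono hx hr.1 hr.2 h3
        have := runSup_nonneg x r
        have : 0 ≤ r - s := by linarith
        have : 0 ≤ 1 + m := by linarith
        gcongr
        · linarith
        · exact hr.2
      linarith

/-- The standing assumptions on the Hamiltonian. -/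
structure Hyp (T : ℝ) (d : ℕ) (H : Ham d) (LH CH : ℝ) (M : ℝ → ℝ) : Prop where
  pos : 0 < T
  cont : HamCont T d H
  meas : HamMeas d H
  lipZ : HamLipZ T d H LH
  lipX : HamLipX T d H M
  mono : HamMono T d H
  bound : HamBound T d H CH

/-- The Hamiltonian of the equation satisfied by `-u`. -/
def negHam (H : Ham d) : Ham d := fun t x y z => -H t x (-y) (-z)

theorem negHam_negHam (H : Ham d) : negHam (negHam H) = H := by
  funext t x y z
  simp [negHam]

theorem Hyp.neg {H : Ham d} {LH CH : ℝ} {M : ℝ → ℝ} (hH : Hyp T d H LH CH M) :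
    Hyp T d (negHam H) LH CH M where
  pos := hH.pos
  cont := by
    filter_upwards [hH.cont] with t ht x hx y z ε hε
    obtain ⟨δ, hδ, h⟩ := ht x hx (-y) (-z) ε hε
    refine ⟨δ, hδ, fun x' hx' y' z' h1 h2 h3 => ?_⟩
    have := h x' hx' (-y') (-z') h1 (by rwa [neg_sub_neg, abs_sub_comm])
      (by rwa [neg_sub_neg, norm_sub_rev])
    simp only [negHam]
    rwa [neg_sub_neg, abs_sub_comm]
  meas := fun x y z => (hH.meas x (-y) (-z)).neg
  lipZ := by
    refine ⟨hH.lipZ.1, ?_⟩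
    filter_upwards [hH.lipZ.2] with t ht x hx y z z'
    have := ht x hx (-y) (-z') (-z)
    simp only [negHam]
    rwa [neg_sub_neg] at this ⊢
  lipX := by
    intro L hL
    refine ⟨(hH.lipX L hL).1, fun t₀ ht₀ x₀ hx₀ x hx x' hx' y z => ?_⟩
    filter_upwards [(hH.lipX L hL).2 t₀ ht₀ x₀ hx₀ x hx x' hx' (-y) (-z)] with t ht
    simp only [negHam]
    rw [neg_sub_neg, abs_sub_comm]
    simpa only [abs_neg, norm_neg] using ht
  mono := by
    filter_upwards [hH.mono] with t ht x hx z y y' hy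
    exact neg_le_neg (ht x hx (-z) (-y') (-y) (neg_le_neg hy))
  bound := by
    refine ⟨hH.bound.1, ?_⟩
    filter_upwards [hH.bound.2] with t ht x hx y
    simpa only [negHam, abs_neg, neg_zero] using ht x hx (-y)

variable {H : Ham d} {LH CH : ℝ} {M : ℝ → ℝ}

theorem ae_restrict_Ioo_mono {p : ℝ → Prop} {a b a' b' : ℝ} (ha : a ≤ a') (hb : b' ≤ b)
    (h : ∀ᵐ t ∂(volume.restrict (Ioo a b)), p t) : ∀ᵐ t ∂(volume.restrict (Ioo a' b')), p t :=
  ae_mono (Measure.restrict_mono (Ioo_subset_Ioo ha hb) le_rfl) h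

theorem Hyp.abs_le (hH : Hyp T d H LH CH M) :
    ∀ᵐ t ∂(volume.restrict (Ioo (0 : ℝ) T)), ∀ x ∈ Cadlag T d, ∀ (y : ℝ) (z : E d),
      |H t x y z| ≤ CH * (1 + runSup d x t + |y|) + LH * (1 + runSup d x t) * ‖z‖ := by
  filter_upwards [hH.lipZ.2, hH.bound.2] with t h1 h2 x hx y z
  have e1 := h1 x hx y z 0
  have e2 := h2 x hx y
  rw [sub_zero] at e1
  have := abs_add_le (H t x y z - H t x y 0) (H t x y 0)
  rw [sub_add_cancel] at this
  linarith

theorem Hyp.tendsto (hH : Hyp T d H LH CH M) :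
    ∀ᵐ t ∂(volume.restrict (Ioo (0 : ℝ) T)), ∀ {ι : Type} {l : Filter ι} (x : Path d)
      (y : ℝ) (z : E d) (xn : ι → Path d) (yn : ι → ℝ), x ∈ Cadlag T d →
      (∀ n, xn n ∈ Cadlag T d) → Tendsto (fun n => supDist T d x (xn n)) l (𝓝 0) →
      Tendsto yn l (𝓝 y) → Tendsto (fun n => H t (xn n) (yn n) z) l (𝓝 (H t x y z)) := by
  filter_upwards [hH.cont] with t ht ι l x y z xn yn hx hxn h1 h2
  refine Metric.tendsto_nhds.2 fun ε hε => ?_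
  obtain ⟨δ, hδ, h⟩ := ht x hx y z ε hε
  filter_upwards [h1.eventually (gt_mem_nhds hδ), Metric.tendsto_nhds.1 h2 δ hδ] with n e1 e2
  rw [Real.dist_eq, abs_sub_comm]
  refine h _ (hxn n) _ _ e1 ?_ (by simpa using hδ)
  rwa [Real.dist_eq, abs_sub_comm] at e2

theorem supDist_le {x y : Path d} (hT : 0 ≤ T) {B : ℝ} (h : ∀ s ∈ Icc 0 T, ‖x s - y s‖ ≤ B) :
    supDist T d x y ≤ B := by
  refine csSup_le ((nonempty_Icc.2 hT).image _) ?_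
  rintro _ ⟨s, hs, rfl⟩
  exact h s hs

theorem supDist_nonneg (x y : Path d) : 0 ≤ supDist T d x y := by
  apply Real.sSup_nonneg
  rintro _ ⟨s, _, rfl⟩
  exact norm_nonneg _

theorem supDist_self (x : Path d) (hT : 0 ≤ T) : supDist T d x x = 0 :=
  le_antisymm (supDist_le hT (by simp)) (supDist_nonneg x x)

theorem Hyp.continuous_y (hH : Hyp T d H LH CH M) :
    ∀ᵐ t ∂(volume.restrict (Ioo (0 : ℝ) T)), ∀ x ∈ Cadlag T d, ∀ z,
      Continuous fun y => H t x y z := by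
  filter_upwards [hH.tendsto] with t ht x hx z
  refine continuous_iff_continuousAt.2 fun y => ?_
  refine ht x y z (fun _ => x) id hx (fun _ => hx) ?_ tendsto_id
  rw [supDist_self x hH.pos.le]
  exact tendsto_const_nhds

theorem Hyp.aestronglyMeasurable (hH : Hyp T d H LH CH M) {x : Path d} (hx : x ∈ Cadlag T d)
    {y : ℝ → ℝ} (hy : Measurable y) (z : E d) :
    AEStronglyMeasurable (fun s => H s x (y s) z) (volume.restrict (Ioo (0 : ℝ) T)) := by
  have hstep : ∀ n : ℕ, Measurable fun s => H s x ((⌊(n + 1 : ℝ) * y s⌋ : ℝ) / (n + 1)) z := by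
    intro n
    have h1 : Measurable fun p : ℤ × ℝ => H p.2 x ((p.1 : ℝ) / (n + 1)) z :=
      measurable_from_prod_countable_right fun k => hH.meas x ((k : ℝ) / (n + 1)) z
    have h2 : Measurable fun s => ⌊(n + 1 : ℝ) * y s⌋ := Int.measurable_floor.comp (hy.const_mul _)
    exact h1.comp (h2.prodMk measurable_id)
  refine aestronglyMeasurable_of_tendsto_ae atTop (fun n => (hstep n).aestronglyMeasurable) ?_
  filter_upwards [hH.continuous_y] with t ht
  refine ((ht x hx z).tendsto (y t)).comp ?_
  refine tendsto_of_tendsto_of_tendsto_of_le_of_le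
    (g := fun n : ℕ => y t - 1 / ((n : ℝ) + 1)) (h := fun _ => y t) ?_ tendsto_const_nhds ?_ ?_
  · simpa using tendsto_const_nhds.sub (tendsto_one_div_add_atTop_nhds_zero_nat (𝕜 := ℝ))
  · intro n
    have hn : (0 : ℝ) < n + 1 := by positivity
    simp only
    rw [le_div_iff₀ hn, sub_mul, one_div, inv_mul_cancel₀ hn.ne']
    linarith [Int.sub_one_lt_floor ((n + 1 : ℝ) * y t)]
  · intro n
    have hn : (0 : ℝ) < n + 1 := by positivity
    simp only
    rw [div_le_iff₀ hn]
    linarith [Int.floor_le ((n + 1 : ℝ) * y t)]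

theorem measurable_comp_clamp {s₀ : ℝ} (hT : s₀ ≤ T) {y : ℝ → ℝ}
    (hy : ContinuousOn y (Icc s₀ T)) : Measurable fun t => y (max s₀ (min t T)) := by
  refine Continuous.measurable ?_
  exact hy.comp_continuous (by fun_prop) fun t => ⟨le_max_left _ _, max_le hT (min_le_right _ _)⟩

theorem Hyp.aestronglyMeasurable_of_continuousOn (hH : Hyp T d H LH CH M) {x : Path d}
    (hx : x ∈ Cadlag T d) {s₀ : ℝ} (hs₀ : s₀ ∈ Icc 0 T) {y : ℝ → ℝ}
    (hy : ContinuousOn y (Icc s₀ T)) (z : E d) :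
    AEStronglyMeasurable (fun s => H s x (y s) z) (volume.restrict (Ioo s₀ T)) := by
  refine ((hH.aestronglyMeasurable hx (measurable_comp_clamp hs₀.2 hy) z).mono_measure
    (Measure.restrict_mono (Ioo_subset_Ioo_left hs₀.1) le_rfl)).congr ?_
  rw [Filter.EventuallyEq, ae_restrict_iff' measurableSet_Ioo]
  refine Eventually.of_forall fun t ht => ?_
  rw [min_eq_left ht.2.le, max_eq_right ht.1.le]

theorem Hyp.ae_abs_le_const (hH : Hyp T d H LH CH M) {R Y Z : ℝ} :
    ∀ᵐ t ∂(volume.restrict (Ioo (0 : ℝ) T)), ∀ x ∈ Cadlag T d, ∀ (y : ℝ) (z : E d),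
      runSup d x t ≤ R → |y| ≤ Y → ‖z‖ ≤ Z →
      |H t x y z| ≤ CH * (1 + R + Y) + LH * (1 + R) * Z := by
  filter_upwards [hH.abs_le] with t ht x hx y z h1 h2 h3
  refine (ht x hx y z).trans ?_
  have := hH.bound.1
  have := hH.lipZ.1
  have : 0 ≤ R := (runSup_nonneg x t).trans h1
  gcongr

theorem Hyp.integrableOn (hH : Hyp T d H LH CH M) {x : Path d}
    (hx : x ∈ Cadlag T d) {s₀ : ℝ} (hs₀ : s₀ ∈ Icc 0 T) {y : ℝ → ℝ}
    (hy : ContinuousOn y (Icc s₀ T)) (z : E d) :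
    IntegrableOn (fun s => H s x (y s) z) (Icc s₀ T) := by
  obtain ⟨Y, hY⟩ := isCompact_Icc.exists_bound_of_continuousOn hy
  rw [integrableOn_Icc_iff_integrableOn_Ioo]
  refine Integrable.of_bound (C := CH * (1 + runSup d x T + Y) + LH * (1 + runSup d x T) * ‖z‖)
    (hH.aestronglyMeasurable_of_continuousOn hx hs₀ hy z) ?_
  · have h1 := ae_restrict_Ioo_mono hs₀.1 le_rfl
      (hH.ae_abs_le_const (R := runSup d x T) (Y := Y) (Z := ‖z‖))
    rw [ae_restrict_iff' measurableSet_Ioo] at h1 ⊢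
    filter_upwards [h1] with t h1 ht
    exact h1 ht x hx _ _ (runSup_mono hx (hs₀.1.trans ht.1.le) ht.2.le le_rfl)
      (hY t (Ioo_subset_Icc_self ht)) le_rfl

theorem Hyp.lip_ae (hH : Hyp T d H LH CH M) {t₀ : ℝ} (ht₀ : t₀ ∈ Icc 0 T) {x₀ x x' : Path d}
    (hx₀ : x₀ ∈ Cadlag T d) (hx : x ∈ XSet T d LH t₀ x₀) (hx' : x' ∈ XSet T d LH t₀ x₀) (z : E d) :
    ∀ᵐ t ∂(volume.restrict (Ioo t₀ T)), ∀ y, |H t x y z - H t x' y z| ≤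
      M LH * (1 + |y| + ‖z‖) * sSup ((fun s => ‖x s - x' s‖) '' Icc 0 t) := by
  rcases ht₀.2.eq_or_lt with rfl | hlt
  · simp
  have h1 := ae_all_iff.2 fun q : ℚ =>
    (hH.lipX LH hH.lipZ.1).2 t₀ ⟨ht₀.1, hlt⟩ x₀ hx₀ x hx x' hx' (q : ℝ) z
  filter_upwards [h1, ae_restrict_Ioo_mono ht₀.1 le_rfl hH.continuous_y] with t h1 h2 y
  have c1 := h2 x hx.1 z
  have c2 := h2 x' hx'.1 z
  refine Rat.denseRange_cast.induction_on (p := fun y : ℝ => |H t x y z - H t x' y z| ≤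
      M LH * (1 + |y| + ‖z‖) * sSup ((fun s => ‖x s - x' s‖) '' Icc 0 t)) y ?_ h1
  exact isClosed_le (by fun_prop) (by fun_prop)

theorem Hyp.eq_ae (hH : Hyp T d H LH CH M) {t₀ t₁ : ℝ} (ht₀ : t₀ ∈ Icc 0 T) (ht₁ : t₁ ≤ T)
    {x₀ x x' : Path d}
    (hx₀ : x₀ ∈ Cadlag T d) (hx : x ∈ XSet T d LH t₀ x₀) (hx' : x' ∈ XSet T d LH t₀ x₀)
    (h : ∀ t ∈ Icc 0 t₁, x t = x' t) (z : E d) :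
    ∀ᵐ t ∂(volume.restrict (Ioo t₀ t₁)), ∀ y, H t x y z = H t x' y z := by
  have h1 := ae_restrict_Ioo_mono le_rfl ht₁ (hH.lip_ae ht₀ hx₀ hx hx' z)
  rw [ae_restrict_iff' measurableSet_Ioo] at h1 ⊢
  filter_upwards [h1] with t h1 ht y
  have h2 : sSup ((fun s => ‖x s - x' s‖) '' Icc 0 t) ≤ 0 := by
    refine Real.sSup_le ?_ le_rfl
    rintro _ ⟨s, hs, rfl⟩
    show ‖x s - x' s‖ ≤ 0
    rw [h s ⟨hs.1, hs.2.trans ht.2.le⟩, sub_self, norm_zero]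
  have h3 := h1 ht y
  have h4 := (hH.lipX LH hH.lipZ.1).1
  have h5 : M LH * (1 + |y| + ‖z‖) * sSup ((fun s => ‖x s - x' s‖) '' Icc 0 t) ≤ 0 :=
    mul_nonpos_of_nonneg_of_nonpos (by positivity) h2
  exact sub_eq_zero.1 (abs_eq_zero.1 (le_antisymm (h3.trans h5) (abs_nonneg _)))

/-- `y` solves the equation defining the second component of the pairs in `YSet` along `x`. -/
def Sol (T : ℝ) (d : ℕ) (H : Ham d) (s₀ : ℝ) (x : Path d) (y₀ : ℝ) (z : E d) (y : ℝ → ℝ) :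
    Prop :=
  ContinuousOn y (Icc s₀ T) ∧
    ∀ t ∈ Icc s₀ T, y t = y₀ + ⟪x t - x s₀, z⟫_ℝ - ∫ s in s₀..t, H s x (y s) z

theorem intervalIntegrable_of_integrableOn_Icc {F : Type*} [NormedAddCommGroup F] {f : ℝ → F}
    {a b s t : ℝ} (h : IntegrableOn f (Icc a b)) (hs : s ∈ Icc a b) (ht : t ∈ Icc a b) :
    IntervalIntegrable f volume s t :=
  (h.mono_set (uIcc_subset_Icc hs ht)).intervalIntegrable

theorem integral_inner_sub {g : Path d} {f : ℝ → ℝ} {z : E d} {s₀ t : ℝ}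
    (hg : IntegrableOn g (Icc s₀ T)) (hf : IntegrableOn f (Icc s₀ T)) (ht : t ∈ Icc s₀ T) :
    ∫ s in s₀..t, (⟪g s, z⟫_ℝ - f s) = ⟪∫ s in s₀..t, g s, z⟫_ℝ - ∫ s in s₀..t, f s := by
  have hs₀ : s₀ ∈ Icc s₀ T := ⟨le_rfl, ht.1.trans ht.2⟩
  have h1 := intervalIntegrable_of_integrableOn_Icc hg hs₀ ht
  have h2 := intervalIntegrable_of_integrableOn_Icc hf hs₀ ht
  have h3 := intervalIntegrable_of_integrableOn_Icc (hg.inner_const (𝕜 := ℝ) z) hs₀ ht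
  rw [intervalIntegral.integral_sub h3 h2]
  congr 1
  have := (innerSL ℝ z).intervalIntegral_comp_comm h1
  simpa only [innerSL_apply_apply, real_inner_comm] using this

theorem mem_YSet_iff (hH : Hyp T d H LH CH M) {s₀ : ℝ} (hs₀ : s₀ ∈ Icc 0 T) {x₀ : Path d}
    {y₀ : ℝ} {z : E d} {p : Path d × (ℝ → ℝ)} :
    p ∈ YSet T d H LH s₀ x₀ y₀ z ↔ p.1 ∈ XSet T d LH s₀ x₀ ∧ Sol T d H s₀ p.1 y₀ z p.2 := by
  constructor
  · rintro ⟨h1, h2, h3, g, h4, h5, h6⟩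
    refine ⟨⟨h1, h2, g, h4⟩, h3, fun t ht => ?_⟩
    rw [h6 t ht, integral_inner_sub h4.1 (hH.integrableOn h1 hs₀ h3 z) ht, h4.2.1 t ht,
      add_sub_cancel_left]
    ring
  · rintro ⟨⟨h1, h2, g, h4⟩, h3, h6⟩
    refine ⟨h1, h2, h3, g, h4, (h4.1.inner_const z).sub (hH.integrableOn h1 hs₀ h3 z),
      fun t ht => ?_⟩
    rw [h6 t ht, integral_inner_sub h4.1 (hH.integrableOn h1 hs₀ h3 z) ht, h4.2.1 t ht,
      add_sub_cancel_left]
    ring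

theorem Sol.sub_eq (hH : Hyp T d H LH CH M) {s₀ : ℝ} (hs₀ : s₀ ∈ Icc 0 T) {x : Path d}
    (hx : x ∈ Cadlag T d) {y₀ : ℝ} {z : E d} {y : ℝ → ℝ} (h : Sol T d H s₀ x y₀ z y)
    {s t : ℝ} (hs : s ∈ Icc s₀ T) (ht : t ∈ Icc s₀ T) :
    y t = y s + ⟪x t - x s, z⟫_ℝ - ∫ r in s..t, H r x (y r) z := by
  have hi := hH.integrableOn hx hs₀ h.1 z
  have h0 : s₀ ∈ Icc s₀ T := ⟨le_rfl, hs₀.2⟩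
  rw [h.2 t ht, h.2 s hs, ← intervalIntegral.integral_add_adjacent_intervals
    (intervalIntegrable_of_integrableOn_Icc hi h0 hs) (intervalIntegrable_of_integrableOn_Icc hi hs ht),
    show x t - x s₀ = (x t - x s) + (x s - x s₀) by abel, inner_add_left]
  ring

theorem Sol.init {s₀ : ℝ} (hs₀ : s₀ ≤ T) {x : Path d} {y₀ : ℝ} {z : E d} {y : ℝ → ℝ}
    (h : Sol T d H s₀ x y₀ z y) : y s₀ = y₀ := by
  rw [h.2 s₀ ⟨le_rfl, hs₀⟩]
  simp

theorem YSet.congr {s₀ : ℝ} {L : ℝ} {x₀ x₀' : Path d} {y₀ : ℝ} {z : E d} {p : Path d × (ℝ → ℝ)}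
    (h : ∀ t ∈ Icc 0 s₀, x₀ t = x₀' t)
    (hx : p ∈ YSet T d H L s₀ x₀ y₀ z) : p ∈ YSet T d H L s₀ x₀' y₀ z :=
  ⟨hx.1, fun t ht => (hx.2.1 t ht).trans (h t ht), hx.2.2⟩

/-- Concatenation of characteristic pairs. -/
theorem YSet.trans (hH : Hyp T d H LH CH M) {s₀ s₁ : ℝ} (hs₀ : s₀ ∈ Icc 0 T)
    (hs₁ : s₁ ∈ Icc s₀ T) {x₀ : Path d} (hx₀ : x₀ ∈ Cadlag T d) {y₀ : ℝ} {z : E d}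
    {p p' : Path d × (ℝ → ℝ)} (hp : p ∈ YSet T d H LH s₀ x₀ y₀ z)
    (hp' : p' ∈ YSet T d H LH s₁ p.1 (p.2 s₁) z) :
    (p'.1, fun t => if t ≤ s₁ then p.2 t else p'.2 t) ∈ YSet T d H LH s₀ x₀ y₀ z := by
  have h0s₁ : s₁ ∈ Icc 0 T := ⟨hs₀.1.trans hs₁.1, hs₁.2⟩
  rw [mem_YSet_iff hH hs₀] at hp ⊢
  rw [mem_YSet_iff hH h0s₁] at hp'
  obtain ⟨hx, hy⟩ := hp
  obtain ⟨hx', hy'⟩ := hp'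
  have hX := XSet.trans hH.lipZ.1 hs₀.1 hs₁.1 hs₁.2 hx hx'
  have hinit := hy'.init hs₁.2
  set Y : ℝ → ℝ := fun t => if t ≤ s₁ then p.2 t else p'.2 t with hY
  have hYl : ∀ t, t ≤ s₁ → Y t = p.2 t := fun t ht => if_pos ht
  have hYr : ∀ t, s₁ ≤ t → Y t = p'.2 t := by
    intro t ht
    rcases ht.eq_or_lt with rfl | ht
    · rw [hYl _ le_rfl, hinit]
    · exact if_neg ht.not_ge
  have hcont : ContinuousOn Y (Icc s₀ T) := by
    rw [← Icc_union_Icc_eq_Icc hs₁.1 hs₁.2]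
    refine ContinuousOn.union_of_isClosed ?_ ?_ isClosed_Icc isClosed_Icc
    · exact (hy.1.mono (Icc_subset_Icc_right hs₁.2)).congr fun t ht => hYl t ht.2
    · exact hy'.1.congr fun t ht => hYr t ht.1
  refine ⟨hX, hcont, ?_⟩
  have hagree : ∀ t ∈ Icc 0 s₁, p'.1 t = p.1 t := hx'.2.1
  have hint : ∀ t ∈ Icc s₀ s₁, ∫ s in s₀..t, H s p'.1 (Y s) z = ∫ s in s₀..t, H s p.1 (p.2 s) z := by
    intro t ht
    refine intervalIntegral.integral_congr_ae ?_
    have := hH.eq_ae hs₀ (ht.2.trans hs₁.2) hx₀ hX hx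
      (fun r hr => hagree r ⟨hr.1, hr.2.trans ht.2⟩) z
    rw [restrict_Ioo_eq_restrict_Ioc, ae_restrict_iff' measurableSet_Ioc] at this
    rw [uIoc_of_le ht.1]
    filter_upwards [this] with r h1 hr
    rw [hYl r (hr.2.trans ht.2), h1 hr]
  have hl : ∀ t ∈ Icc s₀ s₁, Y t = y₀ + ⟪p'.1 t - p'.1 s₀, z⟫_ℝ - ∫ s in s₀..t, H s p'.1 (Y s) z := by
    intro t ht
    rw [hint t ht, hYl t ht.2, hy.2 t ⟨ht.1, ht.2.trans hs₁.2⟩,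
      hagree t ⟨hs₀.1.trans ht.1, ht.2⟩, hagree s₀ ⟨hs₀.1, hs₁.1⟩]
  intro t ht
  rcases le_total t s₁ with hts | hts
  · exact hl t ⟨ht.1, hts⟩
  have hi := hH.integrableOn hX.1 hs₀ hcont z
  have h0 : s₀ ∈ Icc s₀ T := ⟨le_rfl, hs₀.2⟩
  have e1 := hl s₁ ⟨hs₁.1, le_rfl⟩
  have e2 := hy'.2 t ⟨hts, ht.2⟩
  have e3 : ∫ s in s₁..t, H s p'.1 (Y s) z = ∫ s in s₁..t, H s p'.1 (p'.2 s) z := by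
    refine intervalIntegral.integral_congr fun r hr => ?_
    rw [uIcc_of_le hts] at hr
    show H r p'.1 (Y r) z = _
    rw [hYr r hr.1]
  show Y t = _
  rw [hYr t hts, e2, ← hYl s₁ le_rfl, e1, ← intervalIntegral.integral_add_adjacent_intervals
    (intervalIntegrable_of_integrableOn_Icc hi h0 hs₁) (intervalIntegrable_of_integrableOn_Icc hi hs₁ ht),
    e3, show p'.1 t - p'.1 s₀ = (p'.1 t - p'.1 s₁) + (p'.1 s₁ - p'.1 s₀) by abel, inner_add_left]
  ring

/-- Growth constant for the second component of characteristic pairs. -/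
def growthConst (LH CH R Z : ℝ) : ℝ := (2 * LH * Z + CH) * (1 + R)

theorem Hyp.growthConst_nonneg (hH : Hyp T d H LH CH M) {R Z : ℝ} (hR : 0 ≤ R) (hZ : 0 ≤ Z) :
    0 ≤ growthConst LH CH R Z := by
  have := hH.bound.1
  have := hH.lipZ.1
  unfold growthConst
  positivity

theorem abs_inner_le_of_xLip {s₀ L R s t : ℝ} (hL : 0 ≤ L) (hs₀ : 0 ≤ s₀) {x : Path d}
    (hx : x ∈ Cadlag T d) (h : XLip T d L s₀ x) (hR : runSup d x T ≤ R) (z : E d)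
    (hs : s₀ ≤ s) (hst : s ≤ t) (ht : t ≤ T) :
    |⟪x t - x s, z⟫_ℝ| ≤ L * (1 + R) * ‖z‖ * (t - s) := by
  refine (abs_real_inner_le_norm _ _).trans ?_
  have h1 := XLip.lip hL hs₀ hx h s t hs hst ht
  have h2 : L * (1 + runSup d x T) * (t - s) ≤ L * (1 + R) * (t - s) := by
    have := sub_nonneg.2 hst
    gcongr
  calc ‖x t - x s‖ * ‖z‖ ≤ (L * (1 + R) * (t - s)) * ‖z‖ := by gcongr; exact h1.trans h2
    _ = _ := by ring

theorem YSet.increment (hH : Hyp T d H LH CH M) {s₀ : ℝ} (hs₀ : s₀ ∈ Icc 0 T) {x₀ : Path d}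
    {y₀ : ℝ} {z : E d} {p : Path d × (ℝ → ℝ)}
    (hp : p ∈ YSet T d H LH s₀ x₀ y₀ z) {R : ℝ} (hR : runSup d p.1 T ≤ R) {s t m : ℝ}
    (hs : s₀ ≤ s) (hst : s ≤ t) (ht : t ≤ T) (hm : ∀ τ ∈ Icc s t, ‖p.2 τ‖ ≤ m) :
    ‖p.2 t - p.2 s‖ ≤ growthConst LH CH R ‖z‖ * (1 + m) * (t - s) := by
  rw [mem_YSet_iff hH hs₀] at hp
  obtain ⟨hx, hy⟩ := hp
  have hx' := ((mem_XSet_iff hH.lipZ.1 hs₀).1 hx).2.2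
  have hts := sub_nonneg.2 hst
  have hCH := hH.bound.1
  have hLH := hH.lipZ.1
  have hR0 : 0 ≤ R := (runSup_nonneg _ _).trans hR
  have hm0 : 0 ≤ m := (norm_nonneg _).trans (hm s ⟨le_rfl, hst⟩)
  have e1 := hy.sub_eq hH hs₀ hx.1 ⟨hs, hst.trans ht⟩ ⟨hs.trans hst, ht⟩
  have e2 := abs_inner_le_of_xLip hH.lipZ.1 hs₀.1 hx.1 hx' hR z hs hst ht
  have e3 : ‖∫ r in s..t, H r p.1 (p.2 r) z‖ ≤
      (CH * (1 + R + m) + LH * (1 + R) * ‖z‖) * |t - s| := by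
    refine intervalIntegral.norm_integral_le_of_norm_le_const_ae ?_
    have h1 := ae_restrict_Ioo_mono (hs₀.1.trans hs) ht
      (hH.ae_abs_le_const (R := R) (Y := m) (Z := ‖z‖))
    rw [restrict_Ioo_eq_restrict_Ioc, ae_restrict_iff' measurableSet_Ioc] at h1
    rw [uIoc_of_le hst]
    filter_upwards [h1] with r h1 hr
    exact h1 hr _ hx.1 _ _ ((runSup_mono hx.1 ((hs₀.1.trans hs).trans hr.1.le)
      (hr.2.trans ht) le_rfl).trans hR) (hm r (Ioc_subset_Icc_self hr)) le_rfl
  rw [abs_of_nonneg hts] at e3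
  have e4 : p.2 t - p.2 s = ⟪p.1 t - p.1 s, z⟫_ℝ - ∫ r in s..t, H r p.1 (p.2 r) z := by
    rw [e1]; ring
  rw [e4]
  refine (norm_sub_le _ _).trans ((add_le_add e2 e3).trans ?_)
  rw [← add_mul]
  refine mul_le_mul_of_nonneg_right ?_ hts
  unfold growthConst
  have : 0 ≤ m * R * CH + m * R * LH * ‖z‖ * 2 + m * LH * ‖z‖ * 2 := by positivity
  nlinarith [this]

theorem YSet.bound_forward (hH : Hyp T d H LH CH M) {s₀ : ℝ} (hs₀ : s₀ ∈ Icc 0 T) {x₀ : Path d}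
    {y₀ : ℝ} {z : E d} {p : Path d × (ℝ → ℝ)}
    (hp : p ∈ YSet T d H LH s₀ x₀ y₀ z) {R : ℝ} (hR : runSup d p.1 T ≤ R) {s t : ℝ}
    (hs : s₀ ≤ s) (hst : s ≤ t) (ht : t ≤ T) :
    1 + ‖p.2 t‖ ≤ (1 + ‖p.2 s‖) * Real.exp (2 * growthConst LH CH R ‖z‖ * (t - s)) := by
  have hR0 : 0 ≤ R := (runSup_nonneg _ _).trans hR
  refine one_add_norm_le_exp_of_increment_le (a := s) (b := T)
    (hH.growthConst_nonneg hR0 (norm_nonneg z)) ?_ ?_ t ⟨hst, ht⟩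
  · exact isCompact_Icc.exists_bound_of_continuousOn (hp.2.2.1.mono (Icc_subset_Icc_left hs))
  · intro a b ha hab hb m hm
    exact YSet.increment hH hs₀ hp hR (hs.trans ha) hab hb fun τ hτ => hm τ ⟨ha.trans hτ.1, hτ.2⟩

theorem YSet.bound_backward (hH : Hyp T d H LH CH M) {s₀ : ℝ} (hs₀ : s₀ ∈ Icc 0 T) {x₀ : Path d}
    {y₀ : ℝ} {z : E d} {p : Path d × (ℝ → ℝ)}
    (hp : p ∈ YSet T d H LH s₀ x₀ y₀ z) {R : ℝ} (hR : runSup d p.1 T ≤ R) {s t : ℝ}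
    (hs : s₀ ≤ s) (hst : s ≤ t) (ht : t ≤ T) :
    1 + ‖p.2 s‖ ≤ (1 + ‖p.2 t‖) * Real.exp (2 * growthConst LH CH R ‖z‖ * (t - s)) := by
  have hR0 : 0 ≤ R := (runSup_nonneg _ _).trans hR
  have := one_add_norm_le_exp_of_increment_le (y := fun r => p.2 (-r)) (a := -t) (b := -s)
    (hH.growthConst_nonneg hR0 (norm_nonneg z)) ?_ ?_ (-s) ⟨neg_le_neg hst, le_rfl⟩
  · simpa only [neg_neg, sub_neg_eq_add, neg_add_eq_sub] using this
  · obtain ⟨B, hB⟩ := isCompact_Icc.exists_bound_of_continuousOn hp.2.2.1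
    exact ⟨B, fun r hr => hB _ ⟨by linarith [hr.2], by linarith [hr.1]⟩⟩
  · intro a b ha hab hb m hm
    rw [norm_sub_rev]
    refine (YSet.increment hH hs₀ hp hR (s := -b) (t := -a) (m := m) (by linarith) (by linarith)
      (by linarith) fun τ hτ => ?_).trans (le_of_eq (by ring))
    simpa using hm (-τ) ⟨by linarith [hτ.2], by linarith [hτ.1]⟩

/-- Lipschitz constant for the second component of characteristic pairs. -/
def growthLip (T LH CH R Z Y : ℝ) : ℝ :=
  growthConst LH CH R Z * (1 + (1 + Y) * Real.exp (2 * growthConst LH CH R Z * T))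

theorem Hyp.growthLip_nonneg (hH : Hyp T d H LH CH M) {R Z Y : ℝ} (hR : 0 ≤ R) (hZ : 0 ≤ Z)
    (hY : 0 ≤ Y) : 0 ≤ growthLip T LH CH R Z Y := by
  have := hH.growthConst_nonneg hR hZ
  unfold growthLip
  positivity

theorem YSet.lip (hH : Hyp T d H LH CH M) {s₀ : ℝ} (hs₀ : s₀ ∈ Icc 0 T) {x₀ : Path d}
    {y₀ : ℝ} {z : E d} {p : Path d × (ℝ → ℝ)}
    (hp : p ∈ YSet T d H LH s₀ x₀ y₀ z) {R : ℝ} (hR : runSup d p.1 T ≤ R) {Y : ℝ} (hY : |y₀| ≤ Y)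
    {s t : ℝ} (hs : s₀ ≤ s) (hst : s ≤ t) (ht : t ≤ T) :
    ‖p.2 t - p.2 s‖ ≤ growthLip T LH CH R ‖z‖ Y * (t - s) := by
  have hR0 : 0 ≤ R := (runSup_nonneg _ _).trans hR
  have hC := hH.growthConst_nonneg (CH := CH) hR0 (norm_nonneg z)
  have hi : p.2 s₀ = y₀ := ((mem_YSet_iff hH hs₀).1 hp).2.init hs₀.2
  refine YSet.increment hH hs₀ hp hR hs hst ht fun τ hτ => ?_
  have h1 := YSet.bound_forward hH hs₀ hp hR le_rfl (hs.trans hτ.1) (hτ.2.trans ht)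
  have hY0 : 0 ≤ Y := (abs_nonneg _).trans hY
  calc ‖p.2 τ‖ ≤ 1 + ‖p.2 τ‖ := by linarith
    _ ≤ _ := h1
    _ ≤ _ := by
      rw [hi]
      gcongr
      · exact hY
      · linarith [hs₀.1, hτ.2]

theorem XSet.runSup_le {L : ℝ} (hL : 0 ≤ L) {s₀ : ℝ} (hs₀ : s₀ ∈ Icc 0 T) {x₀ x : Path d}
    (hx : x ∈ XSet T d L s₀ x₀) :
    runSup d x T ≤ (1 + runSup d x₀ s₀) * Real.exp (2 * L * T) := by
  have h := ((mem_XSet_iff hL hs₀).1 hx).2.2.runSup_le hL hs₀ hx.1 T ⟨hs₀.2, le_rfl⟩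
  rw [runSup_congr hx.2.1] at h
  have : Real.exp (2 * L * (T - s₀)) ≤ Real.exp (2 * L * T) := by
    gcongr
    linarith [hs₀.1]
  have h2 := runSup_nonneg (d := d) x₀ s₀
  nlinarith

theorem exists_subseq_tendstoUniformlyOn {F : Type*} [NormedAddCommGroup F] [ProperSpace F]
    {a b K B : ℝ} (hab : a ≤ b) {f : ℕ → ℝ → F} (hK : 0 ≤ K)
    (hlip : ∀ n s t, a ≤ s → s ≤ t → t ≤ b → ‖f n t - f n s‖ ≤ K * (t - s))
    (hbd : ∀ n, ‖f n a‖ ≤ B) :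
    ∃ φ : ℕ → ℕ, StrictMono φ ∧ ∃ g : ℝ → F,
      (∀ s t, a ≤ s → s ≤ t → t ≤ b → ‖g t - g s‖ ≤ K * (t - s)) ∧
      TendstoUniformlyOn (fun n => f (φ n)) g atTop (Icc a b) := by
  have hcl := fun n => lipschitzWith_clamp hK hab (hlip n)
  have hnorm : ∀ n, ∀ t ∈ Icc a b, ‖f n t‖ ≤ B + K * (b - a) := by
    intro n t ht
    have h1 := hlip n a t le_rfl ht.1 ht.2
    have h2 := norm_sub_norm_le (f n t) (f n a)
    have h3 : K * (t - a) ≤ K * (b - a) := by gcongr; exact ht.2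
    linarith [hbd n]
  let G : ℕ → BoundedContinuousFunction (Icc a b) F := fun n =>
    BoundedContinuousFunction.mkOfCompact
      ⟨fun t => f n (max a (min (t : ℝ) b)), (hcl n).continuous.comp continuous_subtype_val⟩
  have hG : ∀ n (t : Icc a b), G n t = f n t := by
    intro n t
    show f n (max a (min (t : ℝ) b)) = _
    rw [min_eq_left t.2.2, max_eq_right t.2.1]
  have hcomp : IsCompact (closure (range G)) := by
    refine BoundedContinuousFunction.arzela_ascoli (Metric.closedBall (0 : F) (B + K * (b - a)))
      (isCompact_closedBall _ _) _ ?_ ?_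
    · rintro _ t ⟨n, rfl⟩
      rw [mem_closedBall_zero_iff, hG]
      exact hnorm n t t.2
    · refine (LipschitzWith.uniformEquicontinuous _ K.toNNReal ?_).equicontinuous
      rintro ⟨_, n, rfl⟩
      have := (hcl n).comp (LipschitzWith.subtype_val (Icc a b))
      rw [mul_one] at this
      exact this
  obtain ⟨g, -, φ, hφ, hg⟩ := hcomp.tendsto_subseq fun n => subset_closure (mem_range_self n)
  refine ⟨φ, hφ, fun t => g (projIcc a b hab t), ?_, ?_⟩
  · have hlim : ∀ t ∈ Icc a b, Tendsto (fun n => f (φ n) t) atTop (𝓝 (g (projIcc a b hab t))) := by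
      intro t ht
      have := (BoundedContinuousFunction.tendsto_iff_tendstoUniformly.1 hg).tendsto_at ⟨t, ht⟩
      rw [projIcc_of_mem hab ht]
      simpa only [Function.comp_apply, hG] using this
    intro s t hs hst ht
    exact le_of_tendsto ((hlim t ⟨hs.trans hst, ht⟩).sub (hlim s ⟨hs, hst.trans ht⟩)).norm
      (Eventually.of_forall fun n => hlip (φ n) s t hs hst ht)
  · have := BoundedContinuousFunction.tendsto_iff_tendstoUniformly.1 hg
    rw [Metric.tendstoUniformly_iff] at this
    rw [Metric.tendstoUniformlyOn_iff]
    intro ε hε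
    filter_upwards [this ε hε] with n hn t ht
    have := hn ⟨t, ht⟩
    rw [projIcc_of_mem hab ht]
    simpa only [Function.comp_apply, hG] using this

theorem tendsto_integral_of_moving_start {tn : ℕ → ℝ} {t₀ B : ℝ} (hB : 0 ≤ B)
    (htn : ∀ n, tn n ∈ Icc 0 T)
    (hlim : Tendsto tn atTop (𝓝 t₀)) {f : ℕ → ℝ → ℝ} {g : ℝ → ℝ}
    (hmeas : ∀ n, AEStronglyMeasurable (f n) (volume.restrict (Ioo (tn n) T)))
    (hbd : ∀ n, ∀ᵐ s ∂(volume.restrict (Ioo (tn n) T)), ‖f n s‖ ≤ B)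
    (hfg : ∀ᵐ s ∂(volume.restrict (Ioo t₀ T)), Tendsto (fun n => f n s) atTop (𝓝 (g s)))
    {t : ℝ} (ht : t ∈ Icc t₀ T) :
    Tendsto (fun n => ∫ s in tn n..max t (tn n), f n s) atTop (𝓝 (∫ s in t₀..t, g s)) := by
  have e1 : ∀ n, ∫ s in tn n..max t (tn n), f n s = ∫ s, (Ioc (tn n) t).indicator (f n) s := by
    intro n
    rw [integral_indicator measurableSet_Ioc]
    rcases le_total (tn n) t with h | h
    · rw [max_eq_left h, intervalIntegral.integral_of_le h]
    · rw [max_eq_right h, intervalIntegral.integral_same, Ioc_eq_empty h.not_gt]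
      simp
  have e2 : ∫ s in t₀..t, g s = ∫ s, (Ioc t₀ t).indicator g s := by
    rw [integral_indicator measurableSet_Ioc, intervalIntegral.integral_of_le ht.1]
  simp only [e1, e2]
  refine tendsto_integral_of_dominated_convergence ((Icc 0 T).indicator fun _ => B) ?_ ?_ ?_ ?_
  · intro n
    rw [aestronglyMeasurable_indicator_iff measurableSet_Ioc]
    refine (hmeas n).mono_measure ?_
    rw [restrict_Ioo_eq_restrict_Ioc]
    exact Measure.restrict_mono (Ioc_subset_Ioc_right ht.2) le_rfl
  · rw [integrable_indicator_iff measurableSet_Icc]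
    exact integrableOn_const (by simp)
  · intro n
    have := hbd n
    rw [restrict_Ioo_eq_restrict_Ioc, ae_restrict_iff' measurableSet_Ioc] at this
    filter_upwards [this] with s hs
    by_cases h : s ∈ Ioc (tn n) t
    · have h' : s ∈ Icc 0 T := ⟨(htn n).1.trans h.1.le, h.2.trans ht.2⟩
      rw [indicator_of_mem h, indicator_of_mem h']
      exact hs ⟨h.1, h.2.trans ht.2⟩
    · rw [indicator_of_notMem h, norm_zero]
      exact indicator_nonneg (fun _ _ => hB) _
  · rw [ae_restrict_iff' measurableSet_Ioo] at hfg
    have h1 : ∀ᵐ s : ℝ, s ≠ t₀ := by simp [ae_iff]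
    have h2 : ∀ᵐ s : ℝ, s ≠ T := by simp [ae_iff]
    filter_upwards [hfg, h1, h2] with s hs h1 h2
    rcases h1.lt_or_gt with h1 | h1
    · rw [indicator_of_notMem fun h => h1.not_gt h.1]
      refine tendsto_const_nhds.congr' ?_
      filter_upwards [hlim.eventually (lt_mem_nhds h1)] with n hn
      rw [indicator_of_notMem fun h => hn.not_gt h.1]
    · by_cases h3 : s ≤ t
      · have h' : s ∈ Ioc t₀ t := ⟨h1, h3⟩
        rw [indicator_of_mem h']
        refine (hs ⟨h1, (h3.trans ht.2).lt_of_ne h2⟩).congr' ?_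
        filter_upwards [hlim.eventually (gt_mem_nhds h1)] with n hn
        have h' : s ∈ Ioc (tn n) t := ⟨hn, h3⟩
        rw [indicator_of_mem h']
      · rw [indicator_of_notMem fun h => h3 h.2]
        refine tendsto_const_nhds.congr fun n => ?_
        rw [indicator_of_notMem fun h => h3 h.2]

theorem norm_sub_le_supDist {x y : Path d} (hx : x ∈ Cadlag T d) (hy : y ∈ Cadlag T d)
    {s : ℝ} (hs : s ∈ Icc 0 T) : ‖x s - y s‖ ≤ supDist T d x y := by
  obtain ⟨A, hA⟩ := Cadlag.bounded hx
  obtain ⟨B, hB⟩ := Cadlag.bounded hy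
  refine le_csSup ⟨A + B, ?_⟩ ⟨s, hs, rfl⟩
  rintro _ ⟨r, hr, rfl⟩
  exact (norm_sub_le _ _).trans (add_le_add (hA r hr) (hB r hr))

theorem supDist_comm (x y : Path d) : supDist T d x y = supDist T d y x := by
  simp only [supDist, norm_sub_rev]

theorem Cadlag.stopped {x : Path d} (hx : x ∈ Cadlag T d) (t : ℝ) :
    (fun s => x (min s t)) ∈ Cadlag T d := by
  refine Cadlag.of_agree (s₀ := t) hx (fun s hs => by simp [hs.2]) ?_
  refine (continuousOn_const (c := x t)).congr fun s hs => ?_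
  simp [hs.1]

theorem stopDist_eq_supDist (t s : ℝ) (x y : Path d) :
    stopDist T d t x s y = supDist T d (fun r => x (min r t)) (fun r => y (min r s)) := rfl

theorem runSup_le_add_supDist {x y : Path d} (hx : x ∈ Cadlag T d) (hy : y ∈ Cadlag T d)
    {t : ℝ} (ht : t ∈ Icc 0 T) : runSup d x t ≤ runSup d y t + supDist T d x y := by
  refine PHJ.runSup_le ht.1 fun s hs => ?_
  have h1 := norm_sub_le_supDist hx hy ⟨hs.1, hs.2.trans ht.2⟩
  have h2 := norm_le_runSup hy hs.1 hs.2 ht.2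
  have h3 := norm_sub_norm_le (x s) (y s)
  linarith

theorem stopDist_nonneg (t s : ℝ) (x y : Path d) : 0 ≤ stopDist T d t x s y := by
  rw [stopDist_eq_supDist]
  exact supDist_nonneg _ _

theorem norm_sub_le_stopDist {x y : Path d} (hx : x ∈ Cadlag T d) (hy : y ∈ Cadlag T d)
    (s t : ℝ) {r : ℝ} (hr : r ∈ Icc 0 T) :
    ‖x (min r t) - y (min r s)‖ ≤ stopDist T d t x s y := by
  rw [stopDist_eq_supDist]
  exact norm_sub_le_supDist (Cadlag.stopped hx t) (Cadlag.stopped hy s) hr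

theorem runSup_le_add_stopDist {x y : Path d} (hx : x ∈ Cadlag T d) (hy : y ∈ Cadlag T d)
    {s t : ℝ} (hs : s ∈ Icc 0 T) (ht : t ∈ Icc 0 T) :
    runSup d x t ≤ runSup d y s + stopDist T d t x s y := by
  refine PHJ.runSup_le ht.1 fun r hr => ?_
  have h1 := norm_sub_le_stopDist hx hy s t ⟨hr.1, hr.2.trans ht.2⟩
  rw [min_eq_left hr.2] at h1
  have h2 := norm_le_runSup hy (le_min hr.1 hs.1) (min_le_right r s) hs.2
  have h3 := norm_sub_norm_le (x r) (y (min r s))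
  linarith

theorem Cadlag.of_lip {s₀ K : ℝ} {x x₀ : Path d} (hK : 0 ≤ K) (hs₀ : s₀ ≤ T) (hx₀ : x₀ ∈ Cadlag T d)
    (h : ∀ t ∈ Icc 0 s₀, x t = x₀ t)
    (hlip : ∀ s t, s₀ ≤ s → s ≤ t → t ≤ T → ‖x t - x s‖ ≤ K * (t - s)) : x ∈ Cadlag T d :=
  Cadlag.of_agree hx₀ h (continuousOn_of_increment_le hK hs₀ hlip)

theorem exists_runSup_bound {L : ℝ} (hL : 0 ≤ L) {tn : ℕ → ℝ} {t₀ : ℝ} (htn : ∀ n, tn n ∈ Icc 0 T)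
    (ht₀ : t₀ ∈ Icc 0 T) {xn : ℕ → Path d} {x₀ : Path d}
    (hxn : ∀ n, xn n ∈ Cadlag T d) (hx₀ : x₀ ∈ Cadlag T d)
    (hd : Tendsto (fun n => stopDist T d t₀ x₀ (tn n) (xn n)) atTop (𝓝 0)) {X : ℕ → Path d}
    (hX : ∀ n, X n ∈ XSet T d L (tn n) (xn n)) : ∃ R, 0 ≤ R ∧ ∀ n, runSup d (X n) T ≤ R := by
  obtain ⟨B, hB⟩ := hd.bddAbove_range
  have hB' : ∀ n, stopDist T d t₀ x₀ (tn n) (xn n) ≤ B := fun n => hB ⟨n, rfl⟩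
  have hbd : ∀ n, runSup d (X n) T ≤ (1 + (runSup d x₀ t₀ + B)) * Real.exp (2 * L * T) := by
    intro n
    refine (XSet.runSup_le hL (htn n) (hX n)).trans ?_
    have h1 := runSup_le_add_stopDist (hxn n) hx₀ ht₀ (htn n)
    have h2 : stopDist T d (tn n) (xn n) t₀ x₀ ≤ B := by
      rw [stopDist_eq_supDist, supDist_comm, ← stopDist_eq_supDist]
      exact hB' n
    gcongr
    exact h1.trans (by gcongr)
  exact ⟨_, (runSup_nonneg _ _).trans (hbd 0), hbd⟩

theorem exists_subseq_paths {L K : ℝ} (hL : 0 ≤ L) (hK : 0 ≤ K) {tn : ℕ → ℝ} {t₀ : ℝ}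
    (htn : ∀ n, tn n ∈ Icc 0 T) (ht₀ : t₀ ∈ Icc 0 T) (hlim : Tendsto tn atTop (𝓝 t₀))
    {xn : ℕ → Path d} {x₀ : Path d} (hxn : ∀ n, xn n ∈ Cadlag T d) (hx₀ : x₀ ∈ Cadlag T d)
    (hd : Tendsto (fun n => stopDist T d t₀ x₀ (tn n) (xn n)) atTop (𝓝 0)) {X : ℕ → Path d}
    (hX : ∀ n, X n ∈ XSet T d L (tn n) (xn n)) {yn : ℕ → ℝ} {y₀ : ℝ}
    (hyn : Tendsto yn atTop (𝓝 y₀)) {Y : ℕ → ℝ → ℝ} (hY : ∀ n, Y n (tn n) = yn n)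
    (hYlip : ∀ n s t, tn n ≤ s → s ≤ t → t ≤ T → ‖Y n t - Y n s‖ ≤ K * (t - s)) :
    ∃ φ : ℕ → ℕ, StrictMono φ ∧ ∃ x ∈ XSet T d L t₀ x₀, ∃ y : ℝ → ℝ,
      (∀ s t, t₀ ≤ s → s ≤ t → t ≤ T → ‖y t - y s‖ ≤ K * (t - s)) ∧ y t₀ = y₀ ∧
      Tendsto (fun n => supDist T d x (X (φ n))) atTop (𝓝 0) ∧
      (∀ t ∈ Icc t₀ T, Tendsto (fun n => Y (φ n) (max t (tn (φ n)))) atTop (𝓝 (y t))) ∧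
      (∀ t ∈ Icc t₀ T, Tendsto (fun n => X (φ n) (max t (tn (φ n)))) atTop (𝓝 (x t))) ∧
      Tendsto (fun n => X (φ n) (tn (φ n))) atTop (𝓝 (x t₀)) := by
  have hT : 0 ≤ T := ht₀.1.trans ht₀.2
  obtain ⟨R, hR, hRX⟩ := exists_runSup_bound hL htn ht₀ hxn hx₀ hd hX
  have hX' := fun n => (mem_XSet_iff hL (htn n)).1 (hX n)
  have hKX : 0 ≤ L * (1 + R) := by positivity
  have hXlip : ∀ n s t, tn n ≤ s → s ≤ t → t ≤ T → ‖X n t - X n s‖ ≤ L * (1 + R) * (t - s) := by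
    intro n s t hs hst ht
    refine ((hX' n).2.2.lip hL (htn n).1 (hX n).1 s t hs hst ht).trans ?_
    have := sub_nonneg.2 hst
    gcongr
    exact hRX n
  have hmax : ∀ n s t, s ≤ t → max t (tn n) - max s (tn n) ≤ t - s := by
    intro n s t hst
    rcases le_total s (tn n) with h1 | h1 <;> rcases le_total t (tn n) with h2 | h2 <;>
      simp [h1, h2] <;> linarith
  set ξ : ℕ → ℝ → E d := fun n t => X n (max t (tn n)) - X n (tn n) with hξ
  have hξlip : ∀ n s t, 0 ≤ s → s ≤ t → t ≤ T → ‖ξ n t - ξ n s‖ ≤ L * (1 + R) * (t - s) := by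
    intro n s t hs hst ht
    simp only [hξ, sub_sub_sub_cancel_right]
    refine (hXlip n _ _ (le_max_right _ _) (max_le_max_right _ hst) (max_le ht (htn n).2)).trans ?_
    exact mul_le_mul_of_nonneg_left (hmax n s t hst) hKX
  have hξ0 : ∀ n t, t ≤ tn n → ξ n t = 0 := by
    intro n t ht
    simp [hξ, ht]
  obtain ⟨φ₁, hφ₁, g, hglip, hgconv⟩ := exists_subseq_tendstoUniformlyOn (B := 0) hT hKX hξlip
    fun n => by rw [hξ0 n 0 (htn n).1, norm_zero]
  obtain ⟨B, hB⟩ := (hyn.norm).bddAbove_range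
  obtain ⟨φ₂, hφ₂, y, hylip, hyconv⟩ := exists_subseq_tendstoUniformlyOn (a := 0) (b := T) (B := B)
    (f := fun n t => Y (φ₁ n) (max t (tn (φ₁ n)))) hT hK
    (fun n s t hs hst ht => (hYlip _ _ _ (le_max_right _ _) (max_le_max_right _ hst)
      (max_le ht (htn _).2)).trans (mul_le_mul_of_nonneg_left (hmax _ s t hst) hK))
    (fun n => by
      rw [max_eq_right (htn _).1, hY]
      exact hB ⟨_, rfl⟩)
  set φ := φ₁ ∘ φ₂ with hφ
  have hφm : StrictMono φ := hφ₁.comp hφ₂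
  have htφ : Tendsto (fun n => tn (φ n)) atTop (𝓝 t₀) := hlim.comp hφm.tendsto_atTop
  have hgconv' : TendstoUniformlyOn (fun n => ξ (φ n)) g atTop (Icc 0 T) := by
    rw [Metric.tendstoUniformlyOn_iff] at hgconv ⊢
    intro ε hε
    exact hφ₂.tendsto_atTop.eventually (hgconv ε hε)
  have hg0 : ∀ t ∈ Icc 0 t₀, g t = 0 := by
    intro t ht
    have htT : t ∈ Icc 0 T := ⟨ht.1, ht.2.trans ht₀.2⟩
    have h1 := (hgconv'.tendsto_at htT).norm
    have h2 : ∀ n, ‖ξ (φ n) t‖ ≤ L * (1 + R) * (max t (tn (φ n)) - tn (φ n)) := fun n =>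
      hXlip _ _ _ le_rfl (le_max_right _ _) (max_le htT.2 (htn _).2)
    have h3 : Tendsto (fun n => L * (1 + R) * (max t (tn (φ n)) - tn (φ n))) atTop
        (𝓝 (L * (1 + R) * (max t t₀ - t₀))) :=
      ((tendsto_const_nhds.max htφ).sub htφ).const_mul _
    have h4 := le_of_tendsto_of_tendsto' h1 h3 h2
    rw [max_eq_right ht.2, sub_self, mul_zero] at h4
    exact norm_le_zero_iff.1 h4
  set x : Path d := fun t => x₀ (min t t₀) + g t with hx
  have hagree : ∀ t ∈ Icc 0 t₀, x t = x₀ t := by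
    intro t ht
    simp only [hx, hg0 t ht, min_eq_left ht.2, add_zero]
  have hxlip : ∀ s t, t₀ ≤ s → s ≤ t → t ≤ T → ‖x t - x s‖ ≤ L * (1 + R) * (t - s) := by
    intro s t hs hst ht
    simp only [hx, min_eq_right hs, min_eq_right (hs.trans hst), add_sub_add_left_eq_sub]
    exact hglip s t (ht₀.1.trans hs) hst ht
  have hxC : x ∈ Cadlag T d := Cadlag.of_lip hKX ht₀.2 hx₀ hagree hxlip
  have hXeq : ∀ n, ∀ t ∈ Icc 0 T, X n t = xn n (min t (tn n)) + ξ n t := by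
    intro n t ht
    rcases le_total t (tn n) with h | h
    · rw [hξ0 n t h, min_eq_left h, add_zero, (hX' n).2.1 t ⟨ht.1, h⟩]
    · simp only [hξ, max_eq_left h, min_eq_right h]
      rw [← (hX' n).2.1 (tn n) ⟨(htn n).1, le_rfl⟩]
      abel
  have hsup : Tendsto (fun n => supDist T d x (X (φ n))) atTop (𝓝 0) := by
    rw [Metric.tendstoUniformlyOn_iff] at hgconv'
    refine Metric.tendsto_nhds.2 fun ε hε => ?_
    filter_upwards [hgconv' (ε / 3) (by positivity),
      (hd.comp hφm.tendsto_atTop).eventually (gt_mem_nhds (show (0 : ℝ) < ε / 3 by positivity))]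
      with n h1 h2
    rw [Real.dist_eq, sub_zero, abs_of_nonneg (supDist_nonneg _ _)]
    refine (supDist_le (B := 2 * ε / 3) hT fun s hs => ?_).trans_lt (by linarith)
    rw [hXeq _ s hs]
    have e1 := h1 s hs
    rw [dist_eq_norm] at e1
    have e2 := norm_sub_le_stopDist hx₀ (hxn (φ n)) (tn (φ n)) t₀ hs
    have h2' : stopDist T d t₀ x₀ (tn (φ n)) (xn (φ n)) < ε / 3 := h2
    calc ‖x s - (xn (φ n) (min s (tn (φ n))) + ξ (φ n) s)‖
        = ‖(x₀ (min s t₀) - xn (φ n) (min s (tn (φ n)))) + (g s - ξ (φ n) s)‖ := by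
          congr 1; simp only [hx]; abel
      _ ≤ _ := norm_add_le _ _
      _ ≤ 2 * ε / 3 := by linarith
  have hpt : ∀ t ∈ Icc 0 T, Tendsto (fun n => X (φ n) t) atTop (𝓝 (x t)) := by
    intro t ht
    rw [tendsto_iff_norm_sub_tendsto_zero]
    refine squeeze_zero (fun _ => norm_nonneg _) (fun n => ?_) hsup
    rw [norm_sub_rev]
    exact norm_sub_le_supDist hxC (hX _).1 ht
  have hstart : Tendsto (fun n => X (φ n) (tn (φ n))) atTop (𝓝 (x t₀)) := by
    rw [tendsto_iff_norm_sub_tendsto_zero]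
    refine squeeze_zero (fun _ => norm_nonneg _) (fun n => ?_) (hd.comp hφm.tendsto_atTop)
    rw [norm_sub_rev, (hX' _).2.1 _ ⟨(htn _).1, le_rfl⟩, hagree t₀ ⟨ht₀.1, le_rfl⟩]
    have := norm_sub_le_stopDist hx₀ (hxn (φ n)) (tn (φ n)) t₀ ⟨hT, le_rfl⟩
    rwa [min_eq_right ht₀.2, min_eq_right (htn _).2] at this
  have hmaxlim : ∀ t ∈ Icc t₀ T, Tendsto (fun n => X (φ n) (max t (tn (φ n)))) atTop (𝓝 (x t)) := by
    intro t ht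
    have e3 : Tendsto (fun n => X (φ n) (max t (tn (φ n))) - X (φ n) (tn (φ n))) atTop
      (𝓝 (g t)) := hgconv'.tendsto_at ⟨ht₀.1.trans ht.1, ht.2⟩
    have e5 := hstart.add e3
    simp only [add_sub_cancel] at e5
    convert e5 using 2
    simp only [hx, min_eq_right ht.1, min_self, hg0 t₀ ⟨ht₀.1, le_rfl⟩, add_zero]
  have hxLip : XLip T d L t₀ x := by
    intro s t hs hst ht
    rcases hst.eq_or_lt with rfl | hlt
    · simp
    have ht0 : t₀ < t := hs.trans_lt hlt
    have htT : t ∈ Icc 0 T := ⟨ht₀.1.trans ht0.le, ht⟩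
    have h1 := ((hmaxlim t ⟨ht0.le, ht⟩).sub (hmaxlim s ⟨hs, hst.trans ht⟩)).norm
    have h2 : Tendsto (fun n => L * (1 + (runSup d x t + supDist T d x (X (φ n)))) *
        (max t (tn (φ n)) - max s (tn (φ n)))) atTop
        (𝓝 (L * (1 + (runSup d x t + 0)) * (max t t₀ - max s t₀))) :=
      (((hsup.const_add _).const_add 1).const_mul L).mul
        ((tendsto_const_nhds.max htφ).sub (tendsto_const_nhds.max htφ))
    rw [add_zero, max_eq_left ht0.le, max_eq_left hs] at h2
    refine le_of_tendsto_of_tendsto h1 h2 ?_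
    filter_upwards [htφ.eventually (gt_mem_nhds ht0)] with n hn
    refine ((hX' _).2.2 _ _ (le_max_right _ _) (max_le_max_right _ hst)
      (max_le ht (htn _).2)).trans ?_
    have := sub_nonneg.2 (max_le_max_right (tn (φ n)) hst)
    gcongr
    rw [max_eq_left hn.le, supDist_comm]
    exact runSup_le_add_supDist (hX _).1 hxC htT
  have hyconv' : ∀ t ∈ Icc 0 T, Tendsto (fun n => Y (φ n) (max t (tn (φ n)))) atTop (𝓝 (y t)) :=
    fun t ht => hyconv.tendsto_at ht
  refine ⟨φ, hφm, x, (mem_XSet_iff hL ht₀).2 ⟨hxC, hagree, hxLip⟩, y,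
    fun s t hs => hylip s t (ht₀.1.trans hs), ?_, hsup,
    fun t ht => hyconv' t ⟨ht₀.1.trans ht.1, ht.2⟩, hmaxlim, hstart⟩
  have h1 := hyconv' t₀ ht₀
  have h2 := hyn.comp hφm.tendsto_atTop
  refine tendsto_nhds_unique h1 (h2.congr_dist ?_)
  have h3 : Tendsto (fun n => K * (max t₀ (tn (φ n)) - tn (φ n))) atTop
      (𝓝 (K * (max t₀ t₀ - t₀))) := ((tendsto_const_nhds.max htφ).sub htφ).const_mul _
  rw [max_self, sub_self, mul_zero] at h3
  refine squeeze_zero (fun _ => dist_nonneg) (fun n => ?_) h3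
  rw [dist_comm, dist_eq_norm, Function.comp_apply, ← hY]
  exact hYlip _ _ _ le_rfl (le_max_right _ _) (max_le ht₀.2 (htn _).2)

/-- Passage to the limit in the equation of the second component. -/
theorem Sol.of_tendsto {K B : ℝ} (hK : 0 ≤ K) (hB : 0 ≤ B) {tn : ℕ → ℝ}
    {t₀ : ℝ} (htn : ∀ n, tn n ∈ Icc 0 T) (hlim : Tendsto tn atTop (𝓝 t₀))
    {X : ℕ → Path d} {x : Path d} {Y : ℕ → ℝ → ℝ} {y : ℝ → ℝ} {yn : ℕ → ℝ} {y₀ : ℝ} {z : E d}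
    {f : ℕ → ℝ → ℝ} (ht₀ : t₀ ∈ Icc 0 T)
    (hX : ∀ t ∈ Icc t₀ T, Tendsto (fun n => X n (max t (tn n))) atTop (𝓝 (x t)))
    (hy : ∀ s t, t₀ ≤ s → s ≤ t → t ≤ T → ‖y t - y s‖ ≤ K * (t - s))
    (hyn : Tendsto yn atTop (𝓝 y₀))
    (hYy : ∀ t ∈ Icc t₀ T, Tendsto (fun n => Y n (max t (tn n))) atTop (𝓝 (y t)))
    (hY : ∀ n, ∀ t ∈ Icc (tn n) T,
      Y n t = yn n + ⟪X n t - X n (tn n), z⟫_ℝ - ∫ s in tn n..t, f n s)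
    (hmeas : ∀ n, AEStronglyMeasurable (f n) (volume.restrict (Ioo (tn n) T)))
    (hbd : ∀ n, ∀ᵐ s ∂(volume.restrict (Ioo (tn n) T)), ‖f n s‖ ≤ B)
    (hf : ∀ᵐ s ∂(volume.restrict (Ioo t₀ T)),
      Tendsto (fun n => f n s) atTop (𝓝 (H s x (y s) z)))
    (hX₀ : Tendsto (fun n => X n (tn n)) atTop (𝓝 (x t₀))) :
    Sol T d H t₀ x y₀ z y := by
  refine ⟨continuousOn_of_increment_le hK ht₀.2 hy, fun t ht => ?_⟩
  have h1 := tendsto_integral_of_moving_start hB htn hlim hmeas hbd hf ht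
  have h2 : Tendsto (fun n => ⟪X n (max t (tn n)) - X n (tn n), z⟫_ℝ) atTop
      (𝓝 ⟪x t - x t₀, z⟫_ℝ) := ((hX t ht).sub hX₀).inner tendsto_const_nhds
  refine tendsto_nhds_unique (hYy t ht) (((hyn.add h2).sub h1).congr fun n => ?_)
  exact (hY n _ ⟨le_max_right _ _, max_le ht.2 (htn n).2⟩).symm

/-- Compactness of characteristic pairs with converging initial data. -/
theorem YSet.exists_subseq (hH : Hyp T d H LH CH M) {tn : ℕ → ℝ} {t₀ : ℝ}
    (htn : ∀ n, tn n ∈ Icc 0 T) (ht₀ : t₀ ∈ Icc 0 T) (hlim : Tendsto tn atTop (𝓝 t₀))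
    {xn : ℕ → Path d} {x₀ : Path d} (hxn : ∀ n, xn n ∈ Cadlag T d) (hx₀ : x₀ ∈ Cadlag T d)
    (hd : Tendsto (fun n => stopDist T d t₀ x₀ (tn n) (xn n)) atTop (𝓝 0))
    {yn : ℕ → ℝ} {y₀ : ℝ} (hyn : Tendsto yn atTop (𝓝 y₀)) {z : E d}
    {pn : ℕ → Path d × (ℝ → ℝ)} (hp : ∀ n, pn n ∈ YSet T d H LH (tn n) (xn n) (yn n) z) :
    ∃ φ : ℕ → ℕ, StrictMono φ ∧ ∃ p ∈ YSet T d H LH t₀ x₀ y₀ z,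
      Tendsto (fun n => supDist T d p.1 (pn (φ n)).1) atTop (𝓝 0) ∧
      ∀ t ∈ Icc t₀ T, Tendsto (fun n => (pn (φ n)).2 (max t (tn (φ n)))) atTop (𝓝 (p.2 t)) := by
  have hp' := fun n => (mem_YSet_iff hH (htn n)).1 (hp n)
  obtain ⟨R, hR0, hR⟩ := exists_runSup_bound hH.lipZ.1 htn ht₀ hxn hx₀ hd fun n => (hp' n).1
  obtain ⟨y₁, hy₁⟩ := (hyn.norm).bddAbove_range
  have hyb : ∀ n, |yn n| ≤ y₁ := fun n => hy₁ ⟨n, rfl⟩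
  have hy₁0 : 0 ≤ y₁ := (abs_nonneg _).trans (hyb 0)
  have hK := hH.growthLip_nonneg (CH := CH) hR0 (norm_nonneg z) hy₁0
  have hinit := fun n => (hp' n).2.init (htn n).2
  have hlip : ∀ n s t, tn n ≤ s → s ≤ t → t ≤ T →
      ‖(pn n).2 t - (pn n).2 s‖ ≤ growthLip T LH CH R ‖z‖ y₁ * (t - s) :=
    fun n s t hs hst ht => YSet.lip hH (htn n) (hp n) (hR n) (hyb n) hs hst ht
  obtain ⟨φ, hφ, x, hx, y, hy, hy0, hsup, hYl, hXl, hX0⟩ := exists_subseq_paths hH.lipZ.1 hK htn ht₀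
    hlim hxn hx₀ hd (fun n => (hp' n).1) hyn hinit hlip
  have htφ : Tendsto (fun n => tn (φ n)) atTop (𝓝 t₀) := hlim.comp hφ.tendsto_atTop
  refine ⟨φ, hφ, (x, y), (mem_YSet_iff hH ht₀).2 ⟨hx, ?_⟩, hsup, hYl⟩
  set y₂ := y₁ + growthLip T LH CH R ‖z‖ y₁ * T
  have hTpos := hH.pos.le
  have hCH := hH.bound.1
  have hLH := hH.lipZ.1
  refine Sol.of_tendsto (B := CH * (1 + R + y₂) + LH * (1 + R) * ‖z‖)
    (f := fun n s => H s (pn (φ n)).1 ((pn (φ n)).2 s) z) hK (by positivity)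
    (fun n => htn (φ n)) htφ ht₀ hXl hy (hyn.comp hφ.tendsto_atTop) hYl
    (fun n => (hp' _).2.2) ?_ ?_ ?_ hX0
  · exact fun n => hH.aestronglyMeasurable_of_continuousOn (hp' _).1.1 (htn _) (hp' _).2.1 z
  · intro n
    have h1 := ae_restrict_Ioo_mono (htn (φ n)).1 le_rfl
      (hH.ae_abs_le_const (R := R) (Y := y₂) (Z := ‖z‖))
    rw [ae_restrict_iff' measurableSet_Ioo] at h1 ⊢
    filter_upwards [h1] with s h1 hs
    refine h1 hs _ (hp' _).1.1 _ _ ((runSup_mono (hp' _).1.1 ((htn _).1.trans hs.1.le) hs.2.le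
      le_rfl).trans (hR _)) ?_ le_rfl
    have h2 := hlip (φ n) (tn (φ n)) s le_rfl hs.1.le hs.2.le
    rw [hinit] at h2
    have h3 := abs_sub_abs_le_abs_sub ((pn (φ n)).2 s) (yn (φ n))
    rw [Real.norm_eq_abs] at h2
    have h4 : growthLip T LH CH R ‖z‖ y₁ * (s - tn (φ n)) ≤ growthLip T LH CH R ‖z‖ y₁ * T :=
      mul_le_mul_of_nonneg_left (by linarith [(htn (φ n)).1, hs.2]) hK
    linarith [hyb (φ n)]
  · have h1 := ae_restrict_Ioo_mono ht₀.1 le_rfl hH.tendsto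
    rw [ae_restrict_iff' measurableSet_Ioo] at h1 ⊢
    filter_upwards [h1] with s h1 hs
    refine h1 hs x (y s) z _ _ hx.1 (fun n => (hp' _).1.1) hsup ?_
    refine (hYl s ⟨hs.1.le, hs.2.le⟩).congr' ?_
    filter_upwards [htφ.eventually (gt_mem_nhds hs.1)] with n hn
    rw [max_eq_left hn.le]

theorem norm_sub_le_of_eq_integral {s₀ L R B : ℝ} (hL : 0 ≤ L) (hs₀ : 0 ≤ s₀) {x : Path d}
    (hx : x ∈ Cadlag T d) (h : XLip T d L s₀ x) (hR : runSup d x T ≤ R) {z : E d} {y f : ℝ → ℝ}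
    {c : ℝ} (hy : ∀ t ∈ Icc s₀ T, y t = c + ⟪x t - x s₀, z⟫_ℝ - ∫ s in s₀..t, f s)
    (hf : IntegrableOn f (Icc s₀ T)) {s t : ℝ} (hs : s₀ ≤ s) (hst : s ≤ t) (ht : t ≤ T)
    (hB : ∀ᵐ r ∂(volume.restrict (Ioo s t)), ‖f r‖ ≤ B) :
    ‖y t - y s‖ ≤ (L * (1 + R) * ‖z‖ + B) * (t - s) := by
  have e1 : y t - y s = ⟪x t - x s, z⟫_ℝ - ∫ r in s..t, f r := by
    have h0 : s₀ ∈ Icc s₀ T := ⟨le_rfl, hs.trans (hst.trans ht)⟩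
    have h1 : s ∈ Icc s₀ T := ⟨hs, hst.trans ht⟩
    have h2 : t ∈ Icc s₀ T := ⟨hs.trans hst, ht⟩
    rw [hy t h2, hy s h1, ← intervalIntegral.integral_add_adjacent_intervals
      (intervalIntegrable_of_integrableOn_Icc hf h0 h1)
      (intervalIntegrable_of_integrableOn_Icc hf h1 h2),
      show x t - x s₀ = (x t - x s) + (x s - x s₀) by abel, inner_add_left]
    ring
  have e2 := abs_inner_le_of_xLip hL hs₀ hx h hR z hs hst ht
  have e3 : ‖∫ r in s..t, f r‖ ≤ B * |t - s| := by
    refine intervalIntegral.norm_integral_le_of_norm_le_const_ae ?_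
    rw [restrict_Ioo_eq_restrict_Ioc, ae_restrict_iff' measurableSet_Ioc] at hB
    rwa [uIoc_of_le hst]
  rw [abs_of_nonneg (sub_nonneg.2 hst)] at e3
  rw [e1, add_mul]
  exact (norm_sub_le _ _).trans (add_le_add e2 e3)

theorem continuousOn_of_eq_integral {s₀ L : ℝ} (hL : 0 ≤ L) (hs₀ : s₀ ∈ Icc 0 T) {x : Path d}
    (hx : x ∈ Cadlag T d) (h : XLip T d L s₀ x) {z : E d} {y f : ℝ → ℝ}
    {c : ℝ} (hy : ∀ t ∈ Icc s₀ T, y t = c + ⟪x t - x s₀, z⟫_ℝ - ∫ s in s₀..t, f s)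
    (hf : IntegrableOn f (Icc s₀ T)) : ContinuousOn y (Icc s₀ T) := by
  have hxc : ContinuousOn x (Icc s₀ T) :=
    continuousOn_of_increment_le (K := L * (1 + runSup d x T))
      (mul_nonneg hL (by linarith [runSup_nonneg x T])) hs₀.2 (h.lip hL hs₀.1 hx)
  have hint : ContinuousOn (fun t => ∫ s in s₀..t, f s) (Icc s₀ T) := by
    have := intervalIntegral.continuousOn_primitive_interval (a := s₀) (b := T) (f := f)
      (μ := volume) (by rwa [uIcc_of_le hs₀.2])
    rwa [uIcc_of_le hs₀.2] at this
  refine ContinuousOn.congr ?_ hy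
  exact (continuousOn_const.add ((hxc.sub continuousOn_const).inner continuousOn_const)).sub hint

/-- Solvability from larger initial values, with comparison. -/
theorem Sol.exists_ge (hH : Hyp T d H LH CH M) {s₀ : ℝ} (hs₀ : s₀ ∈ Icc 0 T) {x₀ x : Path d}
    (hx : x ∈ XSet T d LH s₀ x₀) {a b : ℝ} (hab : a ≤ b) {z : E d} {y' : ℝ → ℝ}
    (hy' : Sol T d H s₀ x a z y') :
    ∃ y, Sol T d H s₀ x b z y ∧ ∀ t ∈ Icc s₀ T, y' t ≤ y t := by
  have hL := hH.lipZ.1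
  have hCH := hH.bound.1
  have hT := hH.pos.le
  have hxL := ((mem_XSet_iff hL hs₀).1 hx).2.2
  set R := runSup d x T with hR
  have hR0 : 0 ≤ R := runSup_nonneg _ _
  obtain ⟨Y, hY0, hYs⟩ : ∃ Y : ℕ → ℝ → ℝ, Y 0 = y' ∧ ∀ n t,
      Y (n + 1) t = b + ⟪x t - x s₀, z⟫_ℝ - ∫ s in s₀..t, H s x (Y n s) z :=
    ⟨fun n => Nat.rec y' (fun _ Yn t => b + ⟪x t - x s₀, z⟫_ℝ - ∫ s in s₀..t, H s x (Yn s) z) n,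
      rfl, fun _ _ => rfl⟩
  have hcont : ∀ n, ContinuousOn (Y n) (Icc s₀ T) := by
    intro n
    induction n with
    | zero => rw [hY0]; exact hy'.1
    | succ n ih =>
      exact continuousOn_of_eq_integral hL hs₀ hx.1 hxL (fun t _ => hYs n t)
        (hH.integrableOn hx.1 hs₀ ih z)
  have hi := fun n => hH.integrableOn hx.1 hs₀ (hcont n) z
  have hmono : ∀ n, ∀ t ∈ Icc s₀ T, Y n t ≤ Y (n + 1) t := by
    intro n
    induction n with
    | zero =>
      intro t ht
      rw [hYs, hY0, hy'.2 t ht]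
      linarith
    | succ n ih =>
      intro t ht
      rw [hYs (n + 1), hYs n]
      have h0 : s₀ ∈ Icc s₀ T := ⟨le_rfl, hs₀.2⟩
      have : ∫ s in s₀..t, H s x (Y (n + 1) s) z ≤ ∫ s in s₀..t, H s x (Y n s) z := by
        refine intervalIntegral.integral_mono_ae_restrict ht.1
          (intervalIntegrable_of_integrableOn_Icc (hi _) h0 ht)
          (intervalIntegrable_of_integrableOn_Icc (hi _) h0 ht) ?_
        have h1 := ae_restrict_Ioo_mono hs₀.1 ht.2 hH.mono
        rw [restrict_Ioo_eq_restrict_Icc] at h1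
        filter_upwards [h1, ae_restrict_mem measurableSet_Icc] with r h1 hr
        exact h1 x hx.1 z _ _ (ih r ⟨hr.1, hr.2.trans ht.2⟩)
      linarith
  obtain ⟨B₀, hB₀⟩ := isCompact_Icc.exists_bound_of_continuousOn hy'.1
  have hB₀0 : 0 ≤ B₀ := (norm_nonneg _).trans (hB₀ s₀ ⟨le_rfl, hs₀.2⟩)
  set C₁ := CH * (1 + R) + LH * (1 + R) * ‖z‖ with hC₁
  have hC₁0 : 0 ≤ C₁ := by positivity
  set A := B₀ + |b| + LH * (1 + R) * ‖z‖ * T + C₁ * T with hA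
  have hA0 : 0 ≤ A := by positivity
  have hbound : ∀ n, ∀ t ∈ Icc s₀ T, |Y n t| ≤ A * Real.exp (CH * (t - s₀)) := by
    intro n
    induction n with
    | zero =>
      intro t ht
      have h1 : |y' t| ≤ B₀ := hB₀ t ht
      have h2 : 1 ≤ Real.exp (CH * (t - s₀)) :=
        Real.one_le_exp (mul_nonneg hCH (sub_nonneg.2 ht.1))
      have h3 : B₀ ≤ A := by
        have : 0 ≤ |b| + LH * (1 + R) * ‖z‖ * T + C₁ * T := by positivity
        linarith
      rw [hY0]
      nlinarith
    | succ n ih =>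
      intro t ht
      have hts : 0 ≤ t - s₀ := sub_nonneg.2 ht.1
      have htT : t - s₀ ≤ T := by linarith [hs₀.1, ht.2]
      rw [hYs]
      have e2 := abs_inner_le_of_xLip hL hs₀.1 hx.1 hxL le_rfl z le_rfl ht.1 ht.2
      have e3 : ‖∫ s in s₀..t, H s x (Y n s) z‖ ≤
          ∫ s in s₀..t, (C₁ + CH * (A * Real.exp (CH * (s - s₀)))) := by
        refine intervalIntegral.norm_integral_le_of_norm_le ht.1 ?_ (by
          apply Continuous.intervalIntegrable; fun_prop)
        have h1 := ae_restrict_Ioo_mono hs₀.1 ht.2 hH.abs_le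
        rw [restrict_Ioo_eq_restrict_Ioc, ae_restrict_iff' measurableSet_Ioc] at h1
        filter_upwards [h1] with s h1 hs
        have h2 := h1 hs x hx.1 (Y n s) z
        have h3 := ih s ⟨hs.1.le, hs.2.trans ht.2⟩
        have h4 : runSup d x s ≤ R :=
          runSup_mono hx.1 (hs₀.1.trans hs.1.le) (hs.2.trans ht.2) le_rfl
        refine h2.trans ?_
        calc CH * (1 + runSup d x s + |Y n s|) + LH * (1 + runSup d x s) * ‖z‖
            ≤ CH * (1 + R + A * Real.exp (CH * (s - s₀))) + LH * (1 + R) * ‖z‖ := by gcongr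
          _ = _ := by rw [hC₁]; ring
      have e4 : ∫ s in s₀..t, (C₁ + CH * (A * Real.exp (CH * (s - s₀)))) =
          C₁ * (t - s₀) + A * (Real.exp (CH * (t - s₀)) - 1) := by
        rw [intervalIntegral.integral_eq_sub_of_hasDerivAt
          (f := fun s => C₁ * (s - s₀) + A * Real.exp (CH * (s - s₀)))]
        · simp; ring
        · intro s _
          have h1 : HasDerivAt (fun s : ℝ => s - s₀) 1 s := (hasDerivAt_id s).sub_const s₀
          have h2 := (h1.const_mul CH).exp
          refine ((h1.const_mul C₁).add (h2.const_mul A)).congr_deriv ?_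
          ring
        · apply Continuous.intervalIntegrable; fun_prop
      rw [e4, Real.norm_eq_abs] at e3
      have e5 : C₁ * (t - s₀) ≤ C₁ * T := by gcongr
      have e6 : LH * (1 + R) * ‖z‖ * (t - s₀) ≤ LH * (1 + R) * ‖z‖ * T := by gcongr
      have e7 := abs_sub (b + ⟪x t - x s₀, z⟫_ℝ) (∫ s in s₀..t, H s x (Y n s) z)
      have e8 := abs_add_le b ⟪x t - x s₀, z⟫_ℝ
      rw [hR] at e6
      rw [← hR] at e2 e6
      linarith
  set B₁ := A * Real.exp (CH * T) with hB₁
  have hB₁0 : 0 ≤ B₁ := by positivity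
  have hbound' : ∀ n, ∀ t ∈ Icc s₀ T, |Y n t| ≤ B₁ := by
    intro n t ht
    refine (hbound n t ht).trans ?_
    rw [hB₁]
    gcongr
    linarith [hs₀.1, ht.2]
  have hHb : ∀ n, ∀ᵐ s ∂(volume.restrict (Ioo s₀ T)),
      ‖H s x (Y n s) z‖ ≤ CH * (1 + R + B₁) + LH * (1 + R) * ‖z‖ := by
    intro n
    have h1 := ae_restrict_Ioo_mono hs₀.1 le_rfl
      (hH.ae_abs_le_const (R := R) (Y := B₁) (Z := ‖z‖))
    rw [ae_restrict_iff' measurableSet_Ioo] at h1 ⊢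
    filter_upwards [h1] with s h1 hs
    exact h1 hs x hx.1 _ z (runSup_mono hx.1 (hs₀.1.trans hs.1.le) hs.2.le le_rfl)
      (hbound' n s ⟨hs.1.le, hs.2.le⟩) le_rfl
  have hlip : ∀ n s t, s₀ ≤ s → s ≤ t → t ≤ T → ‖Y (n + 1) t - Y (n + 1) s‖ ≤
      (LH * (1 + R) * ‖z‖ + (CH * (1 + R + B₁) + LH * (1 + R) * ‖z‖)) * (t - s) :=
    fun n s t hs hst ht => norm_sub_le_of_eq_integral hL hs₀.1 hx.1 hxL le_rfl
      (fun t _ => hYs n t) (hi n) hs hst ht (ae_restrict_Ioo_mono hs ht (hHb n))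
  have hmono' : ∀ t ∈ Icc s₀ T, Monotone fun n => Y n t := fun t ht =>
    monotone_nat_of_le_succ fun n => hmono n t ht
  have hbdd : ∀ t ∈ Icc s₀ T, BddAbove (range fun n => Y n t) := by
    rintro t ht
    refine ⟨B₁, ?_⟩
    rintro _ ⟨n, rfl⟩
    exact (le_abs_self _).trans (hbound' n t ht)
  have hlim : ∀ t ∈ Icc s₀ T, Tendsto (fun n => Y n t) atTop (𝓝 (⨆ n, Y n t)) := fun t ht =>
    tendsto_atTop_ciSup (hmono' t ht) (hbdd t ht)
  refine ⟨fun t => ⨆ n, Y n t, ?_, fun t ht => hY0 ▸ le_ciSup (hbdd t ht) 0⟩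
  have hK : 0 ≤ LH * (1 + R) * ‖z‖ + (CH * (1 + R + B₁) + LH * (1 + R) * ‖z‖) := by positivity
  refine Sol.of_tendsto (K := _) (B := CH * (1 + R + B₁) + LH * (1 + R) * ‖z‖) hK (by positivity)
    (tn := fun _ => s₀) (fun _ => hs₀) tendsto_const_nhds (X := fun _ => x)
    (Y := fun n => Y (n + 1)) (yn := fun _ => b) (f := fun n s => H s x (Y n s) z) hs₀ ?_ ?_
    tendsto_const_nhds ?_ (fun n t _ => hYs n t)
    (fun n => hH.aestronglyMeasurable_of_continuousOn hx.1 hs₀ (hcont n) z) hHb ?_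
    tendsto_const_nhds
  · intro t ht
    simp [ht.1]
  · intro s t hs hst ht
    exact le_of_tendsto (((hlim t ⟨hs.trans hst, ht⟩).comp (tendsto_add_atTop_nat 1)).sub
      ((hlim s ⟨hs, hst.trans ht⟩).comp (tendsto_add_atTop_nat 1))).norm
      (Eventually.of_forall fun n => hlip n s t hs hst ht)
  · intro t ht
    simp only [max_eq_left ht.1]
    exact (hlim t ht).comp (tendsto_add_atTop_nat 1)
  · have h1 := ae_restrict_Ioo_mono hs₀.1 le_rfl hH.continuous_y
    rw [ae_restrict_iff' measurableSet_Ioo] at h1 ⊢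
    filter_upwards [h1] with s h1 hs
    exact ((h1 hs x hx.1 z).tendsto _).comp (hlim s ⟨hs.1.le, hs.2.le⟩)

/-- With the arguments of the Hamiltonian frozen, one path serves two values of `z`. -/
theorem Hyp.exists_frozen_step (hH : Hyp T d H LH CH M) {t₁ : ℝ} (ht₁ : t₁ ∈ Icc 0 T)
    {X : Path d} (hX : X ∈ Cadlag T d) (y₁ : ℝ) (z z' : E d) :
    ∃ X' ∈ XSet T d LH t₁ X, (∀ r ≤ t₁, X' r = X r) ∧ ∃ y' : ℝ → ℝ, ∀ t ∈ Icc t₁ T, ∀ ζ ∈ ({z, z'} : Set (E d)),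
      y' t = y₁ + ⟪X' t - X' t₁, ζ⟫_ℝ - (∫ s in t₁..t, H s (fun r => X (min r t₁)) y₁ ζ) := by
  set X₁ : Path d := fun r => X (min r t₁) with hX₁
  have hX₁C : X₁ ∈ Cadlag T d := Cadlag.stopped hX t₁
  have hi : ∀ ζ, IntegrableOn (fun s => H s X₁ y₁ ζ) (Icc t₁ T) := fun ζ =>
    hH.integrableOn hX₁C ht₁ continuousOn_const ζ
  set q : ℝ → E d := fun s => ((H s X₁ y₁ z - H s X₁ y₁ z') / ‖z - z'‖ ^ 2) • (z - z') with hq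
  have hqi : IntegrableOn q (Icc t₁ T) := (((hi z).sub (hi z')).div_const _).smul_const _
  have hqz : ∀ s, ⟪q s, z - z'⟫_ℝ = H s X₁ y₁ z - H s X₁ y₁ z' := by
    intro s
    rw [hq, real_inner_smul_left, real_inner_self_eq_norm_sq]
    rcases eq_or_ne z z' with rfl | hne
    · simp
    · exact div_mul_cancel₀ _ (pow_ne_zero _ (norm_ne_zero_iff.2 (sub_ne_zero.2 hne)))
  set X' : Path d := fun t => X₁ t + ∫ s in t₁..max t t₁, q s with hX'
  have hX'1 : X' t₁ = X t₁ := by simp [hX', hX₁]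
  have hagree' : ∀ t ≤ t₁, X' t = X t := by
    intro t ht
    simp [hX', hX₁, ht]
  have hagree : ∀ t ∈ Icc 0 t₁, X' t = X t := fun t ht => hagree' t ht.2
  have hX't : ∀ t ∈ Icc t₁ T, X' t = X' t₁ + ∫ s in t₁..t, q s := by
    intro t ht
    rw [hX'1]
    simp [hX', hX₁, ht.1]
  have hX'C : X' ∈ Cadlag T d := by
    refine Cadlag.of_agree hX hagree (ContinuousOn.congr (continuousOn_const.add ?_) hX't)
    have := intervalIntegral.continuousOn_primitive_interval (a := t₁) (b := T) (f := q)
      (μ := volume) (by rwa [uIcc_of_le ht₁.2])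
    rwa [uIcc_of_le ht₁.2] at this
  refine ⟨X', ⟨hX'C, hagree, q, hqi, hX't, ?_⟩, hagree',
    fun t => y₁ + ⟪X' t - X' t₁, z⟫_ℝ - (∫ s in t₁..t, H s X₁ y₁ z), fun t ht ζ hζ => ?_⟩
  · have h1 := ae_restrict_Ioo_mono ht₁.1 le_rfl hH.lipZ.2
    rw [ae_restrict_iff' measurableSet_Ioo] at h1 ⊢
    filter_upwards [h1] with t h1 ht
    have h2 : runSup d X₁ t ≤ runSup d X' t := by
      refine PHJ.runSup_le (ht₁.1.trans ht.1.le) fun s hs => ?_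
      have h3 : X₁ s = X' (min s t₁) :=
        (hagree _ ⟨le_min hs.1 ht₁.1, min_le_right _ _⟩).symm
      rw [h3]
      exact norm_le_runSup hX'C (le_min hs.1 ht₁.1) ((min_le_left _ _).trans hs.2) ht.2.le
    have h4 := h1 ht X₁ hX₁C y₁ z z'
    have hLH := hH.lipZ.1
    have h5 : ‖q t‖ ≤ LH * (1 + runSup d X₁ t) := by
      rw [hq]
      simp only
      rw [norm_smul, Real.norm_eq_abs, abs_div, abs_of_nonneg (sq_nonneg ‖z - z'‖)]
      rcases eq_or_ne z z' with rfl | hne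
      · have := runSup_nonneg X₁ t
        simp only [sub_self, norm_zero, mul_zero]
        positivity
      · have hpos : 0 < ‖z - z'‖ := norm_pos_iff.2 (sub_ne_zero.2 hne)
        rw [div_mul_eq_mul_div, div_le_iff₀ (by positivity)]
        nlinarith
    refine h5.trans ?_
    gcongr
  · rcases hζ with rfl | rfl
    · rfl
    have h0 : t₁ ∈ Icc t₁ T := ⟨le_rfl, ht₁.2⟩
    have h1 : ⟪X' t - X' t₁, z - ζ⟫_ℝ =
        (∫ s in t₁..t, H s X₁ y₁ z) - ∫ s in t₁..t, H s X₁ y₁ ζ := by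
      have h2 := integral_inner_sub (z := z - ζ) hqi (integrableOn_zero (s := Icc t₁ T)) ht
      simp only [sub_zero, intervalIntegral.integral_zero, hqz] at h2
      rw [hX't t ht, add_sub_cancel_left, ← h2, intervalIntegral.integral_sub
        (intervalIntegrable_of_integrableOn_Icc (hi z) h0 ht)
        (intervalIntegrable_of_integrableOn_Icc (hi ζ) h0 ht)]
    rw [inner_sub_right] at h1
    linarith

theorem Hyp.exists_euler (hH : Hyp T d H LH CH M) {t₀ : ℝ} (ht₀ : t₀ ∈ Icc 0 T)
    {x₀ : Path d} (hx₀ : x₀ ∈ Cadlag T d) (y₀ : ℝ) (z z' : E d) {Δ : ℝ} (hΔ : 0 ≤ Δ) (n : ℕ) :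
    ∃ X ∈ XSet T d LH t₀ x₀, ∃ (y : ℝ → ℝ) (f : E d → ℝ → ℝ),
      (∀ ζ, Measurable (f ζ)) ∧ (∀ ζ, IntegrableOn (f ζ) (Icc t₀ T)) ∧
      (∀ t ∈ Icc t₀ T, ∀ ζ ∈ ({z, z'} : Set (E d)),
        y t = y₀ + ⟪X t - X t₀, ζ⟫_ℝ - ∫ s in t₀..t, f ζ s) ∧
      ∀ s ∈ Ioc t₀ T, s ≤ t₀ + n * Δ → ∃ σ ∈ Icc t₀ s, s - σ ≤ Δ ∧
        ∀ ζ, f ζ s = H s (fun r => X (min r σ)) (y σ) ζ := by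
  have hL := hH.lipZ.1
  induction n with
  | zero =>
    refine ⟨_, XSet.const hL ht₀ hx₀, fun _ => y₀, fun _ _ => 0, fun _ => measurable_const,
      fun _ => integrableOn_zero, ?_, ?_⟩
    · intro t ht ζ _
      simp [ht.1]
    · intro s hs h
      have := hs.1
      norm_num at h
      linarith
  | succ n ih =>
    obtain ⟨X, hX, y, f, hfm, hfi, hy, hf⟩ := ih
    rcases lt_or_ge T (t₀ + n * Δ) with hgt | hle
    · exact ⟨X, hX, y, f, hfm, hfi, hy, fun s hs _ => hf s hs (hs.2.trans hgt.le)⟩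
    set t₁ := t₀ + n * Δ with ht₁
    have h01 : t₀ ≤ t₁ := by
      rw [ht₁]
      have : 0 ≤ n * Δ := by positivity
      linarith
    have h1 : t₁ ∈ Icc 0 T := ⟨ht₀.1.trans h01, hle⟩
    obtain ⟨X', hX', hXm, y', hy'⟩ := hH.exists_frozen_step h1 hX.1 (y t₁) z z'
    have hX₁C : (fun r => X (min r t₁)) ∈ Cadlag T d := Cadlag.stopped hX.1 t₁
    have hgi : ∀ ζ, IntegrableOn (fun s => H s (fun r => X (min r t₁)) (y t₁) ζ) (Icc t₁ T) :=
      fun ζ => hH.integrableOn hX₁C h1 continuousOn_const ζ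
    have hIc : ∀ a b ζ, a ≤ b → b ≤ t₁ → ∫ s in a..b, (if s ≤ t₁ then f ζ s else
        H s (fun r => X (min r t₁)) (y t₁) ζ) = ∫ s in a..b, f ζ s := by
      intro a b ζ hab hb
      refine intervalIntegral.integral_congr_ae (Eventually.of_forall fun s hs => ?_)
      rw [uIoc_of_le hab] at hs
      rw [if_pos (hs.2.trans hb)]
    have hId : ∀ b ζ, t₁ ≤ b → ∫ s in t₁..b, (if s ≤ t₁ then f ζ s else
        H s (fun r => X (min r t₁)) (y t₁) ζ) =
          ∫ s in t₁..b, H s (fun r => X (min r t₁)) (y t₁) ζ := by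
      intro b ζ hb
      refine intervalIntegral.integral_congr_ae (Eventually.of_forall fun s hs => ?_)
      rw [uIoc_of_le hb] at hs
      rw [if_neg hs.1.not_ge]
    have hFi : ∀ ζ, IntegrableOn (fun s => if s ≤ t₁ then f ζ s else
        H s (fun r => X (min r t₁)) (y t₁) ζ) (Icc t₀ T) := by
      intro ζ
      rw [← Icc_union_Ioc_eq_Icc h01 hle]
      refine IntegrableOn.union ?_ ?_
      · refine ((hfi ζ).mono_set (Icc_subset_Icc_right hle)).congr_fun (fun s hs => ?_)
          measurableSet_Icc
        simp [hs.2]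
      · refine ((hgi ζ).mono_set Ioc_subset_Icc_self).congr_fun (fun s hs => ?_)
          measurableSet_Ioc
        simp [hs.1]
    refine ⟨X', XSet.trans hL ht₀.1 h01 hle hX hX', fun t => if t ≤ t₁ then y t else y' t,
      fun ζ s => if s ≤ t₁ then f ζ s else H s (fun r => X (min r t₁)) (y t₁) ζ,
      fun ζ => (hfm ζ).ite measurableSet_Iic (hH.meas _ _ _), hFi, ?_, ?_⟩
    · intro t ht ζ hζ
      simp only
      rcases le_or_gt t t₁ with h | h
      · rw [if_pos h, hIc _ _ _ ht.1 h, hXm t h, hXm t₀ h01, hy t ht ζ hζ]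
      · have e0 : t₀ ∈ Icc t₀ T := ⟨le_rfl, ht₀.2⟩
        have e1 : t₁ ∈ Icc t₀ T := ⟨h01, hle⟩
        have e2 := hy t₁ e1 ζ hζ
        rw [if_neg h.not_ge, hy' t ⟨h.le, ht.2⟩ ζ hζ,
          ← intervalIntegral.integral_add_adjacent_intervals
          (intervalIntegrable_of_integrableOn_Icc (hFi ζ) e0 e1)
          (intervalIntegrable_of_integrableOn_Icc (hFi ζ) e1 ht), hIc _ _ _ h01 le_rfl,
          hId _ _ h.le, hXm t₁ le_rfl, hXm t₀ h01,
          show X' t - X t₀ = (X' t - X t₁) + (X t₁ - X t₀) by abel, inner_add_left]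
        linarith
    · intro s hs hsn
      rcases le_or_gt s t₁ with h | h
      · obtain ⟨σ, hσ, hσΔ, e⟩ := hf s hs h
        refine ⟨σ, hσ, hσΔ, fun ζ => ?_⟩
        simp only [if_pos h, e ζ, if_pos (hσ.2.trans h), hXm _ ((min_le_right _ σ).trans (hσ.2.trans h))]
      · refine ⟨t₁, ⟨h01, h.le⟩, ?_, fun ζ => ?_⟩
        · rw [ht₁]
          push_cast at hsn
          linarith
        · simp only [if_neg h.not_ge, if_pos le_rfl, hXm _ (min_le_right _ t₁)]

theorem runSup_stop_le {x : Path d} (hx : x ∈ Cadlag T d) {σ s : ℝ} (hσ : 0 ≤ σ) (hs : 0 ≤ s)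
    (hsT : s ≤ T) : runSup d (fun r => x (min r σ)) s ≤ runSup d x s :=
  PHJ.runSup_le hs fun _ hr => norm_le_runSup hx (le_min hr.1 hσ) ((min_le_left _ _).trans hr.2) hsT

theorem supDist_stop_le {L R t₀ s σ : ℝ} (hT : 0 ≤ T) {x X x₀ : Path d} (hL : 0 ≤ L)
    (ht₀ : t₀ ∈ Icc 0 T) (hx : x ∈ Cadlag T d) (hX : X ∈ XSet T d L t₀ x₀)
    (hR : runSup d X T ≤ R) (hσ : t₀ ≤ σ) (hσs : σ ≤ s) :
    supDist T d (fun r => x (min r s)) (fun r => X (min r σ)) ≤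
      supDist T d x X + L * (1 + R) * (s - σ) := by
  refine supDist_le hT fun r hr => ?_
  have h0 : 0 ≤ σ := ht₀.1.trans hσ
  have h1 := norm_sub_le_supDist hx hX.1 (s := min r s)
    ⟨le_min hr.1 (h0.trans hσs), (min_le_left _ _).trans hr.2⟩
  have hR0 : 0 ≤ R := (runSup_nonneg _ _).trans hR
  have h2 : ‖X (min r s) - X (min r σ)‖ ≤ L * (1 + R) * (s - σ) := by
    have hsσ := sub_nonneg.2 hσs
    rcases le_total r σ with h | h
    · rw [min_eq_left h, min_eq_left (h.trans hσs), sub_self, norm_zero]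
      positivity
    · rw [min_eq_right h]
      refine (((mem_XSet_iff hL ht₀).1 hX).2.2.lip hL ht₀.1 hX.1 σ (min r s) hσ (le_min h hσs)
        ((min_le_left _ _).trans hr.2)).trans ?_
      have : min r s - σ ≤ s - σ := sub_le_sub_right (min_le_right _ _) _
      have : 0 ≤ min r s - σ := sub_nonneg.2 (le_min h hσs)
      gcongr
  have h3 := norm_sub_le_norm_sub_add_norm_sub (x (min r s)) (X (min r s)) (X (min r σ))
  linarith

/-- The Hamiltonian is non-anticipating along Lipschitz paths. -/
theorem Hyp.eq_stopped (hH : Hyp T d H LH CH M) {t₀ : ℝ} (ht₀ : t₀ ∈ Icc 0 T) {x₀ x : Path d}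
    (hx₀ : x₀ ∈ Cadlag T d) (hx : x ∈ XSet T d LH t₀ x₀) (z : E d) :
    ∀ᵐ s ∂(volume.restrict (Ioo t₀ T)), ∀ y, H s (fun r => x (min r s)) y z = H s x y z := by
  have hL := hH.lipZ.1
  have h1 : ∀ᵐ s ∂(volume : Measure ℝ), ∀ q : ℚ, t₀ < s → s < q → (q : ℝ) ≤ T →
      ∀ y, H s (fun r => x (min r q)) y z = H s x y z := by
    refine ae_all_iff.2 fun q => ?_
    by_cases hq : t₀ ≤ q ∧ (q : ℝ) ≤ T
    · have := hH.eq_ae ht₀ hq.2 hx₀ (XSet.stopped hL ht₀ hq.1 hx₀ hx) hx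
        (fun t ht => by simp only [min_eq_left ht.2]) z
      rw [ae_restrict_iff' measurableSet_Ioo] at this
      filter_upwards [this] with s hs h2 h3 _ y
      exact hs ⟨h2, h3⟩ y
    · refine Eventually.of_forall fun s h2 h3 h4 => ?_
      exact absurd ⟨(h2.trans h3).le, h4⟩ hq
  have h2 := ae_restrict_Ioo_mono ht₀.1 le_rfl hH.tendsto
  rw [ae_restrict_iff' measurableSet_Ioo] at h2 ⊢
  filter_upwards [h1, h2] with s h1 h2 hs y
  have hqn : ∀ n : ℕ, ∃ q : ℚ, s < q ∧ (q : ℝ) < min T (s + 1 / (n + 1)) := fun n =>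
    exists_rat_btwn (lt_min hs.2 (by have : (0 : ℝ) < 1 / (n + 1) := by positivity
                                     linarith))
  choose q hq1 hq2 using hqn
  have h3 := h2 hs (fun r => x (min r s)) y z (fun n r => x (min r (q n))) (fun _ => y)
    (Cadlag.stopped hx.1 s) (fun n => Cadlag.stopped hx.1 _) (l := atTop) ?_ tendsto_const_nhds
  · refine tendsto_nhds_unique h3 ?_
    simp_rw [fun n => h1 (q n) hs.1 (hq1 n) ((hq2 n).le.trans (min_le_left _ _)) y]
    exact tendsto_const_nhds
  · have h4 : ∀ n, supDist T d (fun r => x (min r s)) (fun r => x (min r (q n))) ≤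
        LH * (1 + runSup d x T) * (1 / ((n : ℝ) + 1)) := by
      intro n
      have := supDist_stop_le hH.pos.le hL ht₀ hx.1 hx le_rfl hs.1.le (hq1 n).le
      rw [supDist_comm]
      refine this.trans ?_
      rw [supDist_self x hH.pos.le, zero_add]
      have := runSup_nonneg x T
      have := (hq2 n).le.trans (min_le_right _ _)
      gcongr
      linarith
    refine squeeze_zero (fun _ => supDist_nonneg _ _) h4 ?_
    have := (tendsto_one_div_add_atTop_nhds_zero_nat (𝕜 := ℝ)).const_mul (LH * (1 + runSup d x T))
    rwa [mul_zero] at this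

/-- For two values of `z` there is a common characteristic pair. -/
theorem Hyp.exists_common_pair (hH : Hyp T d H LH CH M) {t₀ : ℝ} (ht₀ : t₀ ∈ Icc 0 T)
    {x₀ : Path d} (hx₀ : x₀ ∈ Cadlag T d) (y₀ : ℝ) (z z' : E d) :
    ∃ p, p ∈ YSet T d H LH t₀ x₀ y₀ z ∧ p ∈ YSet T d H LH t₀ x₀ y₀ z' := by
  have hL := hH.lipZ.1
  have hCH := hH.bound.1
  have hT := hH.pos.le
  have h00 : t₀ ∈ Icc t₀ T := ⟨le_rfl, ht₀.2⟩
  set Δ : ℕ → ℝ := fun n => (T - t₀) / (n + 1) with hΔ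
  have hΔ0 : ∀ n, 0 ≤ Δ n := fun n => div_nonneg (sub_nonneg.2 ht₀.2) (by positivity)
  have hΔlim : Tendsto Δ atTop (𝓝 0) := by
    have := (tendsto_one_div_add_atTop_nhds_zero_nat (𝕜 := ℝ)).const_mul (T - t₀)
    simpa only [mul_zero, mul_one_div] using this
  choose X hX y f hfm hfi hy hf using fun n : ℕ =>
    hH.exists_euler ht₀ hx₀ y₀ z z' (hΔ0 n) (n + 1)
  have hf' : ∀ n, ∀ s ∈ Ioc t₀ T, ∃ σ ∈ Icc t₀ s, s - σ ≤ Δ n ∧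
      ∀ ζ, f n ζ s = H s (fun r => X n (min r σ)) (y n σ) ζ := by
    intro n s hs
    refine hf n s hs ?_
    have : ((n + 1 : ℕ) : ℝ) * Δ n = T - t₀ := by
      simp only [hΔ]
      push_cast
      field_simp
    rw [this]
    linarith [hs.2]
  set R := (1 + runSup d x₀ t₀) * Real.exp (2 * LH * T) with hR
  have hXR : ∀ n, runSup d (X n) T ≤ R := fun n => XSet.runSup_le hL ht₀ (hX n)
  have hR0 : 0 ≤ R := (runSup_nonneg _ _).trans (hXR 0)
  have hXL := fun n => ((mem_XSet_iff hL ht₀).1 (hX n)).2.2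
  have hfbd : ∀ n ζ m t, t ≤ T → (∀ τ ∈ Icc t₀ t, ‖y n τ‖ ≤ m) →
      ∀ᵐ s ∂(volume.restrict (Ioo t₀ t)),
        ‖f n ζ s‖ ≤ CH * (1 + R + m) + LH * (1 + R) * ‖ζ‖ := by
    intro n ζ m t ht hm
    have h1 := ae_restrict_Ioo_mono ht₀.1 ht
      (hH.ae_abs_le_const (R := R) (Y := m) (Z := ‖ζ‖))
    rw [ae_restrict_iff' measurableSet_Ioo] at h1 ⊢
    filter_upwards [h1] with s h1 hs
    obtain ⟨σ, hσ, -, e⟩ := hf' n s ⟨hs.1, hs.2.le.trans ht⟩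
    rw [e ζ]
    have hs0 : 0 ≤ s := ht₀.1.trans hs.1.le
    refine h1 hs _ (Cadlag.stopped (hX n).1 σ) _ _ ?_ (hm σ ⟨hσ.1, hσ.2.trans hs.2.le⟩) le_rfl
    exact (runSup_stop_le (hX n).1 (ht₀.1.trans hσ.1) hs0 (hs.2.le.trans ht)).trans
      ((runSup_mono (hX n).1 hs0 (hs.2.le.trans ht) le_rfl).trans (hXR n))
  have hyc : ∀ n, ContinuousOn (y n) (Icc t₀ T) := fun n =>
    continuousOn_of_eq_integral hL ht₀ (hX n).1 (hXL n) (fun t ht => hy n t ht z (by simp))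
      (hfi n z)
  have hinc : ∀ n s t, t₀ ≤ s → s ≤ t → t ≤ T → ∀ m, (∀ τ ∈ Icc t₀ t, ‖y n τ‖ ≤ m) →
      ‖y n t - y n s‖ ≤
        (LH * (1 + R) * ‖z‖ + (CH * (1 + R + m) + LH * (1 + R) * ‖z‖)) * (t - s) :=
    fun n s t hs hst ht m hm => norm_sub_le_of_eq_integral hL ht₀.1 (hX n).1 (hXL n) (hXR n)
      (fun t ht => hy n t ht z (by simp)) (hfi n z) hs hst ht
      (ae_restrict_Ioo_mono hs le_rfl (hfbd n z m t ht hm))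
  have hG := hH.growthConst_nonneg (CH := CH) hR0 (norm_nonneg z)
  have hyn0 : ∀ n, y n t₀ = y₀ := by
    intro n
    rw [hy n t₀ h00 z (by simp)]
    simp
  obtain ⟨B, hB0, hB⟩ : ∃ B, 0 ≤ B ∧ ∀ n, ∀ t ∈ Icc t₀ T, ‖y n t‖ ≤ B := by
    refine ⟨(1 + |y₀|) * Real.exp (2 * growthConst LH CH R ‖z‖ * T), by positivity,
      fun n t ht => ?_⟩
    have h1 := one_add_norm_le_exp_of_increment_le (y := y n) (a := t₀) (b := T) hG
      (isCompact_Icc.exists_bound_of_continuousOn (hyc n)) ?_ t ht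
    · rw [hyn0, Real.norm_eq_abs y₀] at h1
      have h2 : Real.exp (2 * growthConst LH CH R ‖z‖ * (t - t₀)) ≤
          Real.exp (2 * growthConst LH CH R ‖z‖ * T) := by
        gcongr
        linarith [ht.2, ht₀.1]
      have h3 := mul_le_mul_of_nonneg_left h2 (show 0 ≤ 1 + |y₀| by positivity)
      linarith
    · intro s t hs hst ht m hm
      refine (hinc n s t hs hst ht m hm).trans ?_
      have hm0 : 0 ≤ m := (norm_nonneg _).trans (hm t ⟨hs.trans hst, le_rfl⟩)
      refine mul_le_mul_of_nonneg_right ?_ (sub_nonneg.2 hst)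
      have e1 : 0 ≤ LH * (1 + R) * ‖z‖ * m := by positivity
      have e2 : 0 ≤ CH * R * m := by positivity
      have e3 : growthConst LH CH R ‖z‖ * (1 + m) = LH * (1 + R) * ‖z‖ +
          (CH * (1 + R + m) + LH * (1 + R) * ‖z‖) + (2 * (LH * (1 + R) * ‖z‖ * m) + CH * R * m) := by
        unfold growthConst
        ring
      linarith
  set B' := CH * (1 + R + B) + LH * (1 + R) * ‖z‖ with hB'
  have hK : 0 ≤ LH * (1 + R) * ‖z‖ + B' := by positivity
  have hylip : ∀ n s t, t₀ ≤ s → s ≤ t → t ≤ T →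
      ‖y n t - y n s‖ ≤ (LH * (1 + R) * ‖z‖ + B') * (t - s) := fun n s t hs hst ht =>
    hinc n s t hs hst ht B fun τ hτ => hB n τ ⟨hτ.1, hτ.2.trans ht⟩
  obtain ⟨φ, hφ, x, hx, y', hy'lip, hy'0, hxd, hyl, hxl, hxl0⟩ := exists_subseq_paths
    (tn := fun _ => t₀) (xn := fun _ => x₀) (x₀ := x₀) (yn := fun _ => y₀) (y₀ := y₀) (Y := y)
    hL hK (fun _ => ht₀) ht₀ tendsto_const_nhds (fun _ => hx₀) hx₀
    (by
      rw [stopDist_eq_supDist, supDist_self _ hT]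
      exact tendsto_const_nhds) hX tendsto_const_nhds hyn0 hylip
  have hyl' : ∀ t ∈ Icc t₀ T, Tendsto (fun n => y (φ n) t) atTop (𝓝 (y' t)) := by
    intro t ht
    simpa only [max_eq_left ht.1] using hyl t ht
  have hsol : ∀ ζ ∈ ({z, z'} : Set (E d)), Sol T d H t₀ x y₀ ζ y' := by
    intro ζ hζ
    refine Sol.of_tendsto (tn := fun _ => t₀) (yn := fun _ => y₀) (f := fun n => f (φ n) ζ)
      (B := CH * (1 + R + B) + LH * (1 + R) * ‖ζ‖)
      hK (by positivity) (fun _ => ht₀) tendsto_const_nhds ht₀ hxl hy'lip tendsto_const_nhds hyl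
      (fun n t ht => hy (φ n) t ht ζ hζ) (fun n => (hfm (φ n) ζ).aestronglyMeasurable)
      (fun n => hfbd _ ζ B T le_rfl (hB _)) ?_ hxl0
    have h1 := hH.eq_stopped ht₀ hx₀ hx ζ
    have h2 := ae_restrict_Ioo_mono ht₀.1 le_rfl hH.tendsto
    rw [ae_restrict_iff' measurableSet_Ioo] at h1 h2 ⊢
    filter_upwards [h1, h2] with s h1 h2 hs
    choose σ hσ hσΔ hσf using fun n => hf' (φ n) s ⟨hs.1, hs.2.le⟩
    have hΔφ : Tendsto (fun n => Δ (φ n)) atTop (𝓝 0) := hΔlim.comp hφ.tendsto_atTop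
    rw [← h1 hs]
    simp_rw [fun n => hσf n ζ]
    refine h2 hs _ _ ζ _ _ (Cadlag.stopped hx.1 s) (fun n => Cadlag.stopped (hX _).1 _) ?_ ?_
    · refine squeeze_zero (fun _ => supDist_nonneg _ _)
        (fun n => supDist_stop_le hT hL ht₀ hx.1 (hX (φ n)) (hXR _) (hσ n).1 (hσ n).2)
        (g := fun n => supDist T d x (X (φ n)) + LH * (1 + R) * (s - σ n)) ?_
      have h3 : Tendsto (fun n => s - σ n) atTop (𝓝 0) :=
        squeeze_zero (fun n => sub_nonneg.2 (hσ n).2) hσΔ hΔφ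
      simpa using hxd.add (h3.const_mul (LH * (1 + R)))
    · have h3 : Tendsto (fun n => y (φ n) s - y (φ n) (σ n)) atTop (𝓝 0) := by
        refine squeeze_zero_norm (fun n => (hylip (φ n) (σ n) s (hσ n).1 (hσ n).2 hs.2.le).trans
          (mul_le_mul_of_nonneg_left (hσΔ n) hK)) ?_
        simpa using hΔφ.const_mul (LH * (1 + R) * ‖z‖ + B')
      simpa using (hyl' s ⟨hs.1.le, hs.2.le⟩).sub h3
  exact ⟨(x, y'), (mem_YSet_iff hH ht₀).2 ⟨hx, hsol z (by simp)⟩,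
    (mem_YSet_iff hH ht₀).2 ⟨hx, hsol z' (by simp)⟩⟩

theorem ncSuper_iff {h : Path d → ℝ} {L : ℝ} {u : ℝ → Path d → EReal} :
    NCSuper T d H h L u ↔ (∀ x ∈ Cadlag T d, u T x = ((h x : ℝ) : EReal)) ∧
      ∀ t₀ ∈ Ico (0 : ℝ) T, ∀ x₀ ∈ Cadlag T d, ∀ (z : E d) (y₀ : ℝ),
        u t₀ x₀ < ((y₀ : ℝ) : EReal) → ∀ T₀ ∈ Ioc t₀ T, ∀ ε > (0 : ℝ),
          ∃ p ∈ YSet T d H L t₀ x₀ y₀ z, u T₀ p.1 < ((p.2 T₀ + ε : ℝ) : EReal) := by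
  refine and_congr_right fun _ => ?_
  refine forall₄_congr fun t₀ _ x₀ _ => forall₅_congr fun z y₀ _ T₀ _ => ?_
  have key : ∀ (p : Path d × (ℝ → ℝ)) (ε : ℝ), u T₀ p.1 - ((p.2 T₀ : ℝ) : EReal) < (ε : EReal) ↔
      u T₀ p.1 < ((p.2 T₀ + ε : ℝ) : EReal) := by
    intro p ε
    rw [EReal.sub_lt_iff (Or.inl (EReal.coe_ne_bot _)) (Or.inl (EReal.coe_ne_top _)),
      EReal.coe_add, add_comm]
  constructor
  · intro h1 ε hε
    have h2 : (0 : EReal) < (ε : EReal) := EReal.coe_pos.2 hε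
    obtain ⟨_, ⟨p, hp, rfl⟩, h3⟩ := sInf_lt_iff.1 (h1.trans_lt h2)
    exact ⟨p, hp, (key p ε).1 h3⟩
  · intro h1
    refine EReal.le_of_forall_lt_iff_le.1 fun ε hε => ?_
    obtain ⟨p, hp, h2⟩ := h1 ε (EReal.coe_pos.1 hε)
    exact (sInf_le (mem_image_of_mem _ hp)).trans ((key p ε).2 h2).le

theorem Sol.neg {s₀ : ℝ} {x : Path d} {y₀ : ℝ} {z : E d} {y : ℝ → ℝ} (h : Sol T d H s₀ x y₀ z y) :
    Sol T d (negHam H) s₀ x (-y₀) (-z) (-y) := by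
  refine ⟨h.1.neg, fun t ht => ?_⟩
  simp only [Pi.neg_apply, h.2 t ht, negHam, neg_neg, inner_neg_right,
    intervalIntegral.integral_neg]
  ring

theorem YSet.neg (hH : Hyp T d H LH CH M) {s₀ : ℝ} (hs₀ : s₀ ∈ Icc 0 T) {x₀ : Path d}
    {y₀ : ℝ} {z : E d} {p : Path d × (ℝ → ℝ)} (hp : p ∈ YSet T d H LH s₀ x₀ y₀ z) :
    (p.1, -p.2) ∈ YSet T d (negHam H) LH s₀ x₀ (-y₀) (-z) := by
  rw [mem_YSet_iff hH hs₀] at hp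
  exact (mem_YSet_iff hH.neg hs₀).2 ⟨hp.1, hp.2.neg⟩

theorem YSet.of_neg (hH : Hyp T d H LH CH M) {s₀ : ℝ} (hs₀ : s₀ ∈ Icc 0 T) {x₀ : Path d}
    {y₀ : ℝ} {z : E d} {p : Path d × (ℝ → ℝ)}
    (hp : p ∈ YSet T d (negHam H) LH s₀ x₀ (-y₀) (-z)) :
    (p.1, -p.2) ∈ YSet T d H LH s₀ x₀ y₀ z := by
  have := YSet.neg hH.neg hs₀ hp
  rwa [negHam_negHam, neg_neg, neg_neg] at this

theorem XSet.exists_subseq {L : ℝ} (hL : 0 ≤ L) {t₀ : ℝ} (ht₀ : t₀ ∈ Icc 0 T) {x₀ : Path d}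
    (hx₀ : x₀ ∈ Cadlag T d) {X : ℕ → Path d} (hX : ∀ n, X n ∈ XSet T d L t₀ x₀) :
    ∃ φ : ℕ → ℕ, StrictMono φ ∧ ∃ x ∈ XSet T d L t₀ x₀,
      Tendsto (fun n => supDist T d x (X (φ n))) atTop (𝓝 0) := by
  obtain ⟨φ, hφ, x, hx, -, -, -, h, -⟩ := exists_subseq_paths
    (tn := fun _ => t₀) (xn := fun _ => x₀) (x₀ := x₀) (yn := fun _ => 0) (y₀ := 0)
    (Y := fun _ _ => 0) hL (le_refl (0 : ℝ)) (fun _ => ht₀) ht₀ tendsto_const_nhds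
    (fun _ => hx₀) hx₀
    (by
      rw [stopDist_eq_supDist, supDist_self _ (ht₀.1.trans ht₀.2)]
      exact tendsto_const_nhds) hX tendsto_const_nhds (fun _ => rfl) (by simp)
  exact ⟨φ, hφ, x, hx, h⟩

theorem TermCont.tendsto {h : Path d → ℝ} (hh : TermCont T d h) {x : Path d}
    (hx : x ∈ Cadlag T d) {X : ℕ → Path d} (hX : ∀ n, X n ∈ Cadlag T d)
    (hd : Tendsto (fun n => supDist T d x (X n)) atTop (𝓝 0)) :
    Tendsto (fun n => h (X n)) atTop (𝓝 (h x)) := by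
  refine Metric.tendsto_nhds.2 fun ε hε => ?_
  obtain ⟨δ, hδ, h1⟩ := hh x hx ε hε
  filter_upwards [hd.eventually (gt_mem_nhds hδ)] with n hn
  exact h1 _ (hX n) hn

theorem TermCont.exists_bound {h : Path d → ℝ} (hh : TermCont T d h) {L : ℝ} (hL : 0 ≤ L) {t₀ : ℝ}
    (ht₀ : t₀ ∈ Icc 0 T) {x₀ : Path d} (hx₀ : x₀ ∈ Cadlag T d) :
    ∃ B, 0 ≤ B ∧ ∀ x ∈ XSet T d L t₀ x₀, |h x| ≤ B := by
  by_contra! hcon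
  choose X hX hhX using fun n : ℕ => hcon n n.cast_nonneg
  obtain ⟨φ, hφ, x, hx, hd⟩ := XSet.exists_subseq hL ht₀ hx₀ hX
  have h1 := (hh.tendsto hx.1 (fun n => (hX (φ n)).1) hd).abs
  have h2 : Tendsto (fun n => |h (X (φ n))|) atTop atTop :=
    tendsto_atTop_mono (fun n => (hhX (φ n)).le)
      (tendsto_natCast_atTop_atTop.comp hφ.tendsto_atTop)
  exact not_tendsto_nhds_of_tendsto_atTop h2 _ h1

theorem TermCont.neg {h : Path d → ℝ} (hh : TermCont T d h) : TermCont T d (-h) := by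
  intro x hx ε hε
  obtain ⟨δ, hδ, h1⟩ := hh x hx ε hε
  refine ⟨δ, hδ, fun x' hx' hd => ?_⟩
  have := h1 x' hx' hd
  rwa [Pi.neg_apply, Pi.neg_apply, neg_sub_neg, abs_sub_comm]

/-- Supersolutions are bounded from below along Lipschitz paths. -/
theorem NCSuper.exists_lower_bound (hH : Hyp T d H LH CH M) {h : Path d → ℝ}
    (hh : TermCont T d h) {u : ℝ → Path d → EReal} (hu : NCSuper T d H h LH u) {t₀ : ℝ}
    (ht₀ : t₀ ∈ Icc 0 T) {x₀ : Path d} (hx₀ : x₀ ∈ Cadlag T d) :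
    ∃ Y : ℝ, ∀ t ∈ Icc t₀ T, ∀ x ∈ XSet T d LH t₀ x₀, ((-Y : ℝ) : EReal) ≤ u t x := by
  rw [ncSuper_iff] at hu
  have hL := hH.lipZ.1
  obtain ⟨B, hB0, hB⟩ := hh.exists_bound hL ht₀ hx₀
  set R := (1 + runSup d x₀ t₀) * Real.exp (2 * LH * T) with hR
  have hR0 : 0 ≤ R := by
    have := runSup_nonneg x₀ t₀
    positivity
  have hG := hH.growthConst_nonneg (CH := CH) hR0 le_rfl
  set Y := (B + 2) * Real.exp (2 * growthConst LH CH R 0 * T) with hY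
  have hexp : 1 ≤ Real.exp (2 * growthConst LH CH R 0 * T) :=
    Real.one_le_exp (mul_nonneg (by positivity) hH.pos.le)
  have hYB : B + 2 ≤ Y := le_mul_of_one_le_right (by positivity) hexp
  refine ⟨Y, fun t ht x hx => ?_⟩
  rcases ht.2.eq_or_lt with rfl | htT
  · rw [hu.1 x hx.1, EReal.coe_le_coe_iff]
    have := neg_le_of_abs_le (hB x hx)
    linarith
  by_contra! hlt
  have ht0 : t ∈ Icc 0 T := ⟨ht₀.1.trans ht.1, ht.2⟩
  obtain ⟨p, hp, hp'⟩ := hu.2 t ⟨ht0.1, htT⟩ x hx.1 0 (-Y) hlt T ⟨htT, le_rfl⟩ 1 one_pos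
  have hpX : p.1 ∈ XSet T d LH t₀ x₀ :=
    XSet.trans hL ht₀.1 ht.1 ht.2 hx ((mem_YSet_iff hH ht0).1 hp).1
  rw [hu.1 _ hp.1, EReal.coe_lt_coe_iff] at hp'
  have h1 := neg_le_of_abs_le (hB _ hpX)
  have hpt : p.2 t = -Y := ((mem_YSet_iff hH ht0).1 hp).2.init ht.2
  have hback : ∀ s ∈ Icc t T, |p.2 s| < B + 1 → False := by
    intro s hs hps
    have h2 := YSet.bound_backward hH ht0 hp (XSet.runSup_le hL ht₀ hpX) le_rfl hs.1 hs.2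
    rw [hpt, norm_zero, norm_neg, Real.norm_eq_abs, Real.norm_eq_abs, ← hR] at h2
    have h3 : Real.exp (2 * growthConst LH CH R 0 * (s - t)) ≤
        Real.exp (2 * growthConst LH CH R 0 * T) := by
      gcongr
      linarith [hs.2, ht0.1]
    have h4 : (1 + |p.2 s|) * Real.exp (2 * growthConst LH CH R 0 * (s - t)) ≤ Y :=
      mul_le_mul (by linarith) h3 (Real.exp_pos _).le (by linarith)
    linarith [le_abs_self Y]
  rcases lt_or_ge (p.2 T) (B + 1) with hT1 | hT1
  · exact hback T ⟨ht.2, le_rfl⟩ (abs_lt.2 ⟨by linarith, hT1⟩)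
  · obtain ⟨s, hs, hs0⟩ : (0 : ℝ) ∈ p.2 '' Icc t T :=
      intermediate_value_Icc ht.2 hp.2.2.1 ⟨by rw [hpt]; linarith, by linarith⟩
    exact hback s hs (by rw [hs0, abs_zero]; linarith)

/-- A penalty comparable to the square of a running maximum `r ≥ ‖ξ‖`. -/
def penalty {V : Type*} [NormedAddCommGroup V] (r : ℝ) (ξ : V) : ℝ := r ^ 2 + ‖ξ‖ ^ 4 / r ^ 2

theorem sq_le_penalty {V : Type*} [NormedAddCommGroup V] (r : ℝ) (ξ : V) :
    r ^ 2 ≤ penalty r ξ := by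
  unfold penalty
  have : 0 ≤ ‖ξ‖ ^ 4 / r ^ 2 := by positivity
  linarith

theorem penalty_max_le {V : Type*} [NormedAddCommGroup V] [InnerProductSpace ℝ V] {r : ℝ}
    (hr : 0 < r) {ξ δ : V} (hξ : ‖ξ‖ ≤ r) (hδ : ‖δ‖ ≤ r) :
    penalty (max r ‖ξ + δ‖) (ξ + δ) ≤
      penalty r ξ + ⟪δ, (4 * ‖ξ‖ ^ 2 / r ^ 2) • ξ⟫_ℝ + 11 * ‖δ‖ ^ 2 := by
  have hm := abs_le.1 (abs_real_inner_le_norm ξ δ)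
  have hsq : ‖ξ + δ‖ ^ 2 = ‖ξ‖ ^ 2 + 2 * ⟪ξ, δ⟫_ℝ + ‖δ‖ ^ 2 := norm_add_sq_real ξ δ
  rw [real_inner_smul_right, real_inner_comm]
  set m := ⟪ξ, δ⟫_ℝ
  set q := ‖ξ‖
  set e := ‖δ‖
  set ρ := ‖ξ + δ‖
  have hq0 : 0 ≤ q := norm_nonneg _
  have he0 : 0 ≤ e := norm_nonneg _
  have hρ0 : 0 ≤ ρ := norm_nonneg _
  have hρ4 : ρ ^ 4 = (q ^ 2 + 2 * m + e ^ 2) ^ 2 := by rw [← hsq]; ring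
  have hqe : q * e ≤ r * e := by gcongr
  have hr2 : 0 < r ^ 2 := by positivity
  unfold penalty
  rcases le_total ρ r with h | h
  · rw [max_eq_left h]
    have key : ρ ^ 4 ≤ q ^ 4 + 4 * q ^ 2 * m + 11 * e ^ 2 * r ^ 2 := by
      rw [hρ4]
      have h1 : m ^ 2 ≤ r ^ 2 * e ^ 2 := by nlinarith
      have h2 : m * e ^ 2 ≤ r * e * e ^ 2 := by
        have : m ≤ r * e := by linarith
        gcongr
      have h3 : r * e * e ^ 2 ≤ r * r * e ^ 2 := by gcongr
      have h4 : e ^ 2 * e ^ 2 ≤ r ^ 2 * e ^ 2 := by gcongr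
      have h5 : q ^ 2 * e ^ 2 ≤ r ^ 2 * e ^ 2 := by gcongr
      nlinarith
    have h6 : ρ ^ 4 / r ^ 2 ≤ (q ^ 4 + 4 * q ^ 2 * m + 11 * e ^ 2 * r ^ 2) / r ^ 2 := by gcongr
    have h7 : (q ^ 4 + 4 * q ^ 2 * m + 11 * e ^ 2 * r ^ 2) / r ^ 2 =
        q ^ 4 / r ^ 2 + 4 * q ^ 2 / r ^ 2 * m + 11 * e ^ 2 := by
      field_simp
    linarith
  · rw [max_eq_right h]
    have hρpos : 0 < ρ := hr.trans_le h
    have h1 : ρ ^ 4 / ρ ^ 2 = ρ ^ 2 := by field_simp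
    rw [h1, hsq]
    set s := (r ^ 2 - q ^ 2) / r with hs
    have hs0 : 0 ≤ s := div_nonneg (by nlinarith) hr.le
    have hsr : s * r = r ^ 2 - q ^ 2 := by rw [hs]; field_simp
    have h2 : q ^ 4 / r ^ 2 = (r - s) ^ 2 := by
      have : q ^ 2 = r * (r - s) := by linarith
      rw [show q ^ 4 = (q ^ 2) ^ 2 by ring, this]
      field_simp
    have h3 : 4 * q ^ 2 / r ^ 2 * m = 4 * m - 4 * s * (m / r) := by
      have : q ^ 2 = r * (r - s) := by linarith
      rw [this]
      field_simp
    rw [h2, h3]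
    have h4 : m / r ≤ e := (div_le_iff₀ hr).2 (by linarith)
    have h5 : s * (m / r) ≤ s * e := by gcongr
    nlinarith [sq_nonneg (s - 2 * e)]

theorem growthLip_mono (hH : Hyp T d H LH CH M) {R Z Z' Y : ℝ} (hR : 0 ≤ R) (hZ : 0 ≤ Z)
    (hZZ' : Z ≤ Z') (hY : 0 ≤ Y) : growthLip T LH CH R Z Y ≤ growthLip T LH CH R Z' Y := by
  have h1 := hH.growthConst_nonneg hR hZ
  have hL := hH.lipZ.1
  have hT := hH.pos
  have h2 : growthConst LH CH R Z ≤ growthConst LH CH R Z' := by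
    unfold growthConst
    gcongr
  have h3 := h1.trans h2
  unfold growthLip
  gcongr

/-- Data of a discrete characteristic approximation witnessing a violation of comparison at
time `s`. -/
structure Separated (T : ℝ) (d : ℕ) (LH : ℝ) (w v : ℝ → Path d → EReal) (t₀ : ℝ) (x₀ : Path d)
    (D Y s r : ℝ) (p q : Path d × ℝ) : Prop where
  cadlag_left : p.1 ∈ Cadlag T d
  cadlag_right : q.1 ∈ Cadlag T d
  left : XSet T d LH s p.1 ⊆ XSet T d LH t₀ x₀
  right : XSet T d LH s q.1 ⊆ XSet T d LH t₀ x₀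
  bound_left : -Y ≤ p.2
  bound_right : q.2 ≤ Y
  lt_left : w s p.1 < (p.2 : EReal)
  lt_right : v s q.1 < ((-q.2 : ℝ) : EReal)
  norm_le : ‖p.1 s - q.1 s‖ ≤ r
  le_radius : D ≤ r
  sup_le : ∀ τ ∈ Icc 0 s, ‖p.1 τ - q.1 τ‖ ≤ r + D

theorem Separated.step (hH : Hyp T d H LH CH M) {h : Path d → ℝ} {w v : ℝ → Path d → EReal}
    (hw : NCSuper T d H h LH w) (hv : NCSuper T d (negHam H) (-h) LH v) {t₀ : ℝ}
    (ht₀ : t₀ ∈ Icc 0 T) {x₀ : Path d} (hx₀ : x₀ ∈ Cadlag T d) {R Y : ℝ}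
    (hR : ∀ x ∈ XSet T d LH t₀ x₀, runSup d x T ≤ R) (hR0 : 0 ≤ R) (hY0 : 0 ≤ Y)
    (hYw : ∀ t ∈ Icc t₀ T, ∀ x ∈ XSet T d LH t₀ x₀, ((-Y : ℝ) : EReal) ≤ w t x)
    (hYv : ∀ t ∈ Icc t₀ T, ∀ x ∈ XSet T d LH t₀ x₀, ((-Y : ℝ) : EReal) ≤ v t x)
    {D s r Δ lam c ε Z : ℝ} {p q : Path d × ℝ} (hs : s ∈ Icc t₀ T) (hΔ : 0 < Δ) (hsΔ : s + Δ ≤ T)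
    (hS : Separated T d LH w v t₀ x₀ D Y s r p q) (hD0 : 0 < D)
    (hD : 2 * (LH * (1 + R)) * Δ ≤ D)
    (hlam : 0 ≤ lam) (hZ : 4 * lam * r ≤ Z) (hpq : p.2 - q.2 ≤ -c)
    (hΔc : 2 * (growthLip T LH CH R Z Y * Δ) ≤ c) (hΔ1 : growthLip T LH CH R Z Y * Δ ≤ 1)
    (hε : 0 < ε) :
    ∃ p' q', Separated T d LH w v t₀ x₀ D Y (s + Δ) (max r ‖p'.1 (s + Δ) - q'.1 (s + Δ)‖)
        p' q' ∧ p'.1 ∈ XSet T d LH t₀ x₀ ∧ q'.1 ∈ XSet T d LH t₀ x₀ ∧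
      p'.2 - q'.2 + lam * penalty (max r ‖p'.1 (s + Δ) - q'.1 (s + Δ)‖)
          (p'.1 (s + Δ) - q'.1 (s + Δ)) ≤
        p.2 - q.2 + lam * penalty r (p.1 s - q.1 s) + 11 * lam * D ^ 2 +
          Δ * (M LH * (2 + Y + 4 * lam * r) * (2 * r)) + 2 * ε := by
  obtain ⟨x₁, y₁⟩ := p
  obtain ⟨x₂, y₂⟩ := q
  obtain ⟨hc₁, hc₂, hx₁, hx₂, hby₁, hby₂, hl, hr', hξ, hDr, hsup⟩ := hS
  simp only at hc₁ hc₂ hx₁ hx₂ hby₁ hby₂ hl hr' hξ hsup hpq ⊢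
  have hL := hH.lipZ.1
  have hM := (hH.lipX LH hL).1
  have hr0 : 0 < r := hD0.trans_le hDr
  have hs0 : s ∈ Icc 0 T := ⟨ht₀.1.trans hs.1, hs.2⟩
  have hsT : s < T := by linarith
  set ξ := x₁ s - x₂ s with hξdef
  set g : E d := (4 * ‖ξ‖ ^ 2 / r ^ 2) • ξ with hg
  set z : E d := (-lam) • g with hz
  have hgn : ‖g‖ ≤ 4 * r := by
    have h1 : ‖ξ‖ ^ 2 / r ^ 2 ≤ 1 := by
      rw [div_le_one (by positivity)]
      gcongr
    have h0 : 0 ≤ ‖ξ‖ ^ 2 / r ^ 2 := by positivity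
    rw [hg, norm_smul, Real.norm_of_nonneg (by positivity), mul_div_assoc]
    nlinarith [norm_nonneg ξ]
  have hzn : ‖z‖ ≤ 4 * lam * r := by
    rw [hz, norm_smul, norm_neg, Real.norm_of_nonneg hlam]
    nlinarith
  have hZ0 : 0 ≤ Z := (by positivity : 0 ≤ 4 * lam * r).trans hZ
  obtain ⟨P, hP, hPw⟩ := (ncSuper_iff.1 hw).2 s ⟨hs0.1, hsT⟩ x₁ hc₁ z y₁ hl (s + Δ)
    ⟨by linarith, hsΔ⟩ ε hε
  obtain ⟨Q, hQ, hQv⟩ := (ncSuper_iff.1 hv).2 s ⟨hs0.1, hsT⟩ x₂ hc₂ (-z) (-y₂) hr' (s + Δ)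
    ⟨by linarith, hsΔ⟩ ε hε
  replace hQ := YSet.of_neg hH hs0 hQ
  obtain ⟨X₁, Y₁⟩ := P
  obtain ⟨X₂, Y₂'⟩ := Q
  obtain ⟨Y₂, rfl⟩ : ∃ Y₂ : ℝ → ℝ, Y₂' = -Y₂ := ⟨-Y₂', (neg_neg _).symm⟩
  rw [neg_neg] at hQ
  simp only [Pi.neg_apply] at hP hQ hPw hQv
  have hG0 := hH.growthLip_nonneg (CH := CH) hR0 hZ0 hY0
  obtain ⟨hX₁, hS₁⟩ := (mem_YSet_iff hH hs0).1 hP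
  obtain ⟨hX₂, hS₂⟩ := (mem_YSet_iff hH hs0).1 hQ
  simp only at hX₁ hS₁ hX₂ hS₂
  have hX₁' := hx₁ hX₁
  have hX₂' := hx₂ hX₂
  have hXl₁ := ((mem_XSet_iff hL hs0).1 hX₁)
  have hXl₂ := ((mem_XSet_iff hL hs0).1 hX₂)
  have e₁ : X₁ s = x₁ s := hX₁.2.1 s ⟨hs0.1, le_rfl⟩
  have e₂ : X₂ s = x₂ s := hX₂.2.1 s ⟨hs0.1, le_rfl⟩
  have hss : s ∈ Icc s T := ⟨le_rfl, hs.2⟩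
  have hy₁ : |y₁| ≤ Y ∧ |y₂| ≤ Y := by
    have h3 : 0 ≤ growthLip T LH CH R Z Y * Δ := by positivity
    exact ⟨abs_le.2 ⟨by linarith, by linarith⟩, abs_le.2 ⟨by linarith, by linarith⟩⟩
  have hlipx : ∀ {X : Path d}, X ∈ Cadlag T d → XLip T d LH s X → runSup d X T ≤ R →
      ∀ τ ∈ Icc s (s + Δ), ‖X τ - X s‖ ≤ LH * (1 + R) * Δ := by
    intro X hX hXl hXR τ hτ
    refine (XLip.lip hL hs0.1 hX hXl s τ le_rfl hτ.1 (hτ.2.trans hsΔ)).trans ?_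
    have : 0 ≤ τ - s := by linarith [hτ.1]
    gcongr
    linarith [hτ.2]
  have hdiff : ∀ τ ∈ Icc s (s + Δ), ‖(X₁ τ - X₂ τ) - ξ‖ ≤ D := by
    intro τ hτ
    have h1 := hlipx hXl₁.1 hXl₁.2.2 (hR _ hX₁') τ hτ
    have h2 := hlipx hXl₂.1 hXl₂.2.2 (hR _ hX₂') τ hτ
    rw [hξdef, ← e₁, ← e₂, show X₁ τ - X₂ τ - (X₁ s - X₂ s) = X₁ τ - X₁ s - (X₂ τ - X₂ s) by abel]
    refine (norm_sub_le _ _).trans ?_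
    linarith
  have hsup' : ∀ τ ∈ Icc 0 (s + Δ), ‖X₁ τ - X₂ τ‖ ≤ r + D := by
    intro τ hτ
    rcases le_total τ s with h1 | h1
    · rw [hX₁.2.1 τ ⟨hτ.1, h1⟩, hX₂.2.1 τ ⟨hτ.1, h1⟩]
      exact hsup τ ⟨hτ.1, h1⟩
    · have h2 := hdiff τ ⟨h1, hτ.2⟩
      have h3 := norm_sub_norm_le (X₁ τ - X₂ τ) ξ
      linarith
  have hylip : ∀ {x X : Path d} {y : ℝ} {f : ℝ → ℝ}, (X, f) ∈ YSet T d H LH s x y z →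
      Sol T d H s X y z f → runSup d X T ≤ R → |y| ≤ Y →
      ∀ τ ∈ Icc s (s + Δ), |f τ - y| ≤ growthLip T LH CH R Z Y * Δ := by
    intro x X y f hf hfs hXR hy τ hτ
    have h1 := YSet.lip hH hs0 hf hXR hy le_rfl hτ.1 (hτ.2.trans hsΔ)
    simp only [hfs.init hs.2, Real.norm_eq_abs] at h1
    refine h1.trans ?_
    have h2 := growthLip_mono (CH := CH) hH hR0 (norm_nonneg z) (hzn.trans hZ) hY0
    have h3 : 0 ≤ τ - s := by linarith [hτ.1]
    have h4 : τ - s ≤ Δ := by linarith [hτ.2]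
    exact mul_le_mul h2 h4 h3 hG0
  have hyl₁ := hylip hP hS₁ (hR _ hX₁') hy₁.1
  have hyl₂ := hylip hQ hS₂ (hR _ hX₂') hy₁.2
  have hsum : s + Δ ∈ Icc s T := ⟨by linarith, hsΔ⟩
  have hint : -(∫ τ in s..(s + Δ), H τ X₁ (Y₁ τ) z) + ∫ τ in s..(s + Δ), H τ X₂ (Y₂ τ) z ≤
      Δ * (M LH * (2 + Y + 4 * lam * r) * (2 * r)) := by
    have hi₁ := intervalIntegrable_of_integrableOn_Icc
      (hH.integrableOn hXl₁.1 hs0 hS₁.1 z) hss hsum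
    have hi₂ := intervalIntegrable_of_integrableOn_Icc
      (hH.integrableOn hXl₂.1 hs0 hS₂.1 z) hss hsum
    have hconst : Δ * (M LH * (2 + Y + 4 * lam * r) * (2 * r)) =
        ∫ _ in s..(s + Δ), M LH * (2 + Y + 4 * lam * r) * (2 * r) := by
      rw [intervalIntegral.integral_const, smul_eq_mul, add_sub_cancel_left]
    rw [neg_add_eq_sub, ← intervalIntegral.integral_sub hi₂ hi₁, hconst]
    refine intervalIntegral.integral_mono_ae_restrict hsum.1 (hi₂.sub hi₁)
      intervalIntegrable_const ?_
    rw [← restrict_Ioo_eq_restrict_Icc]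
    have hlip := ae_restrict_Ioo_mono hs.1 hsΔ (hH.lip_ae ht₀ hx₀ hX₁' hX₂' z)
    filter_upwards [hlip, ae_restrict_Ioo_mono hs0.1 hsΔ hH.mono,
      ae_restrict_mem measurableSet_Ioo] with τ h1 h2 hτ
    have hτ' : τ ∈ Icc s (s + Δ) := ⟨hτ.1.le, hτ.2.le⟩
    have a1 := abs_le.1 (hyl₁ τ hτ')
    have a2 := abs_le.1 (hyl₂ τ hτ')
    have h3 : H τ X₂ (Y₂ τ) z ≤ H τ X₂ (Y₁ τ) z := h2 X₂ hXl₂.1 z _ _ (by linarith)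
    have h4 := (abs_le.1 (h1 (Y₁ τ))).1
    have h5 : sSup ((fun s => ‖X₁ s - X₂ s‖) '' Icc 0 τ) ≤ 2 * r := by
      refine Real.sSup_le ?_ (by positivity)
      rintro _ ⟨t, ht, rfl⟩
      refine (hsup' t ⟨ht.1, ht.2.trans hτ'.2⟩).trans ?_
      linarith
    have h5' : 0 ≤ sSup ((fun s => ‖X₁ s - X₂ s‖) '' Icc 0 τ) := by
      refine Real.sSup_nonneg ?_
      rintro _ ⟨t, -, rfl⟩
      exact norm_nonneg _
    have h6 : |Y₁ τ| ≤ 1 + Y := by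
      have := abs_le.1 hy₁.1
      exact abs_le.2 ⟨by linarith, by linarith⟩
    have h7 : M LH * (1 + |Y₁ τ| + ‖z‖) * sSup ((fun s => ‖X₁ s - X₂ s‖) '' Icc 0 τ) ≤
        M LH * (2 + Y + 4 * lam * r) * (2 * r) := by
      have : 1 + |Y₁ τ| + ‖z‖ ≤ 2 + Y + 4 * lam * r := by linarith
      gcongr
    linarith
  have hδ := hdiff (s + Δ) ⟨by linarith, le_rfl⟩
  have hpen := penalty_max_le hr0 hξ (hδ.trans hDr)
  rw [add_sub_cancel, ← hg] at hpen
  have hpen' := mul_le_mul_of_nonneg_left hpen hlam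
  have hsum0 : s + Δ ∈ Icc t₀ T := ⟨hs.1.trans hsum.1, hsΔ⟩
  have hQv' : v (s + Δ) X₂ < ((-(Y₂ (s + Δ) - ε) : ℝ) : EReal) := by
    rwa [show -(Y₂ (s + Δ) - ε) = -Y₂ (s + Δ) + ε by ring]
  refine ⟨(X₁, Y₁ (s + Δ) + ε), (X₂, Y₂ (s + Δ) - ε), ⟨hX₁'.1, hX₂'.1,
    fun _ => XSet.trans hL ht₀.1 hsum0.1 hsΔ hX₁', fun _ => XSet.trans hL ht₀.1 hsum0.1 hsΔ hX₂',
    EReal.coe_le_coe_iff.1 ((hYw _ hsum0 X₁ hX₁').trans hPw.le),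
    neg_le_neg_iff.1 (EReal.coe_le_coe_iff.1 ((hYv _ hsum0 X₂ hX₂').trans hQv'.le)),
    hPw, hQv', le_max_right _ _,
    hDr.trans (le_max_left _ _), fun τ hτ => (hsup' τ hτ).trans (by gcongr; exact le_max_left _ _)⟩,
    hX₁', hX₂', ?_⟩
  · simp only
    have E₁ := hS₁.2 _ hsum
    have E₂ := hS₂.2 _ hsum
    have hinner : ⟪X₁ (s + Δ) - X₁ s, z⟫_ℝ - ⟪X₂ (s + Δ) - X₂ s, z⟫_ℝ =
        -(lam * ⟪X₁ (s + Δ) - X₂ (s + Δ) - ξ, g⟫_ℝ) := by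
      rw [← inner_sub_left, show X₁ (s + Δ) - X₁ s - (X₂ (s + Δ) - X₂ s) =
          X₁ (s + Δ) - X₂ (s + Δ) - ξ by rw [e₁, e₂, hξdef]; abel,
        hz, real_inner_smul_right, neg_mul]
    have hδ2 : lam * (11 * ‖X₁ (s + Δ) - X₂ (s + Δ) - ξ‖ ^ 2) ≤ 11 * lam * D ^ 2 := by
      rw [mul_left_comm, mul_assoc]
      gcongr
    linarith

theorem exists_small_mesh {τ : ℝ} {ι : Type*} (s : Finset ι) {f : ι → ℝ → ℝ}
    (hf : ∀ i ∈ s, Continuous (f i)) (hf0 : ∀ i ∈ s, f i 0 = 0) {c : ℝ} (hc : 0 < c) :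
    ∃ N : ℕ, 0 < N ∧ ∀ i ∈ s, f i (τ / N) ≤ c := by
  have h0 : Tendsto (fun n : ℕ => τ / n) atTop (𝓝 0) := tendsto_const_div_atTop_nhds_zero_nat τ
  have h1 : ∀ᶠ n : ℕ in atTop, ∀ i ∈ s, f i (τ / n) ≤ c := by
    refine (Finset.eventually_all s).2 fun i hi => ?_
    have := (((hf i hi).tendsto 0).comp h0)
    rw [hf0 i hi] at this
    exact (this.eventually_lt_const hc).mono fun n hn => hn.le
  obtain ⟨N, hN⟩ := (h1.and (eventually_gt_atTop 0)).exists
  exact ⟨N, hN.2, hN.1⟩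

set_option maxHeartbeats 800000 in
theorem exists_terminal_gap (hH : Hyp T d H LH CH M) {h : Path d → ℝ} {w v : ℝ → Path d → EReal}
    (hw : NCSuper T d H h LH w) (hv : NCSuper T d (negHam H) (-h) LH v) {t₀ : ℝ}
    (ht₀ : t₀ ∈ Ico 0 T) {x₀ : Path d} (hx₀ : x₀ ∈ Cadlag T d) {R Y : ℝ}
    (hR : ∀ x ∈ XSet T d LH t₀ x₀, runSup d x T ≤ R) (hR0 : 0 ≤ R) (hY0 : 0 ≤ Y)
    (hYw : ∀ t ∈ Icc t₀ T, ∀ x ∈ XSet T d LH t₀ x₀, ((-Y : ℝ) : EReal) ≤ w t x)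
    (hYv : ∀ t ∈ Icc t₀ T, ∀ x ∈ XSet T d LH t₀ x₀, ((-Y : ℝ) : EReal) ≤ v t x)
    {a b lam : ℝ} (hab : a < b) (hwa : w t₀ x₀ < (a : EReal)) (hvb : v t₀ x₀ < ((-b : ℝ) : EReal))
    (haY : -Y ≤ a) (hbY : b ≤ Y) (hlam : 0 < lam)
    (hbig : (T - t₀) * (M LH * (2 + Y)) ^ 2 * Real.exp ((8 * M LH + 1) * (T - t₀)) ≤
      lam * ((b - a) / 4)) :
    ∃ x₁ ∈ XSet T d LH t₀ x₀, ∃ x₂ ∈ XSet T d LH t₀ x₀, h x₁ - h x₂ ≤ -((b - a) / 2) ∧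
      lam * supDist T d x₁ x₂ ^ 2 ≤ 8 * Y * Real.exp ((8 * M LH + 1) * (T - t₀)) := by
  have hL := hH.lipZ.1
  have hM := (hH.lipX LH hL).1
  have ht₀' : t₀ ∈ Icc 0 T := ⟨ht₀.1, ht₀.2.le⟩
  set c := b - a with hc
  have hc0 : 0 < c := sub_pos.2 hab
  set τ := T - t₀ with hτ
  have hτ0 : 0 < τ := sub_pos.2 ht₀.2
  set κ := 8 * M LH + 1 with hκ
  have hκ0 : 0 < κ := by positivity
  set A := M LH * (2 + Y) with hA
  set Z := 4 * lam * (1 + 2 * R) with hZ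
  have hZ0 : 0 ≤ Z := by positivity
  set G := growthLip T LH CH R Z Y with hG
  have hG0 : 0 ≤ G := hH.growthLip_nonneg hR0 hZ0 hY0
  set K := LH * (1 + R) + 1 with hK
  have hK0 : 0 < K := by positivity
  obtain ⟨N, hN0, hN⟩ := exists_small_mesh (τ := τ) (Finset.univ : Finset (Fin 3))
    (f := ![fun Δ => 2 * K * Δ, fun Δ => 2 * (G * Δ),
      fun Δ => lam * (2 * K * Δ) ^ 2 + τ * (11 * lam * (4 * K ^ 2 * Δ) + 2 * Δ)])
    (by
      intro i _
      fin_cases i <;> (simp only [Fin.zero_eta, Fin.mk_one, Fin.reduceFinMk, Matrix.cons_val]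
                       fun_prop))
    (by intro i _; fin_cases i <;> simp) (c := min 1 (c / 4)) (by positivity)
  set Δ := τ / N with hΔ
  have hN0' : (0 : ℝ) < N := Nat.cast_pos.2 hN0
  have hΔ0 : 0 < Δ := div_pos hτ0 hN0'
  have hNΔ : N * Δ = τ := by rw [hΔ]; field_simp
  clear_value Z G K Δ τ κ c A
  have b1 : 2 * K * Δ ≤ 1 := (hN 0 (Finset.mem_univ _)).trans (min_le_left _ _)
  have b2 : 2 * (G * Δ) ≤ 1 := (hN 1 (Finset.mem_univ _)).trans (min_le_left _ _)
  have b3 : 2 * (G * Δ) ≤ c / 4 := (hN 1 (Finset.mem_univ _)).trans (min_le_right _ _)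
  have b4 : lam * (2 * K * Δ) ^ 2 + τ * (11 * lam * (4 * K ^ 2 * Δ) + 2 * Δ) ≤ c / 4 :=
    (hN 2 (Finset.mem_univ _)).trans (min_le_right _ _)
  clear hN
  set D := 2 * K * Δ with hD
  have hD0 : 0 < D := by positivity
  have hGΔ : 0 ≤ G * Δ := by positivity
  set ell : ℕ → ℝ := fun i => lam * Real.exp (-(κ * (i * Δ))) with hell
  set μ := lam * Real.exp (-(κ * τ)) with hμ
  have hμ0 : 0 < μ := by positivity
  have hμlam : μ * Real.exp (κ * τ) = lam := by
    rw [hμ, mul_assoc, ← Real.exp_add, neg_add_cancel, Real.exp_zero, mul_one]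
  have hAμ : τ * (A ^ 2 / μ) ≤ c / 4 := by
    rw [← mul_div_assoc, div_le_iff₀ hμ0]
    have hE := Real.exp_pos (κ * τ)
    rw [← hμlam] at hbig
    refine le_of_mul_le_mul_right ?_ hE
    linarith
  have hell0 : ∀ i, 0 < ell i := fun i => by positivity
  have hell_le : ∀ i, ell i ≤ lam := by
    intro i
    refine mul_le_of_le_one_right hlam.le (Real.exp_le_one_iff.2 ?_)
    have : 0 ≤ κ * (i * Δ) := by positivity
    linarith
  have hell_ge : ∀ i : ℕ, i ≤ N → μ ≤ ell i := by
    intro i hi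
    have : (i : ℝ) ≤ N := Nat.cast_le.2 hi
    have : i * Δ ≤ τ := by rw [← hNΔ]; gcongr
    simp only [hμ, hell]
    gcongr
  have hell_succ : ∀ i, ell (i + 1) * (1 + κ * Δ) ≤ ell i := by
    intro i
    have h1 : ell i = ell (i + 1) * Real.exp (κ * Δ) := by
      simp only [hell]
      rw [mul_assoc, ← Real.exp_add]
      congr 2
      push_cast
      ring
    rw [h1]
    have := Real.add_one_le_exp (κ * Δ)
    have := (hell0 (i + 1)).le
    gcongr
    linarith
  set η := Δ * (A ^ 2 / μ) + 11 * lam * D ^ 2 + 2 * Δ ^ 2 with hη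
  clear_value D ell μ η
  have hη0 : 0 ≤ η := by rw [hη]; positivity
  have hNη : lam * D ^ 2 + N * η ≤ c / 2 := by
    have : N * η = τ * (A ^ 2 / μ) + τ * (11 * lam * (4 * K ^ 2 * Δ) + 2 * Δ) := by
      rw [← hNΔ, hη, hD]
      ring
    linarith
  have hbudget : ∀ i : ℕ, i ≤ N → -c + lam * D ^ 2 + i * η ≤ -(c / 2) := by
    intro i hi
    have : (i : ℝ) ≤ N := Nat.cast_le.2 hi
    have : i * η ≤ N * η := by gcongr
    linarith
  have main : ∀ i : ℕ, i ≤ N → ∃ r p q, Separated T d LH w v t₀ x₀ D Y (t₀ + i * Δ) r p q ∧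
      r ≤ 1 + 2 * R ∧ (0 < i → p.1 ∈ XSet T d LH t₀ x₀ ∧ q.1 ∈ XSet T d LH t₀ x₀) ∧
      p.2 - q.2 + ell i * penalty r (p.1 (t₀ + i * Δ) - q.1 (t₀ + i * Δ)) ≤
        -c + lam * D ^ 2 + i * η := by
    intro i
    induction i with
    | zero =>
      intro _
      refine ⟨D, (x₀, a), (x₀, b), ⟨hx₀, hx₀, ?_, ?_, haY, hbY, ?_, ?_, ?_, le_rfl, ?_⟩, ?_, ?_, ?_⟩
      · simp
      · simp
      · simpa using hwa
      · simpa using hvb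
      · simpa using hD0.le
      · intro τ _
        simpa using hD0.le
      · linarith
      · simp
      · simp [penalty, hell, hc]
    | succ i ih =>
      intro hi
      obtain ⟨r, p, q, hS, hr, -, hW⟩ := ih (by omega)
      have hle : t₀ + (i + 1) * Δ ≤ T := by
        have : ((i + 1 : ℕ) : ℝ) ≤ N := Nat.cast_le.2 hi
        push_cast at this
        have : (i + 1) * Δ ≤ τ := by rw [← hNΔ]; gcongr
        linarith
      have hiΔ : 0 ≤ i * Δ := by positivity
      have hsucc : t₀ + ((i + 1 : ℕ) : ℝ) * Δ = t₀ + i * Δ + Δ := by push_cast; ring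
      have hr0 : 0 < r := hD0.trans_le hS.le_radius
      have hpen := sq_le_penalty r (p.1 (t₀ + i * Δ) - q.1 (t₀ + i * Δ))
      have hpen0 : 0 ≤ penalty r (p.1 (t₀ + i * Δ) - q.1 (t₀ + i * Δ)) := (sq_nonneg r).trans hpen
      have hpq : p.2 - q.2 ≤ -(c / 2) := by
        have := hbudget i (by omega)
        have := mul_nonneg (hell0 i).le hpen0
        linarith
      obtain ⟨p', q', hS', hp', hq', hW'⟩ := hS.step hH hw hv ht₀' hx₀ hR hR0 hY0 hYw hYv
        (Δ := Δ) (lam := ell (i + 1)) (Z := Z) (c := c / 2) (ε := Δ ^ 2) ⟨by linarith, by linarith⟩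
        hΔ0 (by linarith) hD0 (by rw [hD, hK]; linarith) (hell0 _).le
        (by
          have := hell_le (i + 1)
          rw [hZ]
          gcongr)
        hpq (by rw [← hG]; linarith) (by rw [← hG]; linarith) (by positivity)
      refine ⟨_, p', q', by rw [hsucc]; exact hS', ?_, fun _ => ⟨hp', hq'⟩, ?_⟩
      · have hmem : t₀ + i * Δ + Δ ∈ Icc 0 T := ⟨by linarith [ht₀.1], by linarith⟩
        have h1 := norm_le_runSup hp'.1 hmem.1 hmem.2 le_rfl
        have h2 := norm_le_runSup hq'.1 hmem.1 hmem.2 le_rfl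
        have h3 := norm_sub_le (p'.1 (t₀ + i * Δ + Δ)) (q'.1 (t₀ + i * Δ + Δ))
        have h4 := hR _ hp'
        have h5 := hR _ hq'
        exact max_le hr (by linarith)
      · rw [hsucc]
        refine hW'.trans ?_
        set P := penalty r (p.1 (t₀ + i * Δ) - q.1 (t₀ + i * Δ))
        set l := ell (i + 1) with hl
        have hl0 : 0 < l := hell0 _
        have h1 : l * P + l * κ * Δ * r ^ 2 ≤ ell i * P := by
          have h2 := mul_le_mul_of_nonneg_right (hell_succ i) hpen0
          have h3 : l * κ * Δ * r ^ 2 ≤ l * κ * Δ * P := by gcongr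
          linarith
        have h4 : 2 * A * r - l * r ^ 2 ≤ A ^ 2 / μ := by
          have h5 : A ^ 2 / l ≤ A ^ 2 / μ := by
            have := hell_ge _ hi
            gcongr
          have h6 : 2 * A * r - l * r ^ 2 ≤ A ^ 2 / l := by
            rw [le_div_iff₀ hl0]
            linarith [sq_nonneg (A - l * r)]
          linarith
        have h7 := mul_le_mul_of_nonneg_left h4 hΔ0.le
        have h8 : 11 * l * D ^ 2 ≤ 11 * lam * D ^ 2 := by
          have := hell_le (i + 1)
          gcongr
        have h9 : Δ * (M LH * (2 + Y + 4 * l * r) * (2 * r)) - l * κ * Δ * r ^ 2 =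
            Δ * (2 * A * r - l * r ^ 2) := by
          rw [hA, hκ]
          ring
        push_cast
        linarith
  obtain ⟨r, p, q, hS, -, hX, hW⟩ := main N le_rfl
  obtain ⟨hp, hq⟩ := hX hN0
  have htN : t₀ + N * Δ = T := by rw [hNΔ, hτ]; ring
  rw [htN] at hS hW
  have hellN : ell N = μ := by simp only [hell, hμ, hNΔ]
  rw [hellN] at hW
  have h1 := hbudget N le_rfl
  have hpen := mul_le_mul_of_nonneg_left (sq_le_penalty r (p.1 T - q.1 T)) hμ0.le
  have h2 := hS.lt_left
  have h3 := hS.lt_right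
  rw [hw.1 _ hp.1, EReal.coe_lt_coe_iff] at h2
  rw [hv.1 _ hq.1, EReal.coe_lt_coe_iff, Pi.neg_apply] at h3
  have h4 : 0 ≤ μ * r ^ 2 := by positivity
  refine ⟨p.1, hp, q.1, hq, by linarith, ?_⟩
  have h5 : supDist T d p.1 q.1 ≤ 2 * r :=
    supDist_le hH.pos.le fun s hs => (hS.sup_le s hs).trans (by linarith [hS.le_radius])
  have h6 : μ * r ^ 2 ≤ 2 * Y := by linarith [hS.bound_left, hS.bound_right]
  have h7 := supDist_nonneg (T := T) p.1 q.1
  rw [← hμlam]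
  calc μ * Real.exp (κ * τ) * supDist T d p.1 q.1 ^ 2
      ≤ μ * Real.exp (κ * τ) * (2 * r) ^ 2 := by gcongr
    _ = 4 * (μ * r ^ 2) * Real.exp (κ * τ) := by ring
    _ ≤ 4 * (2 * Y) * Real.exp (κ * τ) := by gcongr
    _ = 8 * Y * Real.exp (κ * τ) := by ring

/-- Comparison principle; subsolutions `-v` are encoded as supersolutions of the reflected
problem. -/
theorem NCSuper.comparison (hH : Hyp T d H LH CH M) {h : Path d → ℝ} (hh : TermCont T d h)
    {w v : ℝ → Path d → EReal} (hw : NCSuper T d H h LH w)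
    (hv : NCSuper T d (negHam H) (-h) LH v) {t₀ : ℝ} (ht₀ : t₀ ∈ Icc 0 T) {x₀ : Path d}
    (hx₀ : x₀ ∈ Cadlag T d) : -v t₀ x₀ ≤ w t₀ x₀ := by
  rcases ht₀.2.eq_or_lt with rfl | htT
  · rw [hw.1 _ hx₀, hv.1 _ hx₀, Pi.neg_apply, EReal.coe_neg, neg_neg]
  by_contra! hlt
  obtain ⟨a, hwa, ha⟩ := EReal.exists_between_coe_real hlt
  obtain ⟨b, hab, hb⟩ := EReal.exists_between_coe_real ha
  rw [EReal.coe_lt_coe_iff] at hab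
  have hvb : v t₀ x₀ < ((-b : ℝ) : EReal) := by
    rw [EReal.coe_neg]
    exact EReal.lt_neg_comm.1 hb
  have hL := hH.lipZ.1
  obtain ⟨Y₁, hY₁⟩ := hw.exists_lower_bound hH hh ht₀ hx₀
  obtain ⟨Y₂, hY₂⟩ := hv.exists_lower_bound hH.neg hh.neg ht₀ hx₀
  set Y := max (max Y₁ Y₂) (max |a| |b|) with hY
  have hY0 : 0 ≤ Y := (abs_nonneg a).trans ((le_max_left _ _).trans (le_max_right _ _))
  have haY : |a| ≤ Y := (le_max_left _ _).trans (le_max_right _ _)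
  have hbY : |b| ≤ Y := (le_max_right _ _).trans (le_max_right _ _)
  have hYY₁ : Y₁ ≤ Y := (le_max_left _ _).trans (le_max_left _ _)
  have hYY₂ : Y₂ ≤ Y := (le_max_right _ _).trans (le_max_left _ _)
  have key : ∀ n : ℕ, ∃ x₁ ∈ XSet T d LH t₀ x₀, ∃ x₂ ∈ XSet T d LH t₀ x₀,
      h x₁ - h x₂ ≤ -((b - a) / 2) ∧ ((n : ℝ) + 1) * supDist T d x₁ x₂ ^ 2 ≤
        8 * Y * Real.exp ((8 * M LH + 1) * (T - t₀)) := by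
    intro n
    set B := (T - t₀) * (M LH * (2 + Y)) ^ 2 * Real.exp ((8 * M LH + 1) * (T - t₀)) with hB
    have hB0 : 0 ≤ B := by
      have := sub_pos.2 htT
      positivity
    have hc : 0 < (b - a) / 4 := by linarith
    have hdiv : 0 ≤ B / ((b - a) / 4) := by positivity
    obtain ⟨x₁, h₁, x₂, h₂, h₃, h₄⟩ := exists_terminal_gap hH hw hv ⟨ht₀.1, htT⟩ hx₀
      (R := (1 + runSup d x₀ t₀) * Real.exp (2 * LH * T)) (Y := Y)
      (lam := (n + 1) + B / ((b - a) / 4))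
      (fun x hx => XSet.runSup_le hL ht₀ hx) (by have := runSup_nonneg x₀ t₀; positivity) hY0
      (fun t ht x hx => le_trans (EReal.coe_le_coe_iff.2 (by linarith)) (hY₁ t ht x hx))
      (fun t ht x hx => le_trans (EReal.coe_le_coe_iff.2 (by linarith)) (hY₂ t ht x hx))
      hab hwa hvb (by linarith [neg_abs_le a]) (by linarith [le_abs_self b]) (by positivity)
      (by
        rw [← hB, add_mul, div_mul_cancel₀ _ hc.ne']
        have : 0 ≤ ((n : ℝ) + 1) * ((b - a) / 4) := by positivity
        linarith)
    exact ⟨x₁, h₁, x₂, h₂, h₃,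
      (mul_le_mul_of_nonneg_right (le_add_of_nonneg_right hdiv) (sq_nonneg _)).trans h₄⟩
  choose X₁ hX₁ X₂ hX₂ hgap hdist using key
  set C := 8 * Y * Real.exp ((8 * M LH + 1) * (T - t₀)) with hC
  have hd0 : Tendsto (fun n => supDist T d (X₁ n) (X₂ n)) atTop (𝓝 0) := by
    have h1 : Tendsto (fun n : ℕ => √(C * (1 / ((n : ℝ) + 1)))) atTop (𝓝 0) := by
      have := (tendsto_one_div_add_atTop_nhds_zero_nat (𝕜 := ℝ)).const_mul C
      rw [mul_zero] at this
      simpa using this.sqrt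
    refine squeeze_zero (fun n => supDist_nonneg _ _) (fun n => Real.le_sqrt_of_sq_le ?_) h1
    rw [mul_one_div, le_div_iff₀ (by positivity), mul_comm]
    exact hdist n
  obtain ⟨φ, hφ, x, hx, hlim₁⟩ := XSet.exists_subseq hL ht₀ hx₀ hX₁
  have hlim₂ : Tendsto (fun n => supDist T d x (X₂ (φ n))) atTop (𝓝 0) := by
    have h1 := hlim₁.add (hd0.comp hφ.tendsto_atTop)
    rw [add_zero] at h1
    refine squeeze_zero (fun n => supDist_nonneg _ _) (fun n => ?_) h1
    refine supDist_le hH.pos.le fun s hs => (norm_sub_le_norm_sub_add_norm_sub _ (X₁ (φ n) s) _).trans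
      (add_le_add (norm_sub_le_supDist hx.1 (hX₁ _).1 hs) ?_)
    exact norm_sub_le_supDist (hX₁ _).1 (hX₂ _).1 hs
  have h1 := (hh.tendsto hx.1 (fun n => (hX₁ (φ n)).1) hlim₁).sub
    (hh.tendsto hx.1 (fun n => (hX₂ (φ n)).1) hlim₂)
  have h2 := le_of_tendsto' h1 fun n => hgap (φ n)
  linarith

theorem uZero_le {h : Path d → ℝ} {L : ℝ} {u : ℝ → Path d → EReal} (hu : NCSuper T d H h L u)
    (t : ℝ) (x : Path d) : uZero T d H h L t x ≤ u t x :=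
  sInf_le ⟨u, hu, rfl⟩

open Classical in
theorem exists_ncSuper (T : ℝ) (H : Ham d) (h : Path d → ℝ) (L : ℝ) :
    ∃ u, NCSuper T d H h L u := by
  refine ⟨fun t x => if t = T then ((h x : ℝ) : EReal) else ⊤, fun x _ => if_pos rfl, ?_⟩
  intro t₀ ht₀ x₀ _ z y₀ hlt
  simp only [if_neg ht₀.2.ne] at hlt
  exact absurd hlt not_top_lt

theorem uZero_ncSuper (T : ℝ) (H : Ham d) (h : Path d → ℝ) (L : ℝ) :
    NCSuper T d H h L (uZero T d H h L) := by
  refine ncSuper_iff.2 ⟨fun x hx => le_antisymm ?_ ?_, ?_⟩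
  · obtain ⟨u, hu⟩ := exists_ncSuper T H h L
    exact (uZero_le hu T x).trans (hu.1 x hx).le
  · refine le_sInf ?_
    rintro _ ⟨u, hu, rfl⟩
    exact (hu.1 x hx).ge
  · intro t₀ ht₀ x₀ hx₀ z y₀ hlt T₀ hT₀ ε hε
    obtain ⟨_, ⟨u, hu, rfl⟩, hlt'⟩ := sInf_lt_iff.1 hlt
    obtain ⟨p, hp, hp'⟩ := (ncSuper_iff.1 hu).2 t₀ ht₀ x₀ hx₀ z y₀ hlt' T₀ hT₀ ε hε
    exact ⟨p, hp, (uZero_le hu _ _).trans_lt hp'⟩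

open Classical in
/-- Perron's method: the least supersolution is also a subsolution. -/
theorem uZero_neg_ncSuper (hH : Hyp T d H LH CH M) (h : Path d → ℝ) :
    NCSuper T d (negHam H) (-h) LH fun t x => -uZero T d H h LH t x := by
  have hu := ncSuper_iff.1 (uZero_ncSuper T H h LH)
  set u := uZero T d H h LH with hu_def
  refine ncSuper_iff.2 ⟨fun x hx => by rw [hu.1 x hx, Pi.neg_apply, EReal.coe_neg], ?_⟩
  intro t₀ ht₀ x₀ hx₀ z' y₀' hlt T₀ hT₀ ε hε
  by_contra! hcon
  obtain ⟨y₀, rfl⟩ : ∃ y₀ : ℝ, y₀' = -y₀ := ⟨-y₀', (neg_neg _).symm⟩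
  obtain ⟨z, rfl⟩ : ∃ z, z' = -z := ⟨-z', (neg_neg _).symm⟩
  have ht₀' : t₀ ∈ Icc 0 T := ⟨ht₀.1, ht₀.2.le⟩
  have hy₀ : (y₀ : EReal) < u t₀ x₀ := by
    rw [EReal.coe_neg] at hlt
    exact EReal.neg_lt_neg_iff.1 hlt
  have hbelow : ∀ p ∈ YSet T d H LH t₀ x₀ y₀ z, u T₀ p.1 < (p.2 T₀ : EReal) := by
    intro p hp
    have h1 := hcon _ (YSet.neg hH ht₀' hp)
    rw [EReal.le_neg, ← EReal.coe_neg] at h1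
    simp only [Pi.neg_apply] at h1
    refine h1.trans_lt (EReal.coe_lt_coe_iff.2 ?_)
    linarith
  set U : ℝ → Path d → EReal := fun t x =>
    if t ∈ Ico t₀ T₀ then min (u t x) (sInf {v : EReal | ∃ p ∈ YSet T d H LH t₀ x₀ y₀ z,
      (∀ s ∈ Icc 0 t, x s = p.1 s) ∧ v = (p.2 t : EReal)}) else u t x with hU
  have hUu : ∀ t x, U t x ≤ u t x := by
    intro t x
    simp only [hU]
    split_ifs
    · exact min_le_left _ _
    · exact le_rfl
  have hUp : ∀ t ∈ Ico t₀ T₀, ∀ p ∈ YSet T d H LH t₀ x₀ y₀ z, ∀ x : Path d,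
      (∀ s ∈ Icc 0 t, x s = p.1 s) → U t x ≤ (p.2 t : EReal) := by
    intro t ht p hp x hx
    simp only [hU, if_pos ht]
    exact (min_le_right _ _).trans (sInf_le ⟨p, hp, hx, rfl⟩)
  have hUsuper : NCSuper T d H h LH U := by
    refine ncSuper_iff.2 ⟨fun x hx => ?_, ?_⟩
    · simp only [hU]
      rw [if_neg fun h' => (h'.2.trans_le hT₀.2).false, hu.1 x hx]
    intro t ht x hx z' y hUy T₁ hT₁ ε' hε'
    have ht' : t ∈ Icc 0 T := ⟨ht.1, ht.2.le⟩
    rcases lt_or_ge (u t x) y with huy | huy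
    · obtain ⟨p, hp, hp'⟩ := hu.2 t ht x hx z' y huy T₁ hT₁ ε' hε'
      exact ⟨p, hp, (hUu _ _).trans_lt hp'⟩
    by_cases htI : t ∈ Ico t₀ T₀
    swap
    · simp only [hU, if_neg htI] at hUy
      exact absurd hUy huy.not_gt
    simp only [hU, if_pos htI] at hUy
    rcases min_lt_iff.1 hUy with h1 | h1
    · exact absurd h1 huy.not_gt
    obtain ⟨_, ⟨p', hp', hxp', rfl⟩, hlt'⟩ := sInf_lt_iff.1 h1
    rw [EReal.coe_lt_coe_iff] at hlt'
    have htt₀ : t ∈ Icc t₀ T := ⟨htI.1, ht.2.le⟩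
    obtain ⟨p'', hpz, hpz'⟩ := hH.exists_common_pair ht' hp'.1 (p'.2 t) z z'
    have hpz'' := (mem_YSet_iff hH ht').1 hpz'
    obtain ⟨Y, hY, hYge⟩ := Sol.exists_ge hH ht' hpz''.1 hlt'.le hpz''.2
    have hq := YSet.trans hH ht₀' htt₀ hx₀ hp' hpz
    set q : Path d × (ℝ → ℝ) := (p''.1, fun s => if s ≤ t then p'.2 s else p''.2 s) with hq_def
    have hq2 : ∀ s, t < s → q.2 s = p''.2 s := fun s hs => if_neg hs.not_ge
    have hpY : (p''.1, Y) ∈ YSet T d H LH t x y z' :=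
      YSet.congr (fun s hs => (hxp' s hs).symm) ((mem_YSet_iff hH ht').2 ⟨hpz''.1, hY⟩)
    rcases lt_or_ge T₁ T₀ with h2 | h2
    · refine ⟨_, hpY, ?_⟩
      have h3 := hUp T₁ ⟨htI.1.trans hT₁.1.le, h2⟩ q hq p''.1 fun s _ => rfl
      refine h3.trans_lt (EReal.coe_lt_coe_iff.2 ?_)
      rw [hq2 _ hT₁.1]
      have := hYge T₁ ⟨hT₁.1.le, hT₁.2⟩
      simp only
      linarith
    · have h3 := hbelow q hq
      rw [hq2 _ htI.2] at h3
      have h4 := hYge T₀ ⟨htI.2.le, hT₀.2⟩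
      have h5 : u T₀ p''.1 < (Y T₀ : EReal) := h3.trans_le (EReal.coe_le_coe_iff.2 h4)
      rcases h2.eq_or_lt with rfl | h2
      · refine ⟨_, hpY, (hUu _ _).trans_lt (h5.trans (EReal.coe_lt_coe_iff.2 ?_))⟩
        simp only
        linarith
      · have hT₀T : T₀ ∈ Ico 0 T := ⟨ht.1.trans htI.2.le, h2.trans_le hT₁.2⟩
        obtain ⟨p₃, hp₃, hlt₃⟩ := hu.2 T₀ hT₀T p''.1 hpY.1 z' (Y T₀) h5 T₁ ⟨h2, hT₁.2⟩ ε' hε'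
        refine ⟨_, YSet.trans hH ht' ⟨htI.2.le, hT₀.2⟩ hx hpY hp₃, (hUu _ _).trans_lt ?_⟩
        simp only
        rwa [if_neg h2.not_ge]
  obtain ⟨p, hp, -⟩ := hH.exists_common_pair ht₀' hx₀ y₀ z z
  have h1 := hUp t₀ ⟨le_rfl, hT₀.1⟩ p hp x₀ fun s hs => (hp.2.1 s hs).symm
  rw [((mem_YSet_iff hH ht₀').1 hp).2.init ht₀.2.le] at h1
  exact absurd (hy₀.trans_le ((uZero_le hUsuper t₀ x₀).trans h1)) (lt_irrefl _)

theorem TermCont.congr {h : Path d → ℝ} (hh : TermCont T d h) (hT : 0 ≤ T) {x x' : Path d}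
    (hx : x ∈ Cadlag T d) (hx' : x' ∈ Cadlag T d) (heq : ∀ t ∈ Icc 0 T, x t = x' t) :
    h x = h x' := by
  have h0 : supDist T d x x' ≤ 0 := supDist_le hT fun s hs => by simp [heq s hs]
  refine (eq_of_abs_sub_nonpos (le_of_forall_pos_lt_add fun ε hε => ?_)).symm
  obtain ⟨δ, hδ, h1⟩ := hh x hx ε hε
  simpa using h1 x' hx' (h0.trans_lt hδ)

theorem stopDist_le {t s : ℝ} {x y : Path d} (hT : 0 ≤ T) {B : ℝ}
    (h : ∀ r ∈ Icc 0 T, ‖x (min r t) - y (min r s)‖ ≤ B) : stopDist T d t x s y ≤ B := by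
  refine csSup_le ((nonempty_Icc.2 hT).image _) ?_
  rintro _ ⟨r, hr, rfl⟩
  exact h r hr

theorem dInf_congr {t₀ : ℝ} (ht₀ : 0 ≤ t₀) {x₀ x₀' : Path d} (h : ∀ s ∈ Icc 0 t₀, x₀ s = x₀' s)
    (q : ℝ × Path d) : dInf T d (t₀, x₀) q = dInf T d (t₀, x₀') q := by
  unfold dInf stopDist
  congr 2
  refine image_congr fun r hr => ?_
  simp only
  rw [h _ ⟨le_min hr.1 ht₀, min_le_right _ _⟩]

theorem dInf_self (hT : 0 ≤ T) (p : ℝ × Path d) : dInf T d p p = 0 := by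
  have h1 : stopDist T d p.1 p.2 p.1 p.2 ≤ 0 := stopDist_le hT fun r _ => by simp
  have h2 := stopDist_nonneg (T := T) p.1 p.1 p.2 p.2
  simp only [dInf, sub_self, abs_zero, zero_add]
  exact le_antisymm h1 h2

theorem dInf_le_supDist {t : ℝ} (ht : t ∈ Icc 0 T) {x y : Path d} (hx : x ∈ Cadlag T d)
    (hy : y ∈ Cadlag T d) : dInf T d (t, x) (t, y) ≤ supDist T d x y := by
  simp only [dInf, sub_self, abs_zero, zero_add]
  exact stopDist_le (ht.1.trans ht.2) fun r hr =>
    norm_sub_le_supDist hx hy ⟨le_min hr.1 ht.1, (min_le_left _ _).trans hr.2⟩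

theorem lscEnv_le_of_frequently {u : ℝ → Path d → EReal} {t₀ : ℝ} {x₀ : Path d} {c : EReal}
    {tn : ℕ → ℝ} {xn : ℕ → Path d} (htn : ∀ n, tn n ∈ Icc 0 T) (hxn : ∀ n, xn n ∈ Cadlag T d)
    (hd : Tendsto (fun n => dInf T d (t₀, x₀) (tn n, xn n)) atTop (𝓝 0))
    (hu : ∃ᶠ n in atTop, u (tn n) (xn n) ≤ c) : lscEnv T d u t₀ x₀ ≤ c := by
  refine iSup₂_le fun δ hδ => ?_
  obtain ⟨n, hn, hn'⟩ := (hu.and_eventually (hd.eventually_lt_const hδ)).exists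
  refine le_trans (sInf_le ?_) hn
  exact ⟨tn n, htn n, xn n, hxn n, hn', rfl⟩

theorem lscEnv_le_self (u : ℝ → Path d → EReal) {t₀ : ℝ} (ht₀ : t₀ ∈ Icc 0 T) {x₀ : Path d}
    (hx₀ : x₀ ∈ Cadlag T d) : lscEnv T d u t₀ x₀ ≤ u t₀ x₀ := by
  refine lscEnv_le_of_frequently (tn := fun _ => t₀) (xn := fun _ => x₀) (fun _ => ht₀)
    (fun _ => hx₀) ?_ (Eventually.frequently (Eventually.of_forall fun _ => le_rfl))
  rw [dInf_self (ht₀.1.trans ht₀.2)]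
  exact tendsto_const_nhds

theorem lscEnv_congr (u : ℝ → Path d → EReal) {t₀ : ℝ} (ht₀ : 0 ≤ t₀) {x₀ x₀' : Path d}
    (h : ∀ s ∈ Icc 0 t₀, x₀ s = x₀' s) : lscEnv T d u t₀ x₀ = lscEnv T d u t₀ x₀' := by
  simp only [lscEnv, dInf_congr ht₀ h]

theorem exists_seq_of_lscEnv_lt {u : ℝ → Path d → EReal} {t₀ : ℝ} {x₀ : Path d} {c : EReal}
    (h : lscEnv T d u t₀ x₀ < c) {ρ : ℝ} (hρ : 0 < ρ) :
    ∃ (tn : ℕ → ℝ) (xn : ℕ → Path d), (∀ n, tn n ∈ Icc 0 T) ∧ (∀ n, xn n ∈ Cadlag T d) ∧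
      (∀ n, |t₀ - tn n| < ρ) ∧ Tendsto tn atTop (𝓝 t₀) ∧
      Tendsto (fun n => stopDist T d t₀ x₀ (tn n) (xn n)) atTop (𝓝 0) ∧
      ∀ n, u (tn n) (xn n) < c := by
  have key : ∀ δ > 0, ∃ t ∈ Icc 0 T, ∃ x ∈ Cadlag T d, dInf T d (t₀, x₀) (t, x) < δ ∧ u t x < c := by
    intro δ hδ
    have h1 := (le_iSup₂ (f := fun δ (_ : δ ∈ Ioi (0 : ℝ)) => sInf {v : EReal | ∃ t ∈ Icc (0 : ℝ) T,
      ∃ x ∈ Cadlag T d, dInf T d (t₀, x₀) (t, x) < δ ∧ v = u t x}) δ hδ).trans_lt h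
    obtain ⟨_, ⟨t, ht, x, hx, hd, rfl⟩, hlt⟩ := sInf_lt_iff.1 h1
    exact ⟨t, ht, x, hx, hd, hlt⟩
  choose tn htn xn hxn hd hlt using fun n : ℕ =>
    key (min (1 / ((n : ℝ) + 1)) ρ) (lt_min (by positivity) hρ)
  have h1 : ∀ n, |t₀ - tn n| ≤ dInf T d (t₀, x₀) (tn n, xn n) := fun n =>
    le_add_of_nonneg_right (stopDist_nonneg _ _ _ _)
  have h2 : ∀ n, stopDist T d t₀ x₀ (tn n) (xn n) ≤ dInf T d (t₀, x₀) (tn n, xn n) := fun n =>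
    le_add_of_nonneg_left (abs_nonneg _)
  have h3 : ∀ n, dInf T d (t₀, x₀) (tn n, xn n) ≤ 1 / ((n : ℝ) + 1) := fun n =>
    (hd n).le.trans (min_le_left _ _)
  have h0 := tendsto_one_div_add_atTop_nhds_zero_nat (𝕜 := ℝ)
  refine ⟨tn, xn, htn, hxn, fun n => ((h1 n).trans_lt (hd n)).trans_le (min_le_right _ _), ?_, ?_,
    hlt⟩
  · rw [tendsto_iff_norm_sub_tendsto_zero]
    refine squeeze_zero (fun n => norm_nonneg _) (fun n => ?_) h0
    rw [Real.norm_eq_abs, abs_sub_comm]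
    exact (h1 n).trans (h3 n)
  · exact squeeze_zero (fun n => stopDist_nonneg _ _ _ _) (fun n => (h2 n).trans (h3 n)) h0

/-- The lower semicontinuous envelope of a supersolution is a supersolution. -/
theorem NCSuper.lscEnv (hH : Hyp T d H LH CH M) {h : Path d → ℝ} (hh : TermCont T d h)
    {u : ℝ → Path d → EReal} (hu : NCSuper T d H h LH u) :
    NCSuper T d H h LH (lscEnv T d u) := by
  have hT := hH.pos.le
  have hTT : T ∈ Icc 0 T := ⟨hT, le_rfl⟩
  rw [ncSuper_iff] at hu
  refine ncSuper_iff.2 ⟨fun x hx => le_antisymm ?_ (le_of_not_gt fun hlt => ?_), ?_⟩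
  · exact (lscEnv_le_self u hTT hx).trans (hu.1 x hx).le
  · obtain ⟨c, hc, hch⟩ := EReal.exists_between_coe_real hlt
    rw [EReal.coe_lt_coe_iff] at hch
    obtain ⟨tn, xn, htn, hxn, -, hlim, hd, huc⟩ := exists_seq_of_lscEnv_lt hc one_pos
    have key : ∀ n : ℕ, ∃ p ∈ YSet T d H LH (tn n) (xn n) c 0,
        h p.1 ≤ p.2 T + 1 / ((n : ℝ) + 1) := by
      intro n
      rcases (htn n).2.eq_or_lt with heq | hlt'
      · obtain ⟨p, hp, -⟩ := hH.exists_common_pair (htn n) (hxn n) c 0 0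
        refine ⟨p, hp, ?_⟩
        have h1 : h p.1 = h (xn n) := hh.congr hT hp.1 (hxn n) fun t ht =>
          hp.2.1 t ⟨ht.1, by rw [heq]; exact ht.2⟩
        have h2 := ((mem_YSet_iff hH (htn n)).1 hp).2.init (htn n).2
        have h3 := huc n
        rw [heq, hu.1 _ (hxn n), EReal.coe_lt_coe_iff] at h3
        rw [heq] at h2
        have : 0 ≤ 1 / ((n : ℝ) + 1) := by positivity
        linarith
      · obtain ⟨p, hp, hp'⟩ := hu.2 _ ⟨(htn n).1, hlt'⟩ _ (hxn n) 0 c (huc n) T ⟨hlt', le_rfl⟩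
          (1 / ((n : ℝ) + 1)) (by positivity)
        rw [hu.1 _ hp.1, EReal.coe_lt_coe_iff] at hp'
        exact ⟨p, hp, hp'.le⟩
    choose P hP hPh using key
    obtain ⟨φ, hφ, p, hp, hpd, hpy⟩ := YSet.exists_subseq hH htn hTT hlim hxn hx hd
      tendsto_const_nhds hP
    have h1 := hpy T ⟨le_rfl, le_rfl⟩
    simp only [max_eq_left (htn _).2] at h1
    rw [((mem_YSet_iff hH hTT).1 hp).2.init le_rfl] at h1
    have h2 := h1.add ((tendsto_one_div_add_atTop_nhds_zero_nat (𝕜 := ℝ)).comp hφ.tendsto_atTop)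
    have h3 := hh.tendsto hp.1 (fun n => (hP (φ n)).1) hpd
    have h4 := le_of_tendsto_of_tendsto' h3 h2 fun n => hPh (φ n)
    rw [hh.congr hT hp.1 hx fun t ht => hp.2.1 t ht, add_zero] at h4
    linarith
  · intro t₀ ht₀ x₀ hx₀ z y₀ hlt T₀ hT₀ ε hε
    obtain ⟨tn, xn, htn, hxn, htρ, hlim, hd, huc⟩ :=
      exists_seq_of_lscEnv_lt hlt (sub_pos.2 hT₀.1)
    have htT₀ : ∀ n, tn n < T₀ := fun n => by linarith [(abs_lt.1 (htρ n)).1]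
    choose P hP hPu using fun n => hu.2 (tn n) ⟨(htn n).1, (htT₀ n).trans_le hT₀.2⟩ (xn n) (hxn n)
      z y₀ (huc n) T₀ ⟨htT₀ n, hT₀.2⟩ (ε / 2) (by positivity)
    obtain ⟨φ, hφ, p, hp, hpd, hpy⟩ := YSet.exists_subseq hH htn ⟨ht₀.1, ht₀.2.le⟩ hlim hxn hx₀ hd
      tendsto_const_nhds hP
    have h1 := hpy T₀ ⟨hT₀.1.le, hT₀.2⟩
    simp only [max_eq_left (htT₀ _).le] at h1
    have hT₀' : T₀ ∈ Icc 0 T := ⟨ht₀.1.trans hT₀.1.le, hT₀.2⟩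
    refine ⟨p, hp, lt_of_le_of_lt ?_ (EReal.coe_lt_coe_iff.2
      (by linarith : p.2 T₀ + 3 / 4 * ε < p.2 T₀ + ε))⟩
    refine lscEnv_le_of_frequently (tn := fun _ => T₀) (xn := fun n => (P (φ n)).1) (fun _ => hT₀')
      (fun n => (hP (φ n)).1) ?_ (Eventually.frequently ?_)
    · refine squeeze_zero (fun n => add_nonneg (abs_nonneg _) (stopDist_nonneg _ _ _ _))
        (fun n => dInf_le_supDist hT₀' hp.1 (hP (φ n)).1) hpd
    · filter_upwards [h1.eventually_lt_const (by linarith : p.2 T₀ < p.2 T₀ + ε / 4)] with n hn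
      refine (hPu (φ n)).le.trans (EReal.coe_le_coe_iff.2 ?_)
      linarith

theorem LscOn.of_le_lscEnv {u : ℝ → Path d → ℝ}
    (hu : ∀ t ∈ Icc 0 T, ∀ x ∈ Cadlag T d,
      ((u t x : ℝ) : EReal) ≤ PHJ.lscEnv T d (fun t x => ((u t x : ℝ) : EReal)) t x) :
    LscOn T d u := by
  intro t₀ ht₀ x₀ hx₀ c hc
  have h0 := (EReal.coe_lt_coe_iff.2 hc).trans_le (hu t₀ ht₀ x₀ hx₀)
  simp only [PHJ.lscEnv, lt_iSup_iff] at h0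
  obtain ⟨δ, hδ, h1⟩ := h0
  refine ⟨δ, hδ, fun t ht x hx hd => EReal.coe_lt_coe_iff.1 (h1.trans_le (sInf_le ?_))⟩
  exact ⟨t, ht, x, hx, hd, rfl⟩

theorem LscOn.le_of_agree {u : ℝ → Path d → ℝ} (hu : LscOn T d u) {t : ℝ} (ht : t ∈ Icc 0 T)
    {x x' : Path d} (hx : x ∈ Cadlag T d) (hx' : x' ∈ Cadlag T d)
    (h : ∀ s ∈ Icc 0 t, x s = x' s) : u t x ≤ u t x' := by
  refine le_of_forall_lt fun c hc => ?_
  obtain ⟨δ, hδ, h1⟩ := hu t ht x hx c hc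
  refine h1 t ht x' hx' ?_
  rw [dInf_congr ht.1 h, dInf_self (ht.1.trans ht.2)]
  exact hδ

theorem LscOn.le_of_tendsto {u : ℝ → Path d → ℝ} (hu : LscOn T d u) {t : ℝ} (ht : t ∈ Icc 0 T)
    {x : Path d} (hx : x ∈ Cadlag T d) {X : ℕ → Path d} (hX : ∀ n, X n ∈ Cadlag T d)
    (hd : Tendsto (fun n => supDist T d x (X n)) atTop (𝓝 0)) {a : ℕ → ℝ} {b : ℝ}
    (ha : Tendsto a atTop (𝓝 b)) (h : ∀ᶠ n in atTop, u t (X n) ≤ a n) : u t x ≤ b := by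
  by_contra! hlt
  obtain ⟨c, hbc, hc⟩ := exists_between hlt
  obtain ⟨δ, hδ, h1⟩ := hu t ht x hx c hc
  obtain ⟨n, ⟨hn1, hn2⟩, hn3⟩ :=
    ((h.and (hd.eventually_lt_const hδ)).and (ha.eventually_lt_const hbc)).exists
  have := h1 t ht (X n) (hX n) ((dInf_le_supDist ht hx (hX n)).trans_lt hn2)
  linarith

theorem XSet.dInf_le {L R t₀ : ℝ} (hL : 0 ≤ L) (ht₀ : t₀ ∈ Icc 0 T) {x₀ x : Path d}
    (hx : x ∈ XSet T d L t₀ x₀) (hR : runSup d x T ≤ R) {s t : ℝ} (hs : t₀ ≤ s) (ht : t₀ ≤ t) :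
    dInf T d (t, x) (s, x) ≤ (1 + L * (1 + R)) * |t - s| := by
  have hT := ht₀.1.trans ht₀.2
  have h0 : supDist T d x x ≤ 0 := supDist_le hT fun r _ => by simp
  have key : stopDist T d t x s x ≤ L * (1 + R) * |t - s| := by
    rw [stopDist_eq_supDist]
    rcases le_total s t with hst | hst
    · have := supDist_stop_le hT hL ht₀ hx.1 hx hR hs hst
      rw [abs_of_nonneg (sub_nonneg.2 hst)]
      linarith
    · have := supDist_stop_le hT hL ht₀ hx.1 hx hR ht hst
      rw [abs_of_nonpos (sub_nonpos.2 hst), neg_sub, supDist_comm]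
      linarith
  simp only [dInf]
  linarith

theorem NCSuper.exists_le (hH : Hyp T d H LH CH M) {h : Path d → ℝ} {u : ℝ → Path d → ℝ}
    (hu : LscOn T d u) (hn : NCSuper T d H h LH fun t x => ((u t x : ℝ) : EReal)) {s : ℝ}
    (hs : s ∈ Ico 0 T) {x : Path d} (hx : x ∈ Cadlag T d) (z : E d) {y : ℝ} (hy : u s x ≤ y)
    {t : ℝ} (ht : t ∈ Ioc s T) :
    ∃ p ∈ YSet T d H LH s x y z, u t p.1 ≤ p.2 t := by
  have hs' : s ∈ Icc 0 T := ⟨hs.1, hs.2.le⟩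
  have ht' : t ∈ Icc 0 T := ⟨hs.1.trans ht.1.le, ht.2⟩
  rw [ncSuper_iff] at hn
  choose P hP hPu using fun n : ℕ => hn.2 s hs x hx z (y + 1 / ((n : ℝ) + 1))
    (EReal.coe_lt_coe_iff.2 (hy.trans_lt (lt_add_of_pos_right _ (by positivity)))) t ht
    (1 / ((n : ℝ) + 1)) (by positivity)
  have h0 := tendsto_one_div_add_atTop_nhds_zero_nat (𝕜 := ℝ)
  have hd : stopDist T d s x s x = 0 :=
    le_antisymm (stopDist_le hH.pos.le fun r _ => by simp) (stopDist_nonneg _ _ _ _)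
  obtain ⟨φ, hφ, p, hp, hpd, hpy⟩ := YSet.exists_subseq hH (fun _ => hs') hs' tendsto_const_nhds
    (fun _ => hx) hx (by rw [hd]; exact tendsto_const_nhds)
    (by simpa using tendsto_const_nhds.add h0) hP
  refine ⟨p, hp, hu.le_of_tendsto ht' hp.1 (fun n => (hP (φ n)).1) hpd
    (by simpa using (hpy t ⟨ht.1.le, ht.2⟩).add (h0.comp hφ.tendsto_atTop))
    (Eventually.of_forall fun n => ?_)⟩
  have := (EReal.coe_lt_coe_iff.1 (hPu (φ n))).le
  simpa [max_eq_left ht.1.le] using this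

theorem NCSuper.exists_le_finset (hH : Hyp T d H LH CH M) {h : Path d → ℝ} {u : ℝ → Path d → ℝ}
    (hu : LscOn T d u) (hn : NCSuper T d H h LH fun t x => ((u t x : ℝ) : EReal)) {s : ℝ}
    (hs : s ∈ Ico 0 T) {x : Path d} (hx : x ∈ Cadlag T d) (z : E d) {y : ℝ} (hy : u s x ≤ y)
    (F : Finset ℝ) (hF : ∀ t ∈ F, t ∈ Icc s T) :
    ∃ p ∈ YSet T d H LH s x y z, ∀ t ∈ insert s F, u t p.1 ≤ p.2 t := by
  have hs' : s ∈ Icc 0 T := ⟨hs.1, hs.2.le⟩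
  induction F using Finset.induction_on_max with
  | empty =>
    obtain ⟨p, hp, -⟩ := hH.exists_common_pair hs' hx y z z
    refine ⟨p, hp, fun t ht => ?_⟩
    obtain rfl : t = s := by simpa using ht
    rw [((mem_YSet_iff hH hs').1 hp).2.init hs.2.le]
    exact (hu.le_of_agree hs' hp.1 hx hp.2.1).trans hy
  | insert a F hlt ih =>
    obtain ⟨p, hp, hpu⟩ := ih fun t ht => hF t (Finset.mem_insert_of_mem ht)
    have ha := hF a (Finset.mem_insert_self _ _)
    set b := (insert s F).max' (Finset.insert_nonempty s F) with hb
    have hbm : b ∈ insert s F := Finset.max'_mem _ _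
    have hle : ∀ t ∈ insert s F, t ≤ b := fun t ht => Finset.le_max' _ _ ht
    have hsb : s ≤ b := hle s (Finset.mem_insert_self _ _)
    have hba : b ≤ a := by
      rcases Finset.mem_insert.1 hbm with h1 | h1
      · rw [h1]; exact ha.1
      · exact (hlt b h1).le
    rcases hba.eq_or_lt with hab | hab
    · refine ⟨p, hp, fun t ht => hpu t ?_⟩
      rw [Finset.insert_comm, Finset.mem_insert] at ht
      rcases ht with rfl | ht
      · rwa [← hab]
      · exact ht
    · have hbT : b ∈ Ico 0 T := ⟨hs.1.trans hsb, hab.trans_le ha.2⟩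
      have hbT' : b ∈ Icc 0 T := ⟨hbT.1, hbT.2.le⟩
      obtain ⟨q, hq, hqu⟩ := NCSuper.exists_le hH hu hn hbT hp.1 z (hpu b hbm) ⟨hab, ha.2⟩
      refine ⟨_, YSet.trans hH hs' ⟨hsb, hbT.2.le⟩ hx hp hq, fun t ht => ?_⟩
      rw [Finset.insert_comm, Finset.mem_insert] at ht
      rcases ht with rfl | ht
      · simpa only [if_neg hab.not_ge] using hqu
      · have htb := hle t ht
        have ht0 : s ≤ t := by
          rcases Finset.mem_insert.1 ht with h1 | h1
          · exact h1.ge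
          · exact (hF t (Finset.mem_insert_of_mem h1)).1
        simp only [if_pos htb]
        exact (hu.le_of_agree ⟨hs.1.trans ht0, htb.trans hbT.2.le⟩ hq.1 hp.1
          fun r hr => hq.2.1 r ⟨hr.1, hr.2.trans htb⟩).trans (hpu t ht)

/-- A lower semicontinuous supersolution in the non-continuous sense satisfies the pathwise
minimax property. -/
theorem NCSuper.exists_forall_le (hH : Hyp T d H LH CH M) {h : Path d → ℝ}
    {u : ℝ → Path d → ℝ} (hu : LscOn T d u)
    (hn : NCSuper T d H h LH fun t x => ((u t x : ℝ) : EReal)) {s : ℝ}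
    (hs : s ∈ Ico 0 T) {x : Path d} (hx : x ∈ Cadlag T d) (z : E d) {y : ℝ} (hy : u s x ≤ y) :
    ∃ p ∈ YSet T d H LH s x y z, ∀ t ∈ Icc s T, u t p.1 ≤ p.2 t := by
  have hs' : s ∈ Icc 0 T := ⟨hs.1, hs.2.le⟩
  have : Nonempty (Icc s T) := ⟨⟨s, le_rfl, hs.2.le⟩⟩
  set q : ℕ → Icc s T := TopologicalSpace.denseSeq (Icc s T)
  choose P hP hPu using fun n : ℕ => NCSuper.exists_le_finset hH hu hn hs hx z hy
    ((Finset.range n).image fun k => (q k : ℝ)) (fun t ht => by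
      obtain ⟨k, -, rfl⟩ := Finset.mem_image.1 ht
      exact (q k).2)
  have hd : stopDist T d s x s x = 0 :=
    le_antisymm (stopDist_le hH.pos.le fun r _ => by simp) (stopDist_nonneg _ _ _ _)
  obtain ⟨φ, hφ, p, hp, hpd, hpy⟩ := YSet.exists_subseq hH (fun _ => hs') hs' tendsto_const_nhds
    (fun _ => hx) hx (by rw [hd]; exact tendsto_const_nhds) tendsto_const_nhds hP
  have hq : ∀ k, u (q k) p.1 ≤ p.2 (q k) := by
    intro k
    refine hu.le_of_tendsto ⟨hs.1.trans (q k).2.1, (q k).2.2⟩ hp.1 (fun n => (hP (φ n)).1) hpd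
      (hpy _ (q k).2) ?_
    filter_upwards [hφ.tendsto_atTop.eventually_gt_atTop k] with n hk
    rw [max_eq_left (q k).2.1]
    exact hPu (φ n) _ (Finset.mem_insert_of_mem
      (Finset.mem_image_of_mem _ (Finset.mem_range.2 hk)))
  refine ⟨p, hp, fun t ht => ?_⟩
  by_contra! hlt
  obtain ⟨c, hbc, hc⟩ := exists_between hlt
  obtain ⟨δ, hδ, h1⟩ := hu t ⟨hs.1.trans ht.1, ht.2⟩ p.1 hp.1 c hc
  have hX := ((mem_YSet_iff hH hs').1 hp).1
  have hcont : ContinuousOn p.2 (Icc s T) := hp.2.2.1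
  have h2 : ∀ᶠ r : Icc s T in 𝓝 ⟨t, ht⟩, p.2 r < c :=
    (continuousOn_iff_continuous_domRestrict.1 hcont).continuousAt.eventually_lt_const hbc
  have h3 : Tendsto (fun r : Icc s T => (1 + LH * (1 + runSup d p.1 T)) * |t - r|) (𝓝 ⟨t, ht⟩)
      (𝓝 0) := by
    have : Continuous fun r : Icc s T => (1 + LH * (1 + runSup d p.1 T)) * |t - r| := by fun_prop
    simpa using this.tendsto ⟨t, ht⟩
  obtain ⟨_, hr, ⟨k, rfl⟩⟩ := (mem_closure_iff_nhds.1
    (TopologicalSpace.denseRange_denseSeq (Icc s T) ⟨t, ht⟩)) _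
    (h2.and (h3.eventually_lt_const hδ))
  have h4 := h1 (q k) ⟨hs.1.trans (q k).2.1, (q k).2.2⟩ p.1 hp.1
    ((XSet.dInf_le hH.lipZ.1 hs' hX le_rfl (q k).2.1 ht.1).trans_lt hr.2)
  exact (h4.trans_le (hq k)).not_gt hr.1

theorem NCSuper.minimaxSuper (hH : Hyp T d H LH CH M) {h : Path d → ℝ}
    {u : ℝ → Path d → ℝ} (hu : LscOn T d u)
    (hn : NCSuper T d H h LH fun t x => ((u t x : ℝ) : EReal)) : MinimaxSuper T d H h LH u :=
  ⟨hu, fun x hx => (EReal.coe_le_coe_iff.1 (hn.1 x hx).ge),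
    fun _ hs _ hx z _ hy => NCSuper.exists_forall_le hH hu hn hs hx z hy⟩

theorem NCSuper.congr {h : Path d → ℝ} {L : ℝ} {u u' : ℝ → Path d → EReal} (hT : 0 ≤ T)
    (hu : NCSuper T d H h L u) (heq : ∀ t ∈ Icc 0 T, ∀ x ∈ Cadlag T d, u t x = u' t x) :
    NCSuper T d H h L u' := by
  rw [ncSuper_iff] at hu ⊢
  refine ⟨fun x hx => by rw [← heq T ⟨hT, le_rfl⟩ x hx, hu.1 x hx], ?_⟩
  intro t₀ ht₀ x₀ hx₀ z y₀ hlt T₀ hT₀ ε hε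
  rw [← heq t₀ ⟨ht₀.1, ht₀.2.le⟩ x₀ hx₀] at hlt
  obtain ⟨p, hp, hpu⟩ := hu.2 t₀ ht₀ x₀ hx₀ z y₀ hlt T₀ hT₀ ε hε
  exact ⟨p, hp, by rwa [← heq T₀ ⟨ht₀.1.trans hT₀.1.le, hT₀.2⟩ _ hp.1]⟩

theorem MinimaxSuper.ncSuper {h : Path d → ℝ} {L : ℝ} {u : ℝ → Path d → ℝ}
    (hu : MinimaxSuper T d H h L u) (huT : ∀ x ∈ Cadlag T d, u T x ≤ h x) :
    NCSuper T d H h L fun t x => ((u t x : ℝ) : EReal) := by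
  refine ncSuper_iff.2
    ⟨fun x hx => by rw [le_antisymm (huT x hx) (hu.2.1 x hx)], ?_⟩
  intro t₀ ht₀ x₀ hx₀ z y₀ hlt T₀ hT₀ ε hε
  obtain ⟨p, hp, hpu⟩ := hu.2.2 t₀ ht₀ x₀ hx₀ z y₀ (EReal.coe_lt_coe_iff.1 hlt).le
  have := hpu T₀ ⟨hT₀.1.le, hT₀.2⟩
  exact ⟨p, hp, EReal.coe_lt_coe_iff.2 (by linarith)⟩

theorem uscOn_iff_lscOn_neg {u : ℝ → Path d → ℝ} : UscOn T d u ↔ LscOn T d (-u) := by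
  constructor <;> intro hu t₀ ht₀ x₀ hx₀ c hc
  · obtain ⟨δ, hδ, h1⟩ := hu t₀ ht₀ x₀ hx₀ (-c) (by simp only [Pi.neg_apply] at hc; linarith)
    refine ⟨δ, hδ, fun t ht x hx hd => ?_⟩
    have := h1 t ht x hx hd
    simp only [Pi.neg_apply]; linarith
  · obtain ⟨δ, hδ, h1⟩ := hu t₀ ht₀ x₀ hx₀ (-c) (by simp only [Pi.neg_apply]; linarith)
    refine ⟨δ, hδ, fun t ht x hx hd => ?_⟩
    have := h1 t ht x hx hd
    simp only [Pi.neg_apply] at this; linarith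

theorem minimaxSub_iff_neg (hH : Hyp T d H LH CH M) {h : Path d → ℝ} {u : ℝ → Path d → ℝ} :
    MinimaxSub T d H h LH u ↔ MinimaxSuper T d (negHam H) (-h) LH (-u) := by
  refine and_congr uscOn_iff_lscOn_neg (and_congr ?_ ?_)
  · simp only [Pi.neg_apply, neg_le_neg_iff]
  · constructor <;> intro hu s₀ hs₀ x₀ hx₀ z y₀ hy
    · obtain ⟨p, hp, hpu⟩ := hu s₀ hs₀ x₀ hx₀ (-z) (-y₀) (by
        simp only [Pi.neg_apply] at hy; linarith)
      have := YSet.neg hH ⟨hs₀.1, hs₀.2.le⟩ hp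
      rw [neg_neg, neg_neg] at this
      exact ⟨_, this, fun t ht => neg_le_neg (hpu t ht)⟩
    · obtain ⟨p, hp, hpu⟩ := hu s₀ hs₀ x₀ hx₀ (-z) (-y₀) (neg_le_neg hy)
      refine ⟨_, YSet.of_neg hH ⟨hs₀.1, hs₀.2.le⟩ hp, fun t ht => ?_⟩
      have := hpu t ht
      simp only [Pi.neg_apply] at this ⊢
      linarith

theorem le_lscEnv_uZero (hH : Hyp T d H LH CH M) {h : Path d → ℝ} (hh : TermCont T d h)
    (t : ℝ) (x : Path d) :
    uZero T d H h LH t x ≤ lscEnv T d (uZero T d H h LH) t x :=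
  uZero_le ((uZero_ncSuper T H h LH).lscEnv hH hh) t x

theorem neg_uZero_le_lscEnv (hH : Hyp T d H LH CH M) {h : Path d → ℝ} (hh : TermCont T d h)
    {t : ℝ} (ht : t ∈ Icc 0 T) {x : Path d} (hx : x ∈ Cadlag T d) :
    -uZero T d H h LH t x ≤ lscEnv T d (fun t x => -uZero T d H h LH t x) t x := by
  have h1 := NCSuper.comparison hH hh (uZero_ncSuper T H h LH)
    ((uZero_neg_ncSuper hH h).lscEnv hH.neg hh.neg) ht hx
  exact EReal.neg_le_of_neg_le h1

theorem NCSuper.bot_lt_lscEnv (hH : Hyp T d H LH CH M) {h : Path d → ℝ} (hh : TermCont T d h)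
    {u : ℝ → Path d → EReal} (hu : NCSuper T d H h LH u) {t : ℝ} (ht : t ∈ Icc 0 T)
    {x : Path d} (hx : x ∈ Cadlag T d) : ⊥ < PHJ.lscEnv T d u t x := by
  obtain ⟨Y, hY⟩ := (hu.lscEnv hH hh).exists_lower_bound hH hh ht hx
  have hc := XSet.const hH.lipZ.1 ht hx
  rw [lscEnv_congr u ht.1 (x₀' := fun s => x (min s t)) fun s hs => by rw [min_eq_left hs.2]]
  exact (EReal.bot_lt_coe _).trans_le (hY t ⟨le_rfl, ht.2⟩ _ hc)

theorem coe_toReal_uZero (hH : Hyp T d H LH CH M) {h : Path d → ℝ} (hh : TermCont T d h)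
    {t : ℝ} (ht : t ∈ Icc 0 T) {x : Path d} (hx : x ∈ Cadlag T d) :
    (((uZero T d H h LH t x).toReal : ℝ) : EReal) = uZero T d H h LH t x := by
  have h1 := ((uZero_ncSuper T H h LH).bot_lt_lscEnv hH hh ht hx).trans_le
    (lscEnv_le_self _ ht hx)
  have h2 := ((uZero_neg_ncSuper hH h).bot_lt_lscEnv hH.neg hh.neg ht hx).trans_le
    (lscEnv_le_self _ ht hx)
  refine EReal.coe_toReal (fun h3 => ?_) h1.ne'
  rw [h3] at h2
  simp at h2

theorem lscEnv_congr_fun {u u' : ℝ → Path d → EReal}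
    (heq : ∀ t ∈ Icc 0 T, ∀ x ∈ Cadlag T d, u t x = u' t x) : lscEnv T d u = lscEnv T d u' := by
  funext t₀ x₀
  have : ∀ δ : ℝ, {v : EReal | ∃ t ∈ Icc (0 : ℝ) T, ∃ x ∈ Cadlag T d,
      dInf T d (t₀, x₀) (t, x) < δ ∧ v = u t x} = {v : EReal | ∃ t ∈ Icc (0 : ℝ) T,
      ∃ x ∈ Cadlag T d, dInf T d (t₀, x₀) (t, x) < δ ∧ v = u' t x} := by
    intro δ
    ext v
    constructor
    · rintro ⟨t, ht, x, hx, hd, rfl⟩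
      exact ⟨t, ht, x, hx, hd, heq t ht x hx⟩
    · rintro ⟨t, ht, x, hx, hd, rfl⟩
      exact ⟨t, ht, x, hx, hd, (heq t ht x hx).symm⟩
  simp only [lscEnv, this]

theorem minimaxSuper_toReal (hH : Hyp T d H LH CH M) {h : Path d → ℝ} {u : ℝ → Path d → EReal}
    {v : ℝ → Path d → ℝ} (hu : NCSuper T d H h LH u)
    (heq : ∀ t ∈ Icc 0 T, ∀ x ∈ Cadlag T d, u t x = ((v t x : ℝ) : EReal))
    (hle : ∀ t ∈ Icc 0 T, ∀ x ∈ Cadlag T d, u t x ≤ lscEnv T d u t x) :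
    MinimaxSuper T d H h LH v := by
  refine NCSuper.minimaxSuper hH (LscOn.of_le_lscEnv fun t ht x hx => ?_)
    (hu.congr hH.pos.le heq)
  rw [← lscEnv_congr_fun heq, ← heq t ht x hx]
  exact hle t ht x hx

theorem minimaxSol_toReal_uZero (hH : Hyp T d H LH CH M) {h : Path d → ℝ}
    (hh : TermCont T d h) :
    MinimaxSol T d H h LH fun t x => (uZero T d H h LH t x).toReal := by
  refine ⟨minimaxSuper_toReal hH (uZero_ncSuper T H h LH)
    (fun t ht x hx => (coe_toReal_uZero hH hh ht hx).symm)
    fun t _ x _ => le_lscEnv_uZero hH hh t x, (minimaxSub_iff_neg hH).2 ?_⟩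
  refine minimaxSuper_toReal hH.neg (uZero_neg_ncSuper hH h) (fun t ht x hx => ?_)
    fun t ht x hx => neg_uZero_le_lscEnv hH hh ht hx
  simp only [Pi.neg_apply, EReal.coe_neg, coe_toReal_uZero hH hh ht hx]

theorem MinimaxSol.le (hH : Hyp T d H LH CH M) {h : Path d → ℝ} (hh : TermCont T d h)
    {u u' : ℝ → Path d → ℝ} (hu : MinimaxSol T d H h LH u) (hu' : MinimaxSol T d H h LH u')
    {t : ℝ} (ht : t ∈ Icc 0 T) {x : Path d} (hx : x ∈ Cadlag T d) : u' t x ≤ u t x := by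
  have h1 := NCSuper.comparison hH hh (hu.1.ncSuper hu.2.2.1)
    (((minimaxSub_iff_neg hH).1 hu'.2).ncSuper fun x hx => neg_le_neg (hu'.1.2.1 x hx)) ht hx
  simpa using h1

end

/-- There exists a unique minimax `L_H`-solution of (TVP), and it
coincides with `u₀`, the pointwise infimum of all non-continuous minimax
`L_H`-supersolutions. -/
theorem perron_existence_uniqueness (T : ℝ) (hT : 0 < T) (d : ℕ) (hd : 1 ≤ d)
    (H : Ham d) (LH CH : ℝ) (M : ℝ → ℝ)
    (hH1 : HamCont T d H) (hH2 : HamMeas d H) (hH3 : HamLipZ T d H LH)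
    (hH4 : HamLipX T d H M) (hH5 : HamMono T d H) (hH6 : HamBound T d H CH)
    (h : Path d → ℝ) (hh : TermCont T d h) :
    (∃ u : ℝ → Path d → ℝ, MinimaxSol T d H h LH u ∧
      ∀ t ∈ Icc (0 : ℝ) T, ∀ x ∈ Cadlag T d, ((u t x : ℝ) : EReal) = uZero T d H h LH t x) ∧
    ∀ u u' : ℝ → Path d → ℝ, MinimaxSol T d H h LH u → MinimaxSol T d H h LH u' →
      ∀ t ∈ Icc (0 : ℝ) T, ∀ x ∈ Cadlag T d, u t x = u' t x := by
  have hH : Hyp T d H LH CH M := ⟨hT, hH1, hH2, hH3, hH4, hH5, hH6⟩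
  exact ⟨⟨_, minimaxSol_toReal_uZero hH hh, fun t ht x hx => coe_toReal_uZero hH hh ht hx⟩,
    fun u u' hu hu' t ht x hx => le_antisymm (MinimaxSol.le hH hh hu' hu ht hx)
      (MinimaxSol.le hH hh hu hu' ht hx)⟩

end PHJ
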